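/- arXiv:1904.06911 — 3 statements merged into one kernel-verified Lean document; each statement's English description precedes it below -/
import Mathlib

section
/- Let m be an even positive integer, let P be a centrally symmetric convex polygon in ℝ² with exactly 2m vertices centered at the origin, and let Λ ⊆ ℝ² be a lattice such that P + Λ is a k-fold lattice tiling of ℝ² for some positive integer k. Then P has an edge that is a lattice vector of Λ; that is, there are two adjacent vertices v_i, v_{i+1} of P with v_{i+1} − v_i ∈ Λ. -/
open Set Pointwise

noncomputable section

/-- A point of the plane `ℝ²`. -/
abbrev Pt : Type := ℝ × ℝ

/-- The standard integer lattice `ℤ² ⊆ ℝ²`. -/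
def IntLattice : Set Pt := {p : Pt | ∃ a b : ℤ, p = ((a : ℝ), (b : ℝ))}

/-- A lattice in `ℝ²` is the image of `ℤ²` under an invertible linear map. -/
def IsLattice (L : Set Pt) : Prop :=
  ∃ B : Pt ≃ₗ[ℝ] Pt, L = B '' IntLattice

/-- `K + L` is a `k`-fold lattice tiling of the plane: `L` is a lattice, every point lies in
at least `k` translates `K + l` (`l ∈ L`), and every point lies in at most `k` translates
`interior K + l`. -/
def IsKFoldLatticeTiling (K L : Set Pt) (k : ℕ) : Prop :=
  IsLattice L ∧
  (∀ p : Pt, (k : ℕ∞) ≤ {l ∈ L | p - l ∈ K}.encard) ∧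
  (∀ p : Pt, {l ∈ L | p - l ∈ interior K}.encard ≤ (k : ℕ∞))

/-- A discrete multiset of points of the plane, given as a family `x : I → ℝ²`:
every bounded set contains `x i` for only finitely many indices. -/
def IsDiscreteFamily {I : Type} (x : I → Pt) : Prop :=
  ∀ B : Set Pt, Bornology.IsBounded B → {i : I | x i ∈ B}.Finite

/-- `K + X` is a `k`-fold translative tiling of the plane, for the discrete multiset
`X = (x i)_{i ∈ I}`: every point lies in `K + x i` for at least `k` indices, and in
`interior K + x i` for at most `k` indices. -/
def IsKFoldTranslativeTiling {I : Type} (K : Set Pt) (x : I → Pt) (k : ℕ) : Prop :=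
  IsDiscreteFamily x ∧
  (∀ p : Pt, (k : ℕ∞) ≤ {i : I | p - x i ∈ K}.encard) ∧
  (∀ p : Pt, {i : I | p - x i ∈ interior K}.encard ≤ (k : ℕ∞))

/-- A convex polygon with exactly `n` vertices: a compact convex set with nonempty interior
which is the convex hull of its finitely many (`n`) extreme points. -/
def IsConvexPolygon (P : Set Pt) (n : ℕ) : Prop :=
  Convex ℝ P ∧ IsCompact P ∧ (interior P).Nonempty ∧
  (Set.extremePoints ℝ P).Finite ∧ (Set.extremePoints ℝ P).ncard = n ∧
  P = convexHull ℝ (Set.extremePoints ℝ P)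

/-- `[a, b]` is an edge of the polygon `P`: a nondegenerate segment which is an extreme
(face) subset of `P`. -/
def IsEdgeOf (P : Set Pt) (a b : Pt) : Prop :=
  a ≠ b ∧ IsExtreme ℝ P (segment ℝ a b)

/-- The set of midpoints of the edges of `P`. -/
def edgeMidpoints (P : Set Pt) : Set Pt :=
  {u : Pt | ∃ a b : Pt, IsEdgeOf P a b ∧ u = midpoint ℝ a b}

/-- `P` is centrally symmetric (about some center `c`). -/
def CentrallySymmetric (P : Set Pt) : Prop :=
  ∃ c : Pt, ∀ x : Pt, x ∈ P ↔ c + c - x ∈ P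

/-- `D` is a parallelogram. -/
def IsParallelogram (D : Set Pt) : Prop :=
  ∃ v a b : Pt, LinearIndependent ℝ ![a, b] ∧
    D = convexHull ℝ ({v, v + a, v + b, v + a + b} : Set Pt)

/-- The octagon `P₈(α)`, with vertices `±(α−1, 2), ±(α, −2), ±(1−α, 0), ±(1+α, −1)`. -/
def P8 (α : ℝ) : Set Pt :=
  convexHull ℝ ({(α - 1, 2), (α, -2), (1 - α, 0), (1 + α, -1),
                 (1 - α, -2), (-α, 2), (α - 1, 0), (-(1 + α), 1)} : Set Pt)

/-- The ten points `D₁`. -/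
def D1 : Set Pt :=
  {(-1, 1/2), (1/2, 1), (3/2, 1), (2, 1/2), (2, 0),
   (1, -1/2), (-1/2, -1), (-3/2, -1), (-2, -1/2), (-2, 0)}

/-- The ten points `D₂`. -/
def D2 : Set Pt :=
  {(1/2, -1), (3/2, -1/2), (2, 0), (3/2, 1/2), (1/2, 1),
   (-1/2, 1), (-3/2, 1/2), (-2, 0), (-3/2, -1/2), (-1/2, -1)}

/-- The set `(1/2)Λ = {λ/2 : λ ∈ Λ}`. -/
def halfSet (L : Set Pt) : Set Pt := (fun l : Pt => (2⁻¹ : ℝ) • l) '' L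

/-- A cyclic enumeration `v : ZMod n → ℝ²` of the vertices of a convex polygon `P` with `n`
vertices: `v` is injective, its range is the vertex set of `P`, and consecutive vertices are
joined by edges of `P`. -/
def IsCyclicVertexEnum (P : Set Pt) (n : ℕ) (v : ZMod n → Pt) : Prop :=
  Function.Injective v ∧ Set.range v = Set.extremePoints ℝ P ∧
  ∀ i : ZMod n, IsEdgeOf P (v i) (v (i + 1))


namespace EvenGon
open Filter Topology

/-- Planar determinant. -/
def det2 (u v : Pt) : ℝ := u.1 * v.2 - u.2 * v.1

lemma neg_mem_of_sym {P : Set Pt} (hsym : P = -P) {x : Pt} (hx : x ∈ P) : -x ∈ P := by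
  rw [hsym] at hx; simpa using hx

lemma neg_mem_int {P : Set Pt} (hsym : P = -P) {x : Pt} (hx : x ∈ interior P) :
    -x ∈ interior P := by
  have h1 : -interior P ⊆ interior P := by
    apply interior_maximal
    · intro y hy
      have := neg_mem_of_sym hsym (interior_subset (Set.mem_neg.1 hy))
      simpa using this
    · exact isOpen_interior.neg
  exact h1 (by simpa using hx)

lemma zero_mem_int {P : Set Pt} (hc : Convex ℝ P) (hsym : P = -P)
    (hne : (interior P).Nonempty) : (0 : Pt) ∈ interior P := by
  obtain ⟨x, hx⟩ := hne
  have h := hc.interior hx (neg_mem_int hsym hx) (a := 1/2) (b := 1/2)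
    (by norm_num) (by norm_num) (by norm_num)
  simpa using h

lemma smul_mem_int {P : Set Pt} (hc : Convex ℝ P) (h0 : (0 : Pt) ∈ interior P) {x : Pt}
    (hx : x ∈ P) {t : ℝ} (ht0 : 0 ≤ t) (ht1 : t < 1) : t • x ∈ interior P := by
  have := hc.combo_self_interior_mem_interior hx h0 ht0 (sub_pos.2 ht1) (by ring)
  simpa using this

lemma ext_ne_zero {P : Set Pt} (hsym : P = -P)
    (h0 : (0 : Pt) ∈ interior P) {v : Pt} (hv : v ∈ extremePoints ℝ P)
     : v ≠ 0 := by
  rintro rfl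
  have hn : ∃ e ∈ P, e ≠ (0 : Pt) := by
    by_contra hcon
    push Not at hcon
    have hsub : P ⊆ {0} := fun x hx => hcon x hx
    have h2 := interior_mono hsub h0
    rw [interior_singleton] at h2
    exact h2
  obtain ⟨e, he, hne⟩ := hn
  have := hv.2 he (neg_mem_of_sym hsym he)
    ⟨1/2, 1/2, by norm_num, by norm_num, by norm_num, by simp⟩
  exact hne this

/-- an extreme point is not an interior multiple of a point of `P` -/
lemma ext_ne_smul {P : Set Pt} (hsym : P = -P)
    (h0 : (0 : Pt) ∈ interior P) {v : Pt} (hv : v ∈ extremePoints ℝ P) {x : Pt} (hx : x ∈ P)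
    {t : ℝ} (ht0 : 0 ≤ t) (ht1 : t < 1) : v ≠ t • x := by
  intro h
  have hv0 := ext_ne_zero hsym h0 hv
  have htpos : 0 < t := by
    rcases ht0.lt_or_eq with h1 | h1
    · exact h1
    · subst h1; simp at h; exact absurd h hv0
  have := hv.2 (interior_subset h0) hx
    ⟨1 - t, t, by linarith, htpos, by ring, by simp [h]⟩
  exact hv0 this.symm

lemma edge_coords {u v : Pt} (hD : 0 < det2 u v) (x : Pt) :
    x = (det2 x v / det2 u v) • u + (det2 u x / det2 u v) • v := by
  have hD' : det2 u v ≠ 0 := hD.ne'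
  have h1 : det2 u v * x.1 = det2 x v * u.1 + det2 u x * v.1 := by unfold det2; ring
  have h2 : det2 u v * x.2 = det2 x v * u.2 + det2 u x * v.2 := by unfold det2; ring
  ext
  · simp only [Prod.fst_add, Prod.smul_fst, smul_eq_mul]
    field_simp; linarith
  · simp only [Prod.snd_add, Prod.smul_snd, smul_eq_mul]
    field_simp; linarith

/-- core of the face argument: `w = α u + β v` with `α < 0`, `α + β ≥ 1` contradicts extremality
of `v`. -/
lemma neg_coeff_absurd {P : Set Pt} (hc : Convex ℝ P) (hsym : P = -P)
    (h0 : (0 : Pt) ∈ interior P) {u v w : Pt} (hv : v ∈ extremePoints ℝ P) (hu : u ∈ P)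
    (hw : w ∈ P) (huv : u ≠ v) {α β : ℝ} (hα : α < 0) (hs : 1 ≤ α + β)
    (hwe : w = α • u + β • v) : False := by
  have hβ : 0 < β := by linarith
  have h1α : 0 < 1 - α := by linarith
  have hv' : v = ((1 - α) / β) • ((1 / (1 - α)) • w + (-α / (1 - α)) • u) := by
    rw [hwe]
    have e1 : (1 - α) ≠ 0 := h1α.ne'
    ext
    · simp only [Prod.fst_add, Prod.smul_fst, smul_eq_mul]; field_simp; ring
    · simp only [Prod.snd_add, Prod.smul_snd, smul_eq_mul]; field_simp; ring
  have hy : ((1 / (1 - α)) • w + (-α / (1 - α)) • u) ∈ P := by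
    apply hc hw hu
    · positivity
    · apply div_nonneg <;> linarith
    · field_simp; ring
  rcases hs.lt_or_eq with hlt | heq
  · exact ext_ne_smul hsym h0 hv hy (by positivity) ((div_lt_one hβ).2 (by linarith)) hv'
  · have e : (1 - α) / β = 1 := by rw [div_eq_one_iff_eq hβ.ne']; linarith
    rw [e, one_smul] at hv'
    have := hv.2 hu hw ⟨-α / (1 - α), 1 / (1 - α), div_pos (by linarith) h1α, by positivity,
      by field_simp; ring, by rw [add_comm]; exact hv'.symm⟩
    exact huv this

lemma det2_self (u : Pt) : det2 u u = 0 := by unfold det2; ring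

/-- consecutive vertices support a face -/
lemma face_of_consecutive {P : Set Pt} (hc : Convex ℝ P) (hsym : P = -P)
    (h0 : (0 : Pt) ∈ interior P) (hhull : P = convexHull ℝ (extremePoints ℝ P)) {u v : Pt}
    (hu : u ∈ extremePoints ℝ P) (hv : v ∈ extremePoints ℝ P) (hD : 0 < det2 u v)
    (hcons : ∀ w ∈ extremePoints ℝ P, 0 < det2 u w → 0 < det2 w v → False) :
    (∀ x ∈ P, det2 x v / det2 u v + det2 u x / det2 u v ≤ 1) ∧
    (∀ x ∈ P, det2 x v / det2 u v + det2 u x / det2 u v = 1 →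
      0 ≤ det2 x v / det2 u v ∧ 0 ≤ det2 u x / det2 u v) := by
  have huv : u ≠ v := by
    rintro rfl
    rw [det2_self] at hD; exact lt_irrefl _ hD
  have key : ∀ w ∈ P, 1 ≤ det2 w v / det2 u v + det2 u w / det2 u v →
      0 ≤ det2 w v / det2 u v ∧ 0 ≤ det2 u w / det2 u v := by
    intro w hw hs
    have hco := edge_coords hD w
    constructor
    · by_contra hneg
      push Not at hneg
      exact neg_coeff_absurd hc hsym h0 hv hu.1 hw huv hneg hs hco
    · by_contra hneg
      push Not at hneg
      rw [add_comm] at hs hco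
      exact neg_coeff_absurd hc hsym h0 hu hv.1 hw huv.symm hneg hs hco
  refine ⟨?_, fun x hx h => key x hx h.ge⟩
  have hconv : Convex ℝ {x : Pt | det2 x v / det2 u v + det2 u x / det2 u v ≤ 1} := by
    intro x hx y hy a b ha hb hab
    simp only [Set.mem_ofPred_eq] at *
    have e : det2 (a • x + b • y) v / det2 u v + det2 u (a • x + b • y) / det2 u v
       = a * (det2 x v / det2 u v + det2 u x / det2 u v)
        + b * (det2 y v / det2 u v + det2 u y / det2 u v) := by
      unfold det2; simp only [Prod.fst_add, Prod.smul_fst, smul_eq_mul, Prod.snd_add,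
        Prod.smul_snd]; ring
    rw [e]
    nlinarith
  intro x hx
  rw [hhull] at hx
  refine convexHull_min ?_ hconv hx
  intro w hw
  simp only [Set.mem_ofPred_eq]
  by_contra hgt
  push Not at hgt
  obtain ⟨hα, hβ⟩ := key w hw.1 hgt.le
  have hco := edge_coords hD w
  rcases hα.lt_or_eq with hα | hα
  · rcases hβ.lt_or_eq with hβ | hβ
    · exact hcons w hw ((div_pos_iff_of_pos_right hD).1 hβ) ((div_pos_iff_of_pos_right hD).1 hα)
    · rw [← hβ] at hgt hco
      rw [add_zero] at hgt
      refine ext_ne_smul hsym h0 hu hw.1 (t := (det2 w v / det2 u v)⁻¹) (by positivity)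
        (inv_lt_one_of_one_lt₀ hgt) ?_
      nth_rewrite 2 [hco]
      rw [zero_smul, add_zero, inv_smul_smul₀ (by positivity)]
  · rw [← hα] at hgt hco
    rw [zero_add] at hgt
    have : 0 < det2 u w / det2 u v := by linarith
    refine ext_ne_smul hsym h0 hv hw.1 (t := (det2 u w / det2 u v)⁻¹) (by positivity)
      (inv_lt_one_of_one_lt₀ hgt) ?_
    nth_rewrite 2 [hco]
    rw [zero_smul, zero_add, inv_smul_smul₀ (by positivity)]

/-- consecutive vertices form an edge -/
lemma edge_of_consecutive {P : Set Pt} (hc : Convex ℝ P) (hsym : P = -P)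
    (h0 : (0 : Pt) ∈ interior P) (hhull : P = convexHull ℝ (extremePoints ℝ P)) {u v : Pt}
    (hu : u ∈ extremePoints ℝ P) (hv : v ∈ extremePoints ℝ P) (hD : 0 < det2 u v)
    (hcons : ∀ w ∈ extremePoints ℝ P, 0 < det2 u w → 0 < det2 w v → False) :
    IsEdgeOf P u v := by
  obtain ⟨hle, heq⟩ := face_of_consecutive hc hsym h0 hhull hu hv hD hcons
  refine ⟨?_, ?_⟩
  · rintro rfl
    rw [det2_self] at hD; exact lt_irrefl _ hD
  · refine ⟨hc.segment_subset hu.1 hv.1, ?_⟩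
    intro x hx y hy z hz hzo
    obtain ⟨p, q, hp, hq, hpq, rfl⟩ := hz
    obtain ⟨a, b, ha, hb, hab, he⟩ := hzo
    have hx1 := hle x hx
    have hy1 := hle y hy
    have e : a * (det2 x v / det2 u v + det2 u x / det2 u v)
        + b * (det2 y v / det2 u v + det2 u y / det2 u v) = 1 := by
      have e1 : det2 (a • x + b • y) v / det2 u v + det2 u (a • x + b • y) / det2 u v
       = a * (det2 x v / det2 u v + det2 u x / det2 u v)
        + b * (det2 y v / det2 u v + det2 u y / det2 u v) := by
        unfold det2; simp only [Prod.fst_add, Prod.smul_fst, smul_eq_mul, Prod.snd_add,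
          Prod.smul_snd]; ring
      rw [← e1, he, ← add_div, div_eq_one_iff_eq hD.ne']
      have : q = 1 - p := by linarith
      subst this
      unfold det2; simp only [Prod.fst_add, Prod.smul_fst, smul_eq_mul, Prod.snd_add,
          Prod.smul_snd]; ring
    have hx2 : det2 x v / det2 u v + det2 u x / det2 u v = 1 := by
      by_contra hne
      have := lt_of_le_of_ne hx1 hne
      nlinarith
    obtain ⟨h1, h2⟩ := heq x hx hx2
    exact ⟨_, _, h1, h2, hx2, (edge_coords hD x).symm⟩


/-! ### Local analysis around a lattice point -/

section Local
variable {P : Set Pt} {a d : Pt}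

/-- openness: perturbing a point by a small multiple -/
lemma ev_open {U : Set Pt} (hU : IsOpen U) {z : Pt} (hz : z ∈ U) (w : Pt) :
    ∀ᶠ e in 𝓝[>] (0 : ℝ), z + e • w ∈ U := by
  have hcont : Continuous fun e : ℝ => z + e • w := by fun_prop
  have h : ∀ᶠ e in 𝓝 (0 : ℝ), z + e • w ∈ U := by
    apply hcont.continuousAt.eventually_mem
    apply hU.mem_nhds
    simpa using hz
  exact h.filter_mono nhdsWithin_le_nhds

lemma ev_pos : ∀ᶠ e in 𝓝[>] (0 : ℝ), 0 < e := eventually_mem_nhdsWithin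

lemma ev_lt {c : ℝ} (hc : 0 < c) : ∀ᶠ e in 𝓝[>] (0 : ℝ), e < c :=
  (eventually_lt_nhds hc).filter_mono nhdsWithin_le_nhds

/-- A line through an interior point: points just after any point of the line are
either interior or outside. -/
lemma ev_line (hc : Convex ℝ P) (hcl : IsClosed P) {q : Pt} {t₀ : ℝ}
    (hy : q + t₀ • d ∈ interior P) :
    ∀ᶠ s in 𝓝[>] (0 : ℝ), q + s • d ∈ interior P ∨ q + s • d ∉ P := by
  -- points strictly between the interior point and a point of `P`
  have btw : ∀ s₁ s θ : ℝ, q + s₁ • d ∈ P → 0 < θ → θ ≤ 1 → s = (1 - θ) * s₁ + θ * t₀ →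
      q + s • d ∈ interior P := by
    intro s₁ s θ h1 h2 h3 hs
    have := hc.combo_self_interior_mem_interior h1 hy (sub_nonneg.2 h3) h2 (by ring)
    convert this using 1
    rw [hs]
    module
  by_cases hq : q ∈ P
  · by_cases ht : 0 < t₀
    · filter_upwards [ev_pos, ev_lt ht] with s h1 h2
      left
      refine btw 0 s (s / t₀) (by simpa using hq) (by positivity) ?_ ?_
      · rw [div_le_one ht]; exact h2.le
      · field_simp; ring
    · push Not at ht
      by_cases hex : ∃ s₁ : ℝ, 0 < s₁ ∧ q + s₁ • d ∈ P
      · obtain ⟨s₁, hs₁, hm⟩ := hex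
        filter_upwards [ev_pos, ev_lt hs₁] with s h1 h2
        left
        have h3 : 0 < s₁ - t₀ := by linarith
        refine btw s₁ s ((s₁ - s) / (s₁ - t₀)) hm (div_pos (by linarith) h3) ?_ ?_
        · rw [div_le_one h3]; linarith
        · field_simp; ring
      · push Not at hex
        filter_upwards [ev_pos] with s h1
        exact Or.inr (hex s h1)
  · filter_upwards [ev_open hcl.isOpen_compl hq d] with s h1
    exact Or.inr h1

/-- half of the comparison in the strip `|x| < 1` -/
lemma ev_strip (hc : Convex ℝ P) (hcl : IsClosed P) {q : Pt} {t₀ : ℝ}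
    (hy : q + t₀ • d ∈ interior P) (a : Pt) :
    ∀ᶠ s in 𝓝[>] (0 : ℝ), ∀ᶠ e in 𝓝[>] (0 : ℝ),
      q + s • d - e • a ∈ interior P ∨ q + s • d + e • a ∉ P := by
  filter_upwards [ev_line hc hcl hy] with s hs
  rcases hs with hs | hs
  · filter_upwards [ev_open isOpen_interior hs (-a)] with e he
    left
    simpa [sub_eq_add_neg] using he
  · filter_upwards [ev_open hcl.isOpen_compl hs a] with e he
    exact Or.inr he

/-- outside points -/
lemma ev_out (hcl : IsClosed P) {q : Pt} (hq : q ∉ P) (d a : Pt) :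
    ∀ᶠ s in 𝓝[>] (0 : ℝ), ∀ᶠ e in 𝓝[>] (0 : ℝ), q + s • d + e • a ∉ P := by
  filter_upwards [ev_open hcl.isOpen_compl hq d] with s hs
  exact ev_open hcl.isOpen_compl hs a

open Classical in
/-- indicator -/
def ind (S : Set Pt) (z : Pt) : ℕ := if z ∈ S then 1 else 0

lemma ind_le_of_or {S T : Set Pt} {y z : Pt} (h : y ∈ S ∨ z ∉ T) : ind T z ≤ ind S y := by
  unfold ind
  rcases h with h | h
  · rw [if_pos h]; split_ifs <;> simp
  · rw [if_neg h]; simp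

lemma ind_le_one (S : Set Pt) (y : Pt) : ind S y ≤ 1 := by
  unfold ind; split_ifs <;> simp

/-- closed count at the two `B`-points -/
def cB (P : Set Pt) (a d q : Pt) (s e : ℝ) : ℕ :=
  ind P (q + s • d + e • a) + ind P (q - s • d - e • a)

/-- open count at the two `A`-points -/
def cA (P : Set Pt) (a d q : Pt) (s e : ℝ) : ℕ :=
  ind (interior P) (q + s • d - e • a) + ind (interior P) (q - s • d + e • a)

lemma ind_neg {S : Set Pt} (hS : ∀ x ∈ S, -x ∈ S) (z : Pt) : ind S (-z) = ind S z := by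
  unfold ind
  have : -z ∈ S ↔ z ∈ S := ⟨fun h => by simpa using hS _ h, hS z⟩
  by_cases hz : z ∈ S
  · rw [if_pos hz, if_pos (this.2 hz)]
  · rw [if_neg hz, if_neg (fun h => hz (this.1 h))]

lemma cB_neg (hsym : P = -P) (q : Pt) (s e : ℝ) : cB P a d (-q) s e = cB P a d q s e := by
  unfold cB
  have hS : ∀ x ∈ P, -x ∈ P := fun x hx => neg_mem_of_sym hsym hx
  rw [← ind_neg hS (q + s • d + e • a), ← ind_neg hS (q - s • d - e • a), add_comm]
  congr 2 <;> module

lemma cA_neg (hsym : P = -P) (q : Pt) (s e : ℝ) : cA P a d (-q) s e = cA P a d q s e := by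
  unfold cA
  have hS : ∀ x ∈ interior P, -x ∈ interior P := fun x hx => neg_mem_int hsym hx
  rw [← ind_neg hS (q + s • d - e • a), ← ind_neg hS (q - s • d + e • a), add_comm]
  congr 2 <;> module

/-- right side `x = 1`, upper inequality -/
lemma ev_right (hc : Convex ℝ P) (hcl : IsClosed P)
    (h0 : (0 : Pt) ∈ interior P)
    (hx : ∀ x t : ℝ, x • a + t • d ∈ P → x ≤ 1)
    (hface : ∀ t : ℝ, a + t • d ∈ P ↔ 0 ≤ t ∧ t ≤ 1) {t : ℝ} (ht : t ≠ 1) :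
    ∀ᶠ s in 𝓝[>] (0 : ℝ), ∀ᶠ e in 𝓝[>] (0 : ℝ),
      cB P a d (a + t • d) s e ≤ cA P a d (a + t • d) s e := by
  have hB1 : ∀ s e : ℝ, 0 < e → (a + t • d) + s • d + e • a ∉ P := by
    intro s e he hm
    have : (1 + e) • a + (t + s) • d ∈ P := by convert hm using 1; module
    linarith [hx _ _ this]
  by_cases hq : a + t • d ∈ P
  · have htt := (hface t).1 hq
    have ht1 : t < 1 := lt_of_le_of_ne htt.2 ht
    filter_upwards [ev_pos, ev_lt (sub_pos.2 ht1)] with s hs hs1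
    have hc1 : 0 < 1 - (t + s) := by linarith
    filter_upwards [ev_pos, ev_lt hc1] with e he he1
    have hA1 : (a + t • d) + s • d - e • a ∈ interior P := by
      have he2 : 0 < 1 - e := by linarith
      have hm : a + ((t + s) / (1 - e)) • d ∈ P := by
        rw [hface]
        refine ⟨div_nonneg (by linarith) he2.le, ?_⟩
        rw [div_le_one he2]; linarith
      have := smul_mem_int hc h0 hm he2.le (by linarith)
      convert this using 1
      rw [smul_add, smul_smul, mul_div_cancel₀ _ he2.ne']
      module
    have e1 : ind P ((a + t • d) + s • d + e • a) = 0 := by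
      unfold ind; rw [if_neg (hB1 s e he)]
    have e2 : ind (interior P) ((a + t • d) + s • d - e • a) = 1 := by
      unfold ind; rw [if_pos hA1]
    unfold cA cB
    have := ind_le_one P ((a + t • d) - s • d - e • a)
    omega
  · filter_upwards [ev_out hcl hq d a, ev_out hcl hq (-d) (-a)] with s h1 h2
    filter_upwards [h1, h2] with e h3 h4
    have h4' : (a + t • d) - s • d - e • a ∉ P := by
      simpa [sub_eq_add_neg] using h4
    unfold cB ind
    rw [if_neg h3, if_neg h4']
    simp

/-- the general inequality -/
lemma ev_general (hc : Convex ℝ P) (hcl : IsClosed P) (hsym : P = -P)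
    (h0 : (0 : Pt) ∈ interior P)
    (hx : ∀ x t : ℝ, x • a + t • d ∈ P → x ≤ 1)
    (hface : ∀ t : ℝ, a + t • d ∈ P ↔ 0 ≤ t ∧ t ≤ 1) {x t : ℝ}
    (h1 : x • a + t • d ≠ a + d) (h2 : x • a + t • d ≠ -(a + d)) :
    ∀ᶠ s in 𝓝[>] (0 : ℝ), ∀ᶠ e in 𝓝[>] (0 : ℝ),
      cB P a d (x • a + t • d) s e ≤ cA P a d (x • a + t • d) s e := by
  have haP : a ∈ P := by simpa using (hface 0).2 ⟨le_refl _, zero_le_one⟩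
  rcases lt_trichotomy |x| 1 with hlt | heq | hgt
  · have hxa : x • a ∈ interior P := by
      rcases le_total 0 x with h | h
      · exact smul_mem_int hc h0 haP h (lt_of_le_of_lt (le_abs_self x) hlt)
      · have := smul_mem_int hc h0 haP (t := -x) (by linarith)
          (lt_of_le_of_lt (neg_le_abs x) hlt)
        simpa using neg_mem_int hsym this
    have hy1 : (x • a + t • d) + (-t) • d ∈ interior P := by
      convert hxa using 1; module
    have hy2 : (x • a + t • d) + t • (-d) ∈ interior P := by
      convert hxa using 1; module
    filter_upwards [ev_strip hc hcl hy1 a, ev_strip hc hcl hy2 (-a)] with s h3 h4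
    filter_upwards [h3, h4] with e h5 h6
    unfold cA cB
    refine add_le_add (ind_le_of_or h5) (ind_le_of_or ?_)
    simpa [sub_eq_add_neg] using h6
  · rcases (abs_eq zero_le_one).1 heq with rfl | rfl
    · rw [one_smul] at *
      apply ev_right hc hcl h0 hx hface
      rintro rfl
      simp at h1
    · have ht : -t ≠ 1 := by
        rintro h
        apply h2
        have : t = -1 := by linarith
        subst this
        module
      have := ev_right hc hcl h0 hx hface ht
      filter_upwards [this] with s h3
      filter_upwards [h3] with e h4
      rw [← cB_neg hsym, ← cA_neg hsym]
      have e : -((-1 : ℝ) • a + t • d) = a + (-t) • d := by module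
      rw [e]
      exact h4
  · have hq : x • a + t • d ∉ P := by
      intro hm
      have g1 := hx _ _ hm
      have : (-x) • a + (-t) • d ∈ P := by
        convert neg_mem_of_sym hsym hm using 1; module
      have g2 := hx _ _ this
      have := abs_le.2 ⟨by linarith, g1⟩
      linarith
    filter_upwards [ev_out hcl hq d a, ev_out hcl hq (-d) (-a)] with s h1 h2
    filter_upwards [h1, h2] with e h3 h4
    have h4' : (x • a + t • d) - s • d - e • a ∉ P := by
      simpa [sub_eq_add_neg] using h4
    unfold cB ind
    rw [if_neg h3, if_neg h4']
    simp

/-- the strict inequality at the vertex `a` -/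
lemma ev_vertex (hc : Convex ℝ P) (hcl : IsClosed P)
    (h0 : (0 : Pt) ∈ interior P)
    (hx : ∀ x t : ℝ, x • a + t • d ∈ P → x ≤ 1)
    (hface : ∀ t : ℝ, a + t • d ∈ P ↔ 0 ≤ t ∧ t ≤ 1) :
    ∀ᶠ s in 𝓝[>] (0 : ℝ), ∀ᶠ e in 𝓝[>] (0 : ℝ), cB P a d a s e < cA P a d a s e := by
  have hB1 : ∀ s e : ℝ, 0 < e → a + s • d + e • a ∉ P := by
    intro s e he hm
    have : (1 + e) • a + s • d ∈ P := by convert hm using 1; module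
    linarith [hx _ _ this]
  filter_upwards [ev_pos, ev_lt one_pos] with s hs hs1
  have hout : a + (-s) • d ∉ P := by
    rw [hface]; rintro ⟨h, -⟩; linarith
  filter_upwards [ev_pos, ev_lt (sub_pos.2 hs1), ev_open hcl.isOpen_compl hout (-a)]
    with e he he1 he3
  have hA1 : a + s • d - e • a ∈ interior P := by
    have he2 : 0 < 1 - e := by linarith
    have hm : a + (s / (1 - e)) • d ∈ P := by
      rw [hface]
      refine ⟨div_nonneg (by linarith) he2.le, ?_⟩
      rw [div_le_one he2]; linarith
    have := smul_mem_int hc h0 hm he2.le (by linarith)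
    convert this using 1
    rw [smul_add, smul_smul, mul_div_cancel₀ _ he2.ne']
    module
  have e1 : ind P (a + s • d + e • a) = 0 := by
    unfold ind; rw [if_neg (hB1 s e he)]
  have e2 : ind (interior P) (a + s • d - e • a) = 1 := by
    unfold ind; rw [if_pos hA1]
  have e3 : ind P (a - s • d - e • a) = 0 := by
    unfold ind
    rw [if_neg]
    simpa [sub_eq_add_neg] using he3
  unfold cA cB
  omega

end Local

/-! ### Lattice facts -/

lemma lattice_add {L : Set Pt} (hL : IsLattice L) {x y : Pt} (hx : x ∈ L) (hy : y ∈ L) :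
    x + y ∈ L := by
  obtain ⟨B, rfl⟩ := hL
  obtain ⟨_, ⟨p, q, rfl⟩, rfl⟩ := hx
  obtain ⟨_, ⟨r, s, rfl⟩, rfl⟩ := hy
  refine ⟨_, ⟨p + r, q + s, rfl⟩, ?_⟩
  rw [← map_add]
  simp

lemma lattice_neg {L : Set Pt} (hL : IsLattice L) {x : Pt} (hx : x ∈ L) : -x ∈ L := by
  obtain ⟨B, rfl⟩ := hL
  obtain ⟨_, ⟨p, q, rfl⟩, rfl⟩ := hx
  refine ⟨_, ⟨-p, -q, rfl⟩, ?_⟩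
  rw [← map_neg]
  simp

lemma lattice_sub {L : Set Pt} (hL : IsLattice L) {x y : Pt} (hx : x ∈ L) (hy : y ∈ L) :
    x - y ∈ L := by
  rw [sub_eq_add_neg]; exact lattice_add hL hx (lattice_neg hL hy)

lemma lattice_zero {L : Set Pt} (hL : IsLattice L) : (0 : Pt) ∈ L := by
  obtain ⟨B, rfl⟩ := hL
  exact ⟨0, ⟨0, 0, Prod.ext (by simp) (by simp)⟩, by simp⟩

lemma lattice_finite {L : Set Pt} (hL : IsLattice L) (R : ℝ) : {l ∈ L | ‖l‖ ≤ R}.Finite := by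
  obtain ⟨B, rfl⟩ := hL
  obtain ⟨C, hC⟩ := (B.symm.toContinuousLinearEquiv : Pt →L[ℝ] Pt).isBoundedLinearMap.bound
  have hfin : ((fun z : ℤ × ℤ => B ((z.1 : ℝ), (z.2 : ℝ))) ''
      ((Set.Icc (-⌈C * |R|⌉) ⌈C * |R|⌉) ×ˢ (Set.Icc (-⌈C * |R|⌉) ⌈C * |R|⌉))).Finite :=
    ((Set.finite_Icc _ _).prod (Set.finite_Icc _ _)).image _
  refine hfin.subset ?_
  rintro _ ⟨⟨_, ⟨p, q, rfl⟩, rfl⟩, hn⟩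
  refine ⟨(p, q), ?_, rfl⟩
  have h1 := hC.2 (B ((p : ℝ), (q : ℝ)))
  have h2 : ‖((p : ℝ), (q : ℝ))‖ ≤ C * ‖B ((p : ℝ), (q : ℝ))‖ := by simpa using h1
  have h3 : ‖((p : ℝ), (q : ℝ))‖ ≤ C * |R| :=
    h2.trans (mul_le_mul_of_nonneg_left (hn.trans (le_abs_self R)) hC.1.le)
  have h4 : C * |R| ≤ ⌈C * |R|⌉ := Int.le_ceil _
  have hp : |(p : ℝ)| ≤ ⌈C * |R|⌉ := ((norm_fst_le ((p : ℝ), (q : ℝ))).trans h3).trans h4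
  have hq : |(q : ℝ)| ≤ ⌈C * |R|⌉ := ((norm_snd_le ((p : ℝ), (q : ℝ))).trans h3).trans h4
  rw [abs_le] at hp hq
  refine ⟨⟨?_, ?_⟩, ⟨?_, ?_⟩⟩
  · exact_mod_cast hp.1
  · exact_mod_cast hp.2
  · exact_mod_cast hq.1
  · exact_mod_cast hq.2

/-- Key lemma: an edge `[a, a + d]` is a lattice vector or its midpoint is half a lattice vector. -/
lemma edge_dichotomy {P L : Set Pt} {k : ℕ} (hc : Convex ℝ P) (hcomp : IsCompact P)
    (hsym : P = -P) (h0 : (0 : Pt) ∈ interior P) (ht : IsKFoldLatticeTiling P L k) {a d : Pt}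
    (hspan : ∀ q : Pt, ∃ x t : ℝ, q = x • a + t • d)
    (hx : ∀ x t : ℝ, x • a + t • d ∈ P → x ≤ 1)
    (hface : ∀ t : ℝ, a + t • d ∈ P ↔ 0 ≤ t ∧ t ≤ 1) :
    d ∈ L ∨ a + (a + d) ∈ L := by
  by_contra hcon
  push Not at hcon
  obtain ⟨hd, had⟩ := hcon
  obtain ⟨hL, hge, hle⟩ := ht
  have hcl := hcomp.isClosed
  obtain ⟨M, hM⟩ := hcomp.isBounded.exists_norm_le
  set R : ℝ := M + ‖a‖ + ‖d‖ + ‖a‖ with hR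
  have hfin := lattice_finite hL R
  set F := hfin.toFinset with hF
  have hFm : ∀ l, l ∈ F ↔ l ∈ L ∧ ‖l‖ ≤ R := by
    intro l; rw [hF, Set.Finite.mem_toFinset]; rfl
  have h0F : (0 : Pt) ∈ F := by
    rw [hFm]
    refine ⟨lattice_zero hL, ?_⟩
    have := hM 0 (interior_subset h0)
    simp only [norm_zero] at *
    positivity
  have hall : ∀ᶠ s in 𝓝[>] (0 : ℝ), ∀ᶠ e in 𝓝[>] (0 : ℝ),
      ∀ l ∈ F, cB P a d (a - l) s e ≤ cA P a d (a - l) s e := by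
    have : ∀ᶠ s in 𝓝[>] (0 : ℝ), ∀ l ∈ F, ∀ᶠ e in 𝓝[>] (0 : ℝ),
        cB P a d (a - l) s e ≤ cA P a d (a - l) s e := by
      rw [Filter.eventually_all_finset]
      intro l hl
      have hlL := ((hFm l).1 hl).1
      obtain ⟨x, t, hq⟩ := hspan (a - l)
      rw [hq]
      apply ev_general hc hcl hsym h0 hx hface
      · rw [← hq]
        intro h
        apply hd
        have : d = -l := by
          have := congrArg (fun z => z - a) h
          simp at this
          exact this.symm
        rw [this]; exact lattice_neg hL hlL
      · rw [← hq]
        intro h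
        apply had
        have : a + (a + d) = l := by
          have := congrArg (fun z => z + (a + d) + l) h
          simp only [neg_add_cancel, zero_add] at this
          rw [← this]; abel
        rw [this]; exact hlL
    filter_upwards [this] with s hs
    rw [Filter.eventually_all_finset]
    exact hs
  obtain ⟨s, hs1, hs2, hs3, hs4⟩ :=
    (hall.and ((ev_vertex hc hcl h0 hx hface).and (ev_pos.and (ev_lt one_pos)))).exists
  obtain ⟨e, he1, he2, he3, he4⟩ := (hs1.and (hs2.and (ev_pos.and (ev_lt one_pos)))).exists
  -- counts as sums
  have hcount : ∀ (S : Set Pt), S ⊆ P → ∀ σ ε : ℝ, |σ| ≤ 1 → |ε| ≤ 1 →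
      {l ∈ L | a + σ • d + ε • a - l ∈ S}.encard
        = ((∑ l ∈ F, ind S (a - l + σ • d + ε • a) : ℕ) : ℕ∞) := by
    classical
    intro S hS σ ε hσ hε
    have hset : {l ∈ L | a + σ • d + ε • a - l ∈ S}
        = ((F.filter (fun l => a - l + σ • d + ε • a ∈ S) : Finset Pt) : Set Pt) := by
      ext l
      have e1 : a + σ • d + ε • a - l = a - l + σ • d + ε • a := by abel
      rw [Finset.mem_coe, Finset.mem_filter, hFm]
      change (l ∈ L ∧ a + σ • d + ε • a - l ∈ S) ↔ _
      rw [e1]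
      constructor
      · rintro ⟨h1, h2⟩
        refine ⟨⟨h1, ?_⟩, h2⟩
        have h3 := hM _ (hS h2)
        have h4 : l = (a + σ • d + ε • a) - (a - l + σ • d + ε • a) := by abel
        rw [h4]
        have h5 : ‖σ • d‖ ≤ ‖d‖ := by
          rw [norm_smul]; exact mul_le_of_le_one_left (norm_nonneg _) hσ
        have h6 : ‖ε • a‖ ≤ ‖a‖ := by
          rw [norm_smul]; exact mul_le_of_le_one_left (norm_nonneg _) hε
        have h7 := norm_sub_le (a + σ • d + ε • a) (a - l + σ • d + ε • a)
        have h8 := norm_add_le (a + σ • d) (ε • a)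
        have h9 := norm_add_le a (σ • d)
        linarith
      · rintro ⟨⟨h1, -⟩, h2⟩
        exact ⟨h1, h2⟩
    rw [hset, Set.encard_coe_eq_coe_finsetCard, Finset.card_filter]
    congr 1
  have as : |s| ≤ 1 := abs_le.2 ⟨by linarith, hs4.le⟩
  have ae : |e| ≤ 1 := abs_le.2 ⟨by linarith, he4.le⟩
  have as' : |-s| ≤ 1 := by rwa [abs_neg]
  have ae' : |-e| ≤ 1 := by rwa [abs_neg]
  have b1 := hge (a + s • d + e • a)
  have b2 := hge (a + (-s) • d + (-e) • a)
  have a1 := hle (a + s • d + (-e) • a)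
  have a2 := hle (a + (-s) • d + e • a)
  rw [hcount P subset_rfl _ _ as ae, Nat.cast_le] at b1
  rw [hcount P subset_rfl _ _ as' ae', Nat.cast_le] at b2
  rw [hcount _ interior_subset _ _ as ae', Nat.cast_le] at a1
  rw [hcount _ interior_subset _ _ as' ae, Nat.cast_le] at a2
  have hlt : ∑ l ∈ F, cB P a d (a - l) s e < ∑ l ∈ F, cA P a d (a - l) s e := by
    apply Finset.sum_lt_sum he1
    exact ⟨0, h0F, by simpa using he2⟩
  have sB : ∑ l ∈ F, cB P a d (a - l) s e = ∑ l ∈ F, ind P (a - l + s • d + e • a)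
      + ∑ l ∈ F, ind P (a - l + (-s) • d + (-e) • a) := by
    rw [← Finset.sum_add_distrib]
    refine Finset.sum_congr rfl fun l _ => ?_
    unfold cB
    simp only [neg_smul, sub_eq_add_neg]
  have sA : ∑ l ∈ F, cA P a d (a - l) s e = ∑ l ∈ F, ind (interior P) (a - l + s • d + (-e) • a)
      + ∑ l ∈ F, ind (interior P) (a - l + (-s) • d + e • a) := by
    rw [← Finset.sum_add_distrib]
    refine Finset.sum_congr rfl fun l _ => ?_
    unfold cA
    simp only [neg_smul, sub_eq_add_neg]
  omega

/-- For consecutive vertices. -/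
lemma consecutive_dichotomy {P L : Set Pt} {k : ℕ} (hc : Convex ℝ P) (hcomp : IsCompact P)
    (hsym : P = -P) (h0 : (0 : Pt) ∈ interior P) (hhull : P = convexHull ℝ (extremePoints ℝ P))
    (ht : IsKFoldLatticeTiling P L k) {u v : Pt}
    (hu : u ∈ extremePoints ℝ P) (hv : v ∈ extremePoints ℝ P) (hD : 0 < det2 u v)
    (hcons : ∀ w ∈ extremePoints ℝ P, 0 < det2 u w → 0 < det2 w v → False) :
    v - u ∈ L ∨ u + v ∈ L := by
  obtain ⟨hle, heq⟩ := face_of_consecutive hc hsym h0 hhull hu hv hD hcons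
  have hD' := hD.ne'
  have e1 : ∀ x t : ℝ, det2 (x • u + t • (v - u)) v / det2 u v = x - t := by
    intro x t
    rw [div_eq_iff hD']
    unfold det2; simp only [Prod.fst_add, Prod.smul_fst, smul_eq_mul, Prod.snd_add,
          Prod.smul_snd, Prod.fst_sub, Prod.snd_sub]; ring
  have e2 : ∀ x t : ℝ, det2 u (x • u + t • (v - u)) / det2 u v = t := by
    intro x t
    rw [div_eq_iff hD']
    unfold det2; simp only [Prod.fst_add, Prod.smul_fst, smul_eq_mul, Prod.snd_add,
          Prod.smul_snd, Prod.fst_sub, Prod.snd_sub]; ring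
  have := edge_dichotomy hc hcomp hsym h0 ht (a := u) (d := v - u) ?_ ?_ ?_
  · simpa using this
  · intro q
    refine ⟨det2 q v / det2 u v + det2 u q / det2 u v, det2 u q / det2 u v, ?_⟩
    nth_rewrite 1 [edge_coords hD q]
    module
  · intro x t hm
    have := hle _ hm
    rw [e1, e2] at this
    linarith
  · intro t
    constructor
    · intro hm
      have hm' : (1 : ℝ) • u + t • (v - u) ∈ P := by rwa [one_smul]
      have := heq _ hm'
      rw [e1, e2] at this
      have := this (by ring)
      exact ⟨this.2, by linarith⟩
    · rintro ⟨h1, h2⟩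
      have := hc hu.1 hv.1 (sub_nonneg.2 h2) h1 (by ring)
      convert this using 1
      module

/-- vertices on a common line through the origin -/
lemma ext_collinear {P : Set Pt} (hsym : P = -P)
    (h0 : (0 : Pt) ∈ interior P) {u v : Pt} (hu : u ∈ extremePoints ℝ P)
    (hv : v ∈ extremePoints ℝ P) (hD : det2 u v = 0) : v = u ∨ v = -u := by
  have hu0 := ext_ne_zero hsym h0 hu
  have hv0 := ext_ne_zero hsym h0 hv
  obtain ⟨t, ht⟩ : ∃ t : ℝ, v = t • u := by
    unfold det2 at hD
    by_cases h1 : u.1 = 0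
    · have h2 : u.2 ≠ 0 := by
        intro h2; exact hu0 (Prod.ext h1 h2)
      refine ⟨v.2 / u.2, ?_⟩
      ext
      · simp only [Prod.smul_fst, smul_eq_mul]; field_simp; linarith
      · simp only [Prod.smul_snd, smul_eq_mul]; field_simp
    · refine ⟨v.1 / u.1, ?_⟩
      ext
      · simp only [Prod.smul_fst, smul_eq_mul]; field_simp
      · simp only [Prod.smul_snd, smul_eq_mul]; field_simp; linarith
  have key : ∀ {x y : Pt} {r : ℝ}, x ∈ extremePoints ℝ P → y ∈ P → x = r • y → 1 ≤ |r| := by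
    intro x y r hx hy hxy
    by_contra hlt
    push Not at hlt
    rcases le_total 0 r with h | h
    · exact ext_ne_smul hsym h0 hx hy h (lt_of_le_of_lt (le_abs_self r) hlt) hxy
    · exact ext_ne_smul hsym h0 hx (neg_mem_of_sym hsym hy) (neg_nonneg.2 h)
        (lt_of_le_of_lt (neg_le_abs r) hlt) (by rw [hxy]; simp)
  have k1 := key hv hu.1 ht
  have ht0 : t ≠ 0 := by rintro rfl; simp at ht; exact hv0 ht
  have k2 := key hu hv.1 (r := t⁻¹) (by rw [ht, inv_smul_smul₀ ht0])
  rw [abs_inv] at k2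
  have : |t| = 1 := by
    apply le_antisymm _ k1
    by_contra hlt
    push Not at hlt
    linarith [inv_lt_one_of_one_lt₀ hlt]
  rcases (abs_eq zero_le_one).1 this with rfl | rfl
  · left; simpa using ht
  · right; simpa using ht

lemma neg_ext {P : Set Pt} (hsym : P = -P) {u : Pt} (hu : u ∈ extremePoints ℝ P) :
    -u ∈ extremePoints ℝ P := by
  refine ⟨neg_mem_of_sym hsym hu.1, ?_⟩
  intro x hx y hy hxy
  obtain ⟨a, b, ha, hb, hab, he⟩ := hxy
  have := hu.2 (neg_mem_of_sym hsym hx) (neg_mem_of_sym hsym hy) ⟨a, b, ha, hb, hab, by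
    have := congrArg (fun z => -z) he
    simp only [neg_neg] at this
    rw [← this]; module⟩
  rw [← this]; simp

lemma plucker (o u w x : Pt) :
    det2 o w * det2 u x = det2 o u * det2 w x + det2 o x * det2 u w := by
  unfold det2; ring

/-- the least element in angular order -/
lemma exists_first (o : Pt) (ho : o ≠ 0) (S : Finset Pt) (hS : S.Nonempty)
    (hpos : ∀ w ∈ S, 0 < det2 o w) : ∃ w ∈ S, ∀ x ∈ S, 0 ≤ det2 w x := by
  obtain ⟨w, hw, hmin⟩ := S.exists_min_image
    (fun w => -(o.1 * w.1 + o.2 * w.2) / det2 o w) hS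
  refine ⟨w, hw, fun x hx => ?_⟩
  have h := hmin x hx
  have p1 := hpos w hw
  have p2 := hpos x hx
  rw [div_le_div_iff₀ p1 p2] at h
  have hn : 0 < o.1 ^ 2 + o.2 ^ 2 := by
    by_contra hle
    apply ho
    ext
    · simp only [Prod.fst_zero]; nlinarith [sq_nonneg o.1, sq_nonneg o.2]
    · simp only [Prod.snd_zero]; nlinarith [sq_nonneg o.1, sq_nonneg o.2]
  have e : (o.1 ^ 2 + o.2 ^ 2) * det2 w x
      = det2 o x * (o.1 * w.1 + o.2 * w.2) - det2 o w * (o.1 * x.1 + o.2 * x.2) := by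
    unfold det2; ring
  by_contra hneg
  push Not at hneg
  nlinarith

end EvenGon

/-- if `m` is even and a centrally symmetric convex `2m`-gon centered at the
origin forms a `k`-fold lattice tiling with a lattice `Λ`, then some edge of `P` is a lattice
vector of `Λ`. -/
theorem even_gon_edge_lattice_vector (m : ℕ) (hm : Even m) (hm0 : 0 < m) (P : Set Pt)
    (hP : IsConvexPolygon P (2 * m)) (hsym : P = -P)
    (L : Set Pt) (k : ℕ) (hk : 0 < k) (ht : IsKFoldLatticeTiling P L k) :
    ∃ a b : Pt, IsEdgeOf P a b ∧ b - a ∈ L := by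
  classical
  obtain ⟨hc, hcomp, hne, hfin, hcard, hhull⟩ := hP
  have h0 := EvenGon.zero_mem_int hc hsym hne
  have hL := ht.1
  by_contra hcon
  push Not at hcon
  -- every pair of consecutive vertices sums to a lattice vector
  have hsum : ∀ u v : Pt, u ∈ extremePoints ℝ P → v ∈ extremePoints ℝ P → 0 < EvenGon.det2 u v →
      (∀ w ∈ extremePoints ℝ P, 0 < EvenGon.det2 u w → 0 < EvenGon.det2 w v → False) →
      u + v ∈ L := by
    intro u v hu hv hD hcons
    rcases EvenGon.consecutive_dichotomy hc hcomp hsym h0 hhull ht hu hv hD hcons with h | h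
    · exact absurd h (hcon u v (EvenGon.edge_of_consecutive hc hsym h0 hhull hu hv hD hcons))
    · exact h
  set V := hfin.toFinset with hV
  have hVm : ∀ x, x ∈ V ↔ x ∈ extremePoints ℝ P := by
    intro x; rw [hV, Set.Finite.mem_toFinset]
  have hVc : V.card = 2 * m := by
    rw [← hcard, Set.ncard_eq_toFinset_card _ hfin]
  obtain ⟨o, hoV⟩ : V.Nonempty := by
    rw [← Finset.card_pos, hVc]; omega
  have ho := (hVm o).1 hoV
  have ho0 := EvenGon.ext_ne_zero hsym h0 ho
  set H := V.filter (fun w => 0 < EvenGon.det2 o w) with hH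
  have hHm : ∀ x, x ∈ H ↔ x ∈ extremePoints ℝ P ∧ 0 < EvenGon.det2 o x := by
    intro x; rw [hH, Finset.mem_filter, hVm]
  have hdneg : ∀ x y : Pt, EvenGon.det2 x (-y) = - EvenGon.det2 x y := by
    intro x y; unfold EvenGon.det2; simp only [Prod.fst_neg, Prod.snd_neg]; ring
  have hdswap : ∀ x y : Pt, EvenGon.det2 x y = - EvenGon.det2 y x := by
    intro x y; unfold EvenGon.det2; ring
  -- `H` has `m - 1` elements
  have hHc : H.card + 1 = m := by
    have hN : V.filter (fun w => EvenGon.det2 o w < 0) = H.image (fun x => -x) := by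
      ext x
      rw [Finset.mem_filter, Finset.mem_image, hVm]
      constructor
      · rintro ⟨h1, h2⟩
        refine ⟨-x, (hHm _).2 ⟨EvenGon.neg_ext hsym h1, ?_⟩, by simp⟩
        rw [hdneg]; linarith
      · rintro ⟨y, hy, rfl⟩
        have := (hHm y).1 hy
        refine ⟨EvenGon.neg_ext hsym this.1, ?_⟩
        rw [hdneg]; linarith [this.2]
    have hNc : (V.filter (fun w => EvenGon.det2 o w < 0)).card = H.card := by
      rw [hN, Finset.card_image_of_injective _ neg_injective]
    have hZ : V.filter (fun w => EvenGon.det2 o w = 0) = {o, -o} := by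
      ext x
      rw [Finset.mem_filter, hVm, Finset.mem_insert, Finset.mem_singleton]
      constructor
      · rintro ⟨h1, h2⟩
        exact EvenGon.ext_collinear hsym h0 ho h1 h2
      · rintro (rfl | rfl)
        · exact ⟨ho, EvenGon.det2_self _⟩
        · refine ⟨EvenGon.neg_ext hsym ho, ?_⟩
          rw [hdneg, EvenGon.det2_self, neg_zero]
    have hZc : (V.filter (fun w => EvenGon.det2 o w = 0)).card = 2 := by
      rw [hZ, Finset.card_pair]
      intro h
      exact ho0 (self_eq_neg.1 h)
    have s1 := Finset.card_filter_add_card_filter_not (s := V) (fun w => 0 < EvenGon.det2 o w)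
    have s2 := Finset.card_filter_add_card_filter_not
      (s := V.filter (fun w => ¬ 0 < EvenGon.det2 o w)) (fun w => EvenGon.det2 o w = 0)
    rw [Finset.filter_filter, Finset.filter_filter] at s2
    have f1 : V.filter (fun w => ¬ 0 < EvenGon.det2 o w ∧ EvenGon.det2 o w = 0)
        = V.filter (fun w => EvenGon.det2 o w = 0) := by
      apply Finset.filter_congr
      intro x _
      constructor
      · exact fun h => h.2
      · exact fun h => ⟨by rw [h]; exact lt_irrefl _, h⟩
    have f2 : V.filter (fun w => ¬ 0 < EvenGon.det2 o w ∧ ¬ EvenGon.det2 o w = 0)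
        = V.filter (fun w => EvenGon.det2 o w < 0) := by
      apply Finset.filter_congr
      intro x _
      constructor
      · rintro ⟨g1, g2⟩
        exact lt_of_le_of_ne (not_lt.1 g1) g2
      · exact fun h => ⟨not_lt.2 h.le, h.ne⟩
    rw [f1, f2, hZc, hNc] at s2
    rw [← s2, hVc] at s1
    have s3 : H.card + (2 + H.card) = 2 * m := s1
    omega
  clear_value H
  -- next vertex
  have hnext : ∀ u, (u = o ∨ u ∈ H) → (H.filter (fun w => 0 < EvenGon.det2 u w)).Nonempty →
      ∃ w ∈ H, 0 < EvenGon.det2 u w ∧ u + w ∈ L ∧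
        H.filter (fun x => 0 < EvenGon.det2 w x)
          = (H.filter (fun x => 0 < EvenGon.det2 u x)).erase w := by
    intro u hu hnonempty
    have huV : u ∈ extremePoints ℝ P := by
      rcases hu with rfl | hu
      · exact ho
      · exact ((hHm u).1 hu).1
    have huo : 0 ≤ EvenGon.det2 o u := by
      rcases hu with rfl | hu
      · rw [EvenGon.det2_self]
      · exact ((hHm u).1 hu).2.le
    obtain ⟨w, hw, hfirst⟩ := EvenGon.exists_first o ho0 _ hnonempty
      (fun w hw => ((hHm w).1 (Finset.mem_filter.1 hw).1).2)
    obtain ⟨hwH, huw⟩ := Finset.mem_filter.1 hw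
    obtain ⟨hwV, how⟩ := (hHm w).1 hwH
    refine ⟨w, hwH, huw, ?_, ?_⟩
    · apply hsum u w huV hwV huw
      intro x hxV hux hxw
      have hox : 0 < EvenGon.det2 o x := by
        have := EvenGon.plucker w u x o
        -- det w x * det u o = det w u * det x o + det w o * det u x
        rw [hdswap w x, hdswap u o, hdswap w u, hdswap x o, hdswap w o] at this
        by_contra hle
        push Not at hle
        nlinarith [mul_nonneg hxw.le huo, mul_pos how hux, mul_nonneg huw.le (neg_nonneg.2 hle)]
      have := hfirst x (Finset.mem_filter.2 ⟨(hHm x).2 ⟨hxV, hox⟩, hux⟩)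
      rw [hdswap] at this
      linarith
    · ext x
      rw [Finset.mem_erase, Finset.mem_filter, Finset.mem_filter]
      constructor
      · rintro ⟨hxH, hwx⟩
        have hox := ((hHm x).1 hxH).2
        refine ⟨?_, hxH, ?_⟩
        · rintro rfl
          rw [EvenGon.det2_self] at hwx; exact lt_irrefl _ hwx
        · have := EvenGon.plucker o u w x
          have g : 0 < EvenGon.det2 o w * EvenGon.det2 u x := by
            rw [this]
            have := mul_nonneg huo hwx.le
            have := mul_pos hox huw
            linarith
          exact (pos_iff_pos_of_mul_pos g).1 how
      · rintro ⟨hne', hxH, hux⟩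
        refine ⟨hxH, ?_⟩
        have h1 := hfirst x (Finset.mem_filter.2 ⟨hxH, hux⟩)
        refine lt_of_le_of_ne h1 fun h2 => ?_
        have hxx := (hHm x).1 hxH
        rcases EvenGon.ext_collinear hsym h0 hwV hxx.1 h2.symm with h | h
        · exact hne' h
        · have := hxx.2
          rw [h, hdneg] at this
          linarith
  -- induction along the half-chain
  have hchain : ∀ n : ℕ, ∀ u ∈ H, (H.filter (fun w => 0 < EvenGon.det2 u w)).card = n →
      (Even n → u - o ∈ L) ∧ (Odd n → u + o ∈ L) := by
    intro n
    induction n with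
    | zero =>
      intro u hu hcd
      refine ⟨fun _ => ?_, fun h => absurd h (by decide)⟩
      obtain ⟨huV, hou⟩ := (hHm u).1 hu
      rw [sub_eq_add_neg]
      apply hsum u (-o) huV (EvenGon.neg_ext hsym ho)
      · rw [hdneg, hdswap]; linarith
      · intro w hwV huw hwo
        rw [hdneg, hdswap] at hwo
        have : w ∈ H.filter (fun w => 0 < EvenGon.det2 u w) :=
          Finset.mem_filter.2 ⟨(hHm w).2 ⟨hwV, by linarith⟩, huw⟩
        rw [Finset.card_eq_zero.1 hcd] at this
        simp at this
    | succ n ih =>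
      intro u hu hcd
      obtain ⟨w, hwH, huw, hLw, her⟩ := hnext u (Or.inr hu)
        (Finset.card_pos.1 (by rw [hcd]; omega))
      have hcw := ih w hwH (by
        rw [her, Finset.card_erase_of_mem (Finset.mem_filter.2 ⟨hwH, huw⟩), hcd]; simp)
      constructor
      · intro hev
        have hodd : Odd n := by
          rw [← Nat.not_even_iff_odd]; intro h; exact (Nat.even_add_one.1 hev) h
        have := EvenGon.lattice_sub hL hLw (hcw.2 hodd)
        convert this using 1; abel
      · intro hod
        have hev : Even n := by
          by_contra h
          exact (Nat.not_even_iff_odd.2 hod) (Nat.even_add_one.2 h)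
        have := EvenGon.lattice_sub hL hLw (hcw.1 hev)
        convert this using 1; abel
  -- conclude
  have hHo : H.filter (fun w => 0 < EvenGon.det2 o w) = H := by
    apply Finset.filter_true_of_mem
    intro x hx
    exact ((hHm x).1 hx).2
  have hm2 : 2 ≤ m := by
    obtain ⟨r, hr⟩ := hm
    omega
  have hHne : H.Nonempty := by
    rw [← Finset.card_pos]; omega
  obtain ⟨w, hwH, how, hLw, her⟩ := hnext o (Or.inl rfl) (by rw [hHo]; exact hHne)
  have hcw : (H.filter (fun x => 0 < EvenGon.det2 w x)).card = m - 2 := by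
    rw [her, hHo, Finset.card_erase_of_mem hwH]; omega
  have hev : Even (m - 2) := by
    obtain ⟨r, hr⟩ := hm
    exact ⟨r - 1, by omega⟩
  have hwo := (hchain _ w hwH hcw).1 hev
  refine hcon o w ?_ hwo
  apply EvenGon.edge_of_consecutive hc hsym h0 hhull ho ((hHm w).1 hwH).1 how
  intro x hxV hox hxw
  have hxH := (hHm x).2 ⟨hxV, hox⟩
  have hx2 : x ∈ H.filter (fun x => 0 < EvenGon.det2 w x) := by
    rw [her, hHo, Finset.mem_erase]
    refine ⟨?_, hxH⟩
    rintro rfl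
    rw [EvenGon.det2_self] at hxw; exact lt_irrefl _ hxw
  have := (Finset.mem_filter.1 hx2).2
  rw [hdswap] at this
  linarith
end
end

section
/- Let m ≥ 4, let P be a centrally symmetric convex polygon in ℝ² with exactly 2m vertices centered at the origin, and let X = (x_i)_{i∈I} be a discrete multiset such that P + X is a k-fold translative tiling of ℝ² with k = τ(P) (i.e., P admits no translative tiling of multiplicity smaller than k). Let v be a vertex of some translate P + x_j (that is, v = w + x_j where w is a vertex of P), and let G be an edge of some translate P + x_l (that is, G = E + x_l where E is an edge of P) such that v is an endpoint of G. Then there are at least ⌈(m−3)/2⌉ distinct indices i ∈ I such that v ∈ ∂(P) + x_i and G ∖ {v} ⊆ int(P) + x_i. -/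
open Set Pointwise

noncomputable section

open Filter Topology

lemma ker_lem (f : Pt →L[ℝ] ℝ) (e : Pt) (he : f e ≠ 0) (u g : Pt) (hg : g ≠ 0)
    (hfu : f u = 0) (hfg : f g = 0) : ∃ c : ℝ, u = c • g := by
  have key : ∀ z : Pt, f z = z.1 * f (1, 0) + z.2 * f (0, 1) := by
    intro z
    have : z = z.1 • ((1, 0) : Pt) + z.2 • ((0, 1) : Pt) := by
      ext <;> simp
    calc f z = f (z.1 • ((1, 0) : Pt) + z.2 • ((0, 1) : Pt)) := congrArg f this
      _ = _ := by rw [map_add, map_smul, map_smul]; rfl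
  rw [key] at hfu hfg he
  set α := f (1, 0)
  set β := f (0, 1)
  have hα : α * (u.1 * g.2 - u.2 * g.1) = 0 := by linear_combination g.2 * hfu - u.2 * hfg
  have hβ : β * (u.1 * g.2 - u.2 * g.1) = 0 := by linear_combination -g.1 * hfu + u.1 * hfg
  have hc : u.1 * g.2 - u.2 * g.1 = 0 := by
    by_contra h
    have h1 : α = 0 := by simpa [h] using hα
    have h2 : β = 0 := by simpa [h] using hβ
    simp [h1, h2] at he
  by_cases h1 : g.1 = 0
  · have h2 : g.2 ≠ 0 := fun h => hg (Prod.ext h1 h)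
    refine ⟨u.2 / g.2, Prod.ext ?_ ?_⟩
    · have : u.1 = 0 := by simpa [h1, h2] using hc
      simp [this, h1]
    · simp [h2]
  · refine ⟨u.1 / g.1, Prod.ext ?_ ?_⟩
    · simp [h1]
    · simp; field_simp; linarith

lemma exists_ker (f : Pt →L[ℝ] ℝ) : ∃ d : Pt, d ≠ 0 ∧ f d = 0 := by
  have key : ∀ z : Pt, f z = z.1 * f (1, 0) + z.2 * f (0, 1) := by
    intro z
    have : z = z.1 • ((1, 0) : Pt) + z.2 • ((0, 1) : Pt) := by
      ext <;> simp
    calc f z = f (z.1 • ((1, 0) : Pt) + z.2 • ((0, 1) : Pt)) := congrArg f this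
      _ = _ := by rw [map_add, map_smul, map_smul]; rfl
  by_cases h : f (0, 1) = 0
  · exact ⟨(0, 1), by simp, h⟩
  · refine ⟨(- f (0, 1), f (1, 0)), fun h' => h (by simpa using congrArg Prod.fst h'), ?_⟩
    rw [key]; simp; ring

/-- basic facts about the body -/
structure Body (P : Set Pt) : Prop where
  conv : Convex ℝ P
  comp : IsCompact P
  zero : (0 : Pt) ∈ interior P
  neg : ∀ z ∈ P, -z ∈ P

lemma Body.negI {P : Set Pt} (h : Body P) {z : Pt} (hz : z ∈ interior P) : -z ∈ interior P := by
  have : P = -P := by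
    ext y; constructor
    · intro hy; exact h.neg y hy
    · intro hy; simpa using h.neg _ hy
  rw [this]
  have h2 := (Homeomorph.neg Pt).preimage_interior P
  have h3 : -z ∈ (Homeomorph.neg Pt) ⁻¹' interior P := by simpa using hz
  rw [h2] at h3
  exact h3

lemma Body.not_int {P : Set Pt} (_h : Body P) (f : Pt →L[ℝ] ℝ) (w : Pt)
    (hpos : 0 < f w) (hmax : ∀ z ∈ P, f z ≤ f w) : w ∉ interior P := by
  intro hw
  have hc : Tendsto (fun t : ℝ => t • w) (𝓝[>] 1) (𝓝 w) := by
    have : ContinuousAt (fun t : ℝ => t • w) 1 := by fun_prop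
    have h2 := this.tendsto
    simp only [one_smul] at h2
    exact h2.mono_left nhdsWithin_le_nhds
  have h1 := hc.eventually (mem_interior_iff_mem_nhds.1 hw)
  obtain ⟨t, ht, ht1⟩ := (h1.and self_mem_nhdsWithin).exists
  have h3 := hmax _ ht
  simp only [map_smul, smul_eq_mul] at h3
  have : (1 : ℝ) < t := ht1
  nlinarith

/-- supporting functional -/
lemma Body.support {P : Set Pt} (h : Body P) (y : Pt) (hy : y ∉ interior P) :
    ∃ f : Pt →L[ℝ] ℝ, 0 < f y ∧ ∀ z ∈ P, f z ≤ f y := by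
  obtain ⟨f, hf⟩ := geometric_hahn_banach_open_point h.conv.interior isOpen_interior hy
  refine ⟨f, by simpa using hf 0 h.zero, fun z hz => ?_⟩
  have h1 : z ∈ closure (interior P) := by
    rw [h.conv.closure_interior_eq_closure_of_nonempty_interior ⟨0, h.zero⟩]
    exact subset_closure hz
  have : closure (interior P) ⊆ {z | f z ≤ f y} :=
    closure_minimal (fun z hz => (hf z hz).le) (isClosed_le (by fun_prop) (by fun_prop))
  exact this h1

/-- a boundary point strictly inside a strip: exactly one of the two directions is interior. -/
lemma Body.dir {P : Set Pt} (h : Body P) (f : Pt →L[ℝ] ℝ) (w d z : Pt) (hw : w ∈ P)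
    (hpos : 0 < f w) (hd : d ≠ 0) (hfd : f d = 0) (hz : z ∈ P) (hzi : z ∉ interior P)
    (h1 : f z < f w) (h2 : - f w < f z) :
    (∃ c > (0 : ℝ), z + c • d ∈ interior P ∧ ∀ e > (0 : ℝ), e ≤ c → z + e • d ∈ interior P) ∧
        (∀ e > (0 : ℝ), z - e • d ∉ P) ∨
    (∃ c > (0 : ℝ), z - c • d ∈ interior P ∧ ∀ e > (0 : ℝ), e ≤ c → z - e • d ∈ interior P) ∧
        (∀ e > (0 : ℝ), z + e • d ∉ P) := by
  have gen : ∀ d : Pt, ∀ c > (0 : ℝ), z + c • d ∈ interior P →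
      (∀ e > (0 : ℝ), e ≤ c → z + e • d ∈ interior P) ∧ (∀ e > (0 : ℝ), z - e • d ∉ P) := by
    intro d c hc hin
    constructor
    · intro e he hec
      rcases hec.eq_or_lt with rfl | hlt
      · exact hin
      · apply h.conv.openSegment_self_interior_subset_interior hz hin
        refine ⟨1 - e / c, e / c, ?_, by positivity, by ring, ?_⟩
        · have : e / c < 1 := (div_lt_one hc).2 hlt
          linarith
        · have : e / c * c = e := by field_simp
          rw [smul_add, smul_smul, this]; module
    · intro e he hin2
      apply hzi
      apply h.conv.openSegment_self_interior_subset_interior hin2 hin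
      refine ⟨c / (e + c), e / (e + c), by positivity, by positivity, by field_simp; ring, ?_⟩
      ext <;> simp <;> field_simp <;> ring
  set t := f z / f w with ht
  have htw : t * f w = f z := by rw [ht]; field_simp
  have ht1 : t < 1 := by rw [ht, div_lt_one hpos]; exact h1
  have ht2 : -1 < t := by rw [ht, lt_div_iff₀ hpos]; linarith
  have hy : t • w ∈ interior P := by
    have aux : ∀ s : ℝ, 0 ≤ s → s < 1 → ∀ w ∈ P, s • w ∈ interior P := by
      intro s hs0 hs w hw
      rcases hs0.eq_or_lt with rfl | hs0
      · simpa using h.zero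
      · apply h.conv.openSegment_interior_self_subset_interior h.zero hw
        exact ⟨1 - s, s, by linarith, hs0, by ring, by simp⟩
    rcases le_total 0 t with h0 | h0
    · exact aux t h0 ht1 w hw
    · have := aux (-t) (by linarith) (by linarith) (-w) (h.neg w hw)
      simpa using this
  obtain ⟨c, hc⟩ := ker_lem f w hpos.ne' (t • w - z) d hd (by simp [htw]) hfd
  have hc' : z + c • d = t • w := by rw [← hc]; abel
  rcases lt_trichotomy c 0 with hneg | h0 | hpos'
  · right
    have hin : z + (-c) • (-d) ∈ interior P := by simpa [hc'] using hy
    obtain ⟨g1, g2⟩ := gen (-d) (-c) (by linarith) hin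
    refine ⟨⟨-c, by linarith, by simpa [hc'] using hy, fun e he hec => ?_⟩, fun e he => ?_⟩
    · have := g1 e he hec
      rwa [smul_neg, ← sub_eq_add_neg] at this
    · have := g2 e he
      rwa [smul_neg, sub_neg_eq_add] at this
  · exfalso; apply hzi
    have : z = t • w := by rw [← hc', h0]; simp
    rw [this]; exact hy
  · left
    obtain ⟨g1, g2⟩ := gen d c hpos' (by rw [hc']; exact hy)
    exact ⟨⟨c, hpos', by rw [hc']; exact hy, g1⟩, g2⟩

lemma nbhd_lem {I : Type} {P : Set Pt} (hP : IsCompact P) (x : I → Pt)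
    (hx : IsDiscreteFamily x) (p : Pt) :
    ∀ᶠ q in 𝓝 p, (∀ i, q - x i ∈ P → p - x i ∈ P) ∧
      (∀ i, p - x i ∈ interior P → q - x i ∈ interior P) := by
  have hB : Bornology.IsBounded (Metric.closedBall p 1 - P) :=
    Metric.isBounded_closedBall.sub hP.isBounded
  have hF := hx _ hB
  have h1 : ∀ᶠ q in 𝓝 p, ∀ i ∈ {i | x i ∈ Metric.closedBall p 1 - P},
      (q - x i ∈ P → p - x i ∈ P) ∧ (p - x i ∈ interior P → q - x i ∈ interior P) := by
    rw [Filter.eventually_all_finite hF]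
    intro i _
    have hc : Tendsto (fun q => q - x i) (𝓝 p) (𝓝 (p - x i)) := by
      have : ContinuousAt (fun q => q - x i) p := by fun_prop
      exact this
    apply Filter.Eventually.and
    · by_cases h : p - x i ∈ P
      · simp [h]
      · filter_upwards [hc.eventually (hP.isClosed.isOpen_compl.mem_nhds h)] with q hq hq2
        exact absurd hq2 hq
    · by_cases h : p - x i ∈ interior P
      · filter_upwards [hc.eventually (isOpen_interior.mem_nhds h)] with q hq _
        exact hq
      · simp [h]
  have h2 : ∀ᶠ q in 𝓝 p, q ∈ Metric.closedBall p 1 := Metric.closedBall_mem_nhds p one_pos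
  filter_upwards [h1, h2] with q hq hqb
  constructor
  · intro i hi
    refine (hq i ⟨q, hqb, q - x i, hi, by simp⟩).1 hi
  · intro i hi
    refine (hq i ⟨p, by simp, p - x i, interior_subset hi, by simp⟩).2 hi

/-- exposing functional at a vertex -/
lemma Body.expose {P : Set Pt} (h : Body P) (hfin : (Set.extremePoints ℝ P).Finite)
    (hhull : P = convexHull ℝ (Set.extremePoints ℝ P)) (w : Pt)
    (hw : w ∈ Set.extremePoints ℝ P) :
    ∃ f : Pt →L[ℝ] ℝ, 0 < f w ∧ ∀ z ∈ P, z ≠ w → f z < f w := by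
  set Q := convexHull ℝ (Set.extremePoints ℝ P \ {w}) with hQ
  have hwQ : w ∉ Q := by
    intro hmem
    have := (h.conv.mem_extremePoints_iff_mem_sdiff_convexHull_sdiff).1 hw
    exact this.2 (convexHull_mono (Set.sdiff_subset_sdiff_left extremePoints_subset) hmem)
  have hQc : IsClosed Q := (hfin.subset Set.sdiff_subset).isClosed_convexHull ℝ
  obtain ⟨f, u, hf1, hf2⟩ := geometric_hahn_banach_closed_point (convex_convexHull ℝ _) hQc hwQ
  have hmain : ∀ z ∈ P, z ≠ w → f z < f w := by
    intro z hz hne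
    have hQne : Q.Nonempty := by
      rw [hQ, convexHull_nonempty_iff]
      by_contra hemp
      rw [Set.not_nonempty_iff_eq_empty, Set.sdiff_eq_empty] at hemp
      have : P ⊆ {w} := by
        rw [hhull]
        exact convexHull_min hemp (convex_singleton w)
      exact hne (this hz)
    have hext : Set.extremePoints ℝ P = insert w (Set.extremePoints ℝ P \ {w}) := by
      rw [Set.insert_sdiff_singleton, Set.insert_eq_of_mem hw]
    rw [hhull, hext, convexHull_insert (by simpa [hQ] using hQne), mem_convexJoin] at hz
    obtain ⟨w', hw', q, hq, hzs⟩ := hz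
    rw [Set.mem_singleton_iff] at hw'
    subst hw'
    obtain ⟨α, β, hα, hβ, hab, rfl⟩ := hzs
    have hq' := hf1 q hq
    have hβ' : 0 < β := by
      rcases hβ.eq_or_lt with h0 | h0
      · exfalso; apply hne
        have : α = 1 := by linarith
        simp [this, ← h0]
      · exact h0
    simp only [map_add, map_smul, smul_eq_mul]
    have : α = 1 - β := by linarith
    subst this
    nlinarith
  refine ⟨f, ?_, hmain⟩
  have : (0 : Pt) ≠ w := by
    rintro rfl
    have h0 := h.zero
    have hev : ∀ᶠ t : ℝ in 𝓝[>] 0, t • ((1, 0) : Pt) ∈ P := by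
      have : ContinuousAt (fun t : ℝ => t • ((1, 0) : Pt)) 0 := by fun_prop
      have h2 := this.tendsto
      simp only [zero_smul] at h2
      exact (h2.mono_left nhdsWithin_le_nhds).eventually (mem_interior_iff_mem_nhds.1 h0)
    obtain ⟨t, ht, htp⟩ := (hev.and self_mem_nhdsWithin).exists
    have htp : 0 < t := htp
    have hne : t • ((1, 0) : Pt) ≠ 0 := by
      simp [htp.ne']
    have e1 := hmain _ ht hne
    have e2 := hmain _ (h.neg _ ht) (neg_ne_zero.2 hne)
    simp only [map_neg, map_zero] at e1 e2
    linarith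
  simpa using hmain 0 (interior_subset h.zero) this

lemma Body.edge {P : Set Pt} (h : Body P) {a b : Pt} (hab : IsEdgeOf P a b) :
    ∃ f : Pt →L[ℝ] ℝ, f b = f a ∧ 0 < f a ∧ (∀ z ∈ P, f z ≤ f a) ∧
      ∀ z ∈ P, f z = f a → z ∈ segment ℝ a b := by
  obtain ⟨hne, hsub, hext⟩ := hab
  have haP : a ∈ P := hsub (left_mem_segment ℝ a b)
  have hbP : b ∈ P := hsub (right_mem_segment ℝ a b)
  set c : Pt := (1 / 2 : ℝ) • a + (1 / 2 : ℝ) • b with hc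
  have hcs : c ∈ segment ℝ a b := ⟨1 / 2, 1 / 2, by norm_num, by norm_num, by norm_num, rfl⟩
  have hci : c ∉ interior P := by
    intro hin
    set η : Pt := (-(b - a).2, (b - a).1) with hη
    have t1 : Tendsto (fun e : ℝ => c + e • η) (𝓝[>] 0) (𝓝 c) := by
      have : ContinuousAt (fun e : ℝ => c + e • η) 0 := by fun_prop
      have h2 := this.tendsto
      simp only [zero_smul, add_zero] at h2
      exact h2.mono_left nhdsWithin_le_nhds
    have t2 : Tendsto (fun e : ℝ => c - e • η) (𝓝[>] 0) (𝓝 c) := by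
      have : ContinuousAt (fun e : ℝ => c - e • η) 0 := by fun_prop
      have h2 := this.tendsto
      simp only [zero_smul, sub_zero] at h2
      exact h2.mono_left nhdsWithin_le_nhds
    obtain ⟨e, ⟨h1, h2⟩, he⟩ := (((t1.eventually (mem_interior_iff_mem_nhds.1 hin)).and
      (t2.eventually (mem_interior_iff_mem_nhds.1 hin))).and self_mem_nhdsWithin).exists
    have he : 0 < e := he
    have h3 := hext h1 h2 hcs ⟨1 / 2, 1 / 2, by norm_num, by norm_num, by norm_num, by module⟩
    obtain ⟨α, β, _, _, hαβ, h4⟩ := h3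
    have e1 := congrArg Prod.fst h4
    have e2 := congrArg Prod.snd h4
    simp [hc, hη] at e1 e2
    have hα : α = 1 - β := by linarith
    subst hα
    have : e * ((b.1 - a.1) ^ 2 + (b.2 - a.2) ^ 2) = 0 := by
      linear_combination (-(b.1 - a.1)) * e2 + (b.2 - a.2) * e1
    have h5 : (b.1 - a.1) ^ 2 + (b.2 - a.2) ^ 2 = 0 := by
      simpa [he.ne'] using this
    apply hne
    ext
    · nlinarith [sq_nonneg (b.1 - a.1), sq_nonneg (b.2 - a.2)]
    · nlinarith [sq_nonneg (b.1 - a.1), sq_nonneg (b.2 - a.2)]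
  obtain ⟨f, hfpos, hf⟩ := h.support c hci
  have h1 := hf a haP
  have h2 := hf b hbP
  have h3 : f c = 1 / 2 * f a + 1 / 2 * f b := by simp [hc]
  have hfa : f a = f c := by linarith
  have hfb : f b = f a := by linarith
  refine ⟨f, hfb, by rw [hfa]; exact hfpos, fun z hz => by rw [hfa]; exact hf z hz, ?_⟩
  intro z hz hfz
  obtain ⟨s, hs⟩ := ker_lem f a (by rw [hfa]; exact hfpos.ne') (z - a) (b - a)
    (sub_ne_zero.2 hne.symm) (by simp [hfz]) (by simp [hfb])
  have hz' : z = a + s • (b - a) := by rw [← hs]; abel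
  rcases lt_or_ge s 0 with h0 | h0
  · refine hext hz hbP (left_mem_segment ℝ a b) ⟨1 / (1 - s), (-s) / (1 - s), ?_, ?_, ?_, ?_⟩
    · apply div_pos <;> linarith
    · apply div_pos <;> linarith
    · have : 1 - s ≠ 0 := by linarith
      field_simp; ring
    · have : 1 - s ≠ 0 := by linarith
      rw [hz']; ext <;> simp <;> field_simp <;> ring
  rcases le_or_gt s 1 with h1 | h1
  · exact ⟨1 - s, s, by linarith, h0, by ring, by rw [hz']; module⟩
  · refine hext hz haP (right_mem_segment ℝ a b) ⟨1 / s, (s - 1) / s, ?_, ?_, ?_, ?_⟩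
    · apply div_pos <;> linarith
    · apply div_pos <;> linarith
    · have : s ≠ 0 := by linarith
      field_simp; ring
    · have : s ≠ 0 := by linarith
      rw [hz']; ext <;> simp <;> field_simp <;> ring

lemma Body.chord {P : Set Pt} (h : Body P) {a b w : Pt} (f : Pt →L[ℝ] ℝ) (hne : a ≠ b)
    (haP : a ∈ P) (hbP : b ∈ P) (hfb : f b = f a) (hpos : 0 < f a)
    (hw : w ∈ Set.extremePoints ℝ P) (hw1 : f w < f a) (hw2 : -f a < f w)
    (z : Pt) (hz : z ∈ P) (hzi : z ∉ interior P) (hz1 : f z < f a) (hz2 : - f a < f z)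
    (hc : ∃ c > (0 : ℝ), z + c • (b - a) ∈ interior P) :
    ∀ s > (0 : ℝ), s ≤ 1 → z + s • (b - a) ∈ interior P := by
  set y : ℝ → Pt := fun t => ((1 + t) / 2) • a + ((1 - t) / 2) • (-b) with hy
  have hfy : ∀ t, f (y t) = t * f a := by
    intro t; simp [hy, hfb]; ring
  have hyP : ∀ t, -1 < t → t < 1 → y t ∈ openSegment ℝ a (-b) := by
    intro t h1 h2
    exact ⟨(1 + t) / 2, (1 - t) / 2, by linarith, by linarith, by ring, rfl⟩
  have hyg : ∀ t, y t + (b - a) = - y (-t) := by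
    intro t; simp only [hy]; module
  have hyP' : ∀ t, -1 < t → t < 1 → y t ∈ P := fun t h1 h2 =>
    h.conv.openSegment_subset haP (h.neg b hbP) (hyP t h1 h2)
  have coord : ∀ q : Pt, f q < f a → - f a < f q → ∃ t r : ℝ, -1 < t ∧ t < 1 ∧
      q = y t + r • (b - a) := by
    intro q h1 h2
    obtain ⟨r, hr⟩ := ker_lem f a hpos.ne' (q - y (f q / f a)) (b - a)
      (sub_ne_zero.2 hne.symm) (by rw [map_sub, hfy]; field_simp; ring) (by simp [hfb])
    refine ⟨f q / f a, r, ?_, ?_, ?_⟩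
    · rw [lt_div_iff₀ hpos]; linarith
    · rw [div_lt_one hpos]; exact h1
    · rw [← hr]; abel
  have hyI : ∀ t, -1 < t → t < 1 → y t ∈ interior P := by
    intro t h1 h2
    by_contra hcon
    obtain ⟨f', hp', hm'⟩ := h.support _ hcon
    have e1 := hm' a haP
    have e2 := hm' (-b) (h.neg b hbP)
    have e3 : ∀ t, f' (y t) = (1 + t) / 2 * f' a + (1 - t) / 2 * (- f' b) := by
      intro t; simp [hy]
    rw [map_neg] at e2
    rw [e3] at e1 e2 hp'
    have e4 : f' a = - f' b := by nlinarith
    have e5 : f' b = - f' a := by linarith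
    rw [e5] at hp'
    have e6 : 0 < f' a := by linarith
    obtain ⟨t0, r, ht1, ht2, hwq⟩ := coord w hw1 hw2
    have g1 := hm' w hw.1
    have g2 := hm' (-w) (h.neg w hw.1)
    rw [e3] at g1 g2
    have e7 : f' w = f' a - 2 * r * f' a := by
      rw [hwq, map_add, e3, map_smul, map_sub, smul_eq_mul, e5]; ring
    rw [map_neg, e7, e5] at g2
    rw [e7, e5] at g1
    have hr0 : 0 ≤ r := by nlinarith
    have hr1 : r ≤ 1 := by nlinarith
    have hyg1 : y t0 + (b - a) ∈ P := by
      rw [hyg]; exact h.neg _ (hyP' _ (by linarith) (by linarith))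
    rcases hr0.eq_or_lt with h0 | h0
    · have : w ∈ openSegment ℝ a (-b) := by
        rw [hwq, ← h0]; simpa using hyP t0 ht1 ht2
      have := hw.2 haP (h.neg b hbP) this
      rw [this] at hw1
      exact lt_irrefl _ hw1
    rcases hr1.eq_or_lt with h0' | h0'
    · have : w ∈ openSegment ℝ b (-a) := by
        rw [hwq, h0']
        refine ⟨(1 + t0) / 2, (1 - t0) / 2, by linarith, by linarith, by ring, ?_⟩
        simp only [hy]; module
      have := hw.2 hbP (h.neg a haP) this
      rw [← this, hfb] at hw1
      exact lt_irrefl _ hw1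
    · have hseg : w ∈ openSegment ℝ (y t0) (y t0 + (b - a)) :=
        ⟨1 - r, r, by linarith, h0, by ring, by rw [hwq]; module⟩
      have i1 := hw.2 (hyP' t0 ht1 ht2) hyg1 hseg
      rw [openSegment_symm] at hseg
      have i2 := hw.2 hyg1 (hyP' t0 ht1 ht2) hseg
      have : b - a = 0 := by
        have := i1.trans i2.symm
        simpa using this
      exact hne (sub_eq_zero.1 this).symm
  obtain ⟨t, r, ht1, ht2, hzq⟩ := coord z hz1 hz2
  have hI0 := hyI t ht1 ht2
  have hI1 : y t + (b - a) ∈ interior P := by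
    rw [hyg]; exact h.negI (hyI _ (by linarith) (by linarith))
  have hr : r < 0 := by
    by_contra hr
    push Not at hr
    obtain ⟨c, hc0, hc1⟩ := hc
    apply hzi
    rcases le_or_gt r 1 with h1 | h1
    · apply h.conv.interior.segment_subset hI0 hI1
      exact ⟨1 - r, r, by linarith, hr, by ring, by rw [hzq]; module⟩
    · apply h.conv.interior.segment_subset hI0 hc1
      have : r + c ≠ 0 := by positivity
      refine ⟨c / (r + c), r / (r + c), by positivity, by positivity, by field_simp; ring, ?_⟩
      rw [hzq]; ext <;> simp <;> field_simp <;> ring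
  intro s hs hs1
  apply h.conv.openSegment_self_interior_subset_interior hz hI1
  have h1r : (0 : ℝ) < 1 - r := by linarith
  refine ⟨1 - s / (1 - r), s / (1 - r), ?_, by positivity, by ring, ?_⟩
  · have : s / (1 - r) < 1 := by rw [div_lt_one h1r]; linarith
    linarith
  · have : s / (1 - r) * (1 - r) = s := by field_simp
    have e : y t = z - r • (b - a) := by rw [hzq]; abel
    have e2 : y t + (b - a) = z + (1 - r) • (b - a) := by rw [e]; module
    rw [e2, smul_add, smul_smul, this]; module

open Classical in
lemma Body.stepA {P : Set Pt} (h : Body P) (hfin : (Set.extremePoints ℝ P).Finite)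
    (hhull : P = convexHull ℝ (Set.extremePoints ℝ P))
    {I : Type} (x : I → Pt) (k : ℕ) (ht : IsKFoldTranslativeTiling P x k) (v : Pt)
    (S : Finset I) (hS : ∀ i, i ∈ S ↔ v - x i ∈ P) (w : Pt)
    (hw : w ∈ Set.extremePoints ℝ P) :
    2 * k + ((S.filter (fun i => v - x i = w)).card + (S.filter (fun i => v - x i = -w)).card) =
      2 * (S.filter (fun i => v - x i ∈ interior P)).card +
        (S.filter (fun i => v - x i ∉ interior P)).card := by
  obtain ⟨f, hpos, hf⟩ := h.expose hfin hhull w hw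
  obtain ⟨d, hd, hfd⟩ := exists_ker f
  obtain ⟨hdis, hge, hle⟩ := ht
  have hwP : w ∈ P := hw.1
  have hmaxw : ∀ z ∈ P, f z ≤ f w := by
    intro z hz
    by_cases hzw : z = w
    · rw [hzw]
    · exact (hf z hz hzw).le
  have hwi : w ∉ interior P := h.not_int f w hpos hmaxw
  have hwi' : -w ∉ interior P := fun hh => hwi (by simpa using h.negI hh)
  have t1 : Tendsto (fun e : ℝ => v + e • d) (𝓝[>] 0) (𝓝 v) := by
    have : ContinuousAt (fun e : ℝ => v + e • d) 0 := by fun_prop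
    have h2 := this.tendsto
    simp only [zero_smul, add_zero] at h2
    exact h2.mono_left nhdsWithin_le_nhds
  have t2 : Tendsto (fun e : ℝ => v - e • d) (𝓝[>] 0) (𝓝 v) := by
    have : ContinuousAt (fun e : ℝ => v - e • d) 0 := by fun_prop
    have h2 := this.tendsto
    simp only [zero_smul, sub_zero] at h2
    exact h2.mono_left nhdsWithin_le_nhds
  have hnb := nbhd_lem h.comp x hdis v
  have hall : ∀ᶠ e : ℝ in 𝓝[>] 0, ∀ i ∈ S, v - x i ∉ interior P → v - x i ≠ w → v - x i ≠ -w →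
      (v - x i + e • d ∈ interior P ∧ v - x i - e • d ∉ P) ∨
      (v - x i - e • d ∈ interior P ∧ v - x i + e • d ∉ P) := by
    rw [Filter.eventually_all_finset]
    intro i hi
    by_cases hcase : v - x i ∉ interior P ∧ v - x i ≠ w ∧ v - x i ≠ -w
    swap
    · filter_upwards with e h1 h2 h3
      exact absurd ⟨h1, h2, h3⟩ hcase
    obtain ⟨c1, c2, c3⟩ := hcase
    have hzP := (hS i).1 hi
    have b1 := hf _ hzP c2
    have b2 := hf _ (h.neg _ hzP) (fun hh => c3 (by rw [← hh, neg_neg]))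
    rw [map_neg] at b2
    rcases h.dir f w d (v - x i) hwP hpos hd hfd hzP c1 b1 (by linarith) with
      ⟨⟨c, hc, -, hc2⟩, hc3⟩ | ⟨⟨c, hc, -, hc2⟩, hc3⟩
    · filter_upwards [Ioc_mem_nhdsGT hc] with e he _ _ _
      exact Or.inl ⟨hc2 e he.1 he.2, hc3 e he.1⟩
    · filter_upwards [Ioc_mem_nhdsGT hc] with e he _ _ _
      exact Or.inr ⟨hc2 e he.1 he.2, hc3 e he.1⟩
  obtain ⟨e, ⟨⟨hn1, hn2⟩, hall⟩, he⟩ := ((((t1.eventually hnb).and (t2.eventually hnb)).and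
    hall).and self_mem_nhdsWithin).exists
  have he : 0 < e := he
  have r1 : ∀ i, v + e • d - x i = v - x i + e • d := fun i => by abel
  have r2 : ∀ i, v - e • d - x i = v - x i - e • d := fun i => by abel
  simp only [r1] at hn1
  simp only [r2] at hn2
  have wout : ∀ s : ℝ, s ≠ 0 → w + s • d ∉ P := by
    intro s hs hin
    have := hf _ hin (by simp [hs, hd])
    simp [hfd] at this
  have wout1 := wout e he.ne'
  have wout2 : w - e • d ∉ P := by
    have := wout (-e) (by linarith)
    rwa [neg_smul, ← sub_eq_add_neg] at this
  have wout3 : -w - e • d ∉ P := fun hh => wout1 (by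
    have := h.neg _ hh; rwa [neg_sub, sub_neg_eq_add, add_comm] at this)
  have wout4 : -w + e • d ∉ P := fun hh => wout2 (by
    have := h.neg _ hh; rwa [neg_add, neg_neg, ← sub_eq_add_neg] at this)
  have A1 : k ≤ (S.filter (fun i => v - x i + e • d ∈ P)).card := by
    have := hge (v + e • d)
    have hs : {i | v + e • d - x i ∈ P} = ↑(S.filter (fun i => v - x i + e • d ∈ P)) := by
      ext i; simp only [Set.mem_ofPred_eq, Finset.coe_filter, r1, hS]
      exact ⟨fun hh => ⟨hn1.1 i hh, hh⟩, fun hh => hh.2⟩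
    rw [hs, Set.encard_coe_eq_coe_finsetCard] at this
    exact_mod_cast this
  have A2 : k ≤ (S.filter (fun i => v - x i - e • d ∈ P)).card := by
    have := hge (v - e • d)
    have hs : {i | v - e • d - x i ∈ P} = ↑(S.filter (fun i => v - x i - e • d ∈ P)) := by
      ext i; simp only [Set.mem_ofPred_eq, Finset.coe_filter, r2, hS]
      exact ⟨fun hh => ⟨hn2.1 i hh, hh⟩, fun hh => hh.2⟩
    rw [hs, Set.encard_coe_eq_coe_finsetCard] at this
    exact_mod_cast this
  have B1 : (S.filter (fun i => v - x i + e • d ∈ interior P)).card ≤ k := by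
    have := hle (v + e • d)
    have hs : {i | v + e • d - x i ∈ interior P} =
        ↑(S.filter (fun i => v - x i + e • d ∈ interior P)) := by
      ext i; simp only [Set.mem_ofPred_eq, Finset.coe_filter, r1, hS]
      exact ⟨fun hh => ⟨hn1.1 i (interior_subset hh), hh⟩, fun hh => hh.2⟩
    rw [hs, Set.encard_coe_eq_coe_finsetCard] at this
    exact_mod_cast this
  have B2 : (S.filter (fun i => v - x i - e • d ∈ interior P)).card ≤ k := by
    have := hle (v - e • d)
    have hs : {i | v - e • d - x i ∈ interior P} =
        ↑(S.filter (fun i => v - x i - e • d ∈ interior P)) := by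
      ext i; simp only [Set.mem_ofPred_eq, Finset.coe_filter, r2, hS]
      exact ⟨fun hh => ⟨hn2.1 i (interior_subset hh), hh⟩, fun hh => hh.2⟩
    rw [hs, Set.encard_coe_eq_coe_finsetCard] at this
    exact_mod_cast this
  have hww : w ≠ -w := by
    intro hh
    have := congrArg f hh
    rw [map_neg] at this
    linarith
  have U : (S.filter (fun i => v - x i + e • d ∈ P)).card +
      (S.filter (fun i => v - x i - e • d ∈ P)).card +
      ((S.filter (fun i => v - x i = w)).card + (S.filter (fun i => v - x i = -w)).card) ≤
      2 * (S.filter (fun i => v - x i ∈ interior P)).card +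
        (S.filter (fun i => v - x i ∉ interior P)).card := by
    simp only [Finset.card_filter, Finset.mul_sum, ← Finset.sum_add_distrib]
    apply Finset.sum_le_sum
    intro i hi
    by_cases c1 : v - x i ∈ interior P
    · have d1 : v - x i ≠ w := fun hh => hwi (hh ▸ c1)
      have d2 : v - x i ≠ -w := fun hh => hwi' (hh ▸ c1)
      simp only [c1, d1, d2, if_true, if_false, not_true]
      split_ifs <;> norm_num
    by_cases c2 : v - x i = w
    · simp [c2, wout1, wout2, hwi, hww]
    by_cases c3 : v - x i = -w
    · simp [c3, wout3, wout4, hwi', hww.symm]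
    rcases hall i hi c1 c2 c3 with ⟨q1, q2⟩ | ⟨q1, q2⟩
    · simp [c1, c2, c3, interior_subset q1, q2]
    · simp [c1, c2, c3, interior_subset q1, q2]
  have L : 2 * (S.filter (fun i => v - x i ∈ interior P)).card +
        (S.filter (fun i => v - x i ∉ interior P)).card ≤
      (S.filter (fun i => v - x i + e • d ∈ interior P)).card +
      (S.filter (fun i => v - x i - e • d ∈ interior P)).card +
      ((S.filter (fun i => v - x i = w)).card + (S.filter (fun i => v - x i = -w)).card) := by
    simp only [Finset.card_filter, Finset.mul_sum, ← Finset.sum_add_distrib]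
    apply Finset.sum_le_sum
    intro i hi
    by_cases c1 : v - x i ∈ interior P
    · simp [c1, hn1.2 i c1, hn2.2 i c1]
    by_cases c2 : v - x i = w
    · simp [c2, hwi]; omega
    by_cases c3 : v - x i = -w
    · simp [c3, hwi']; omega
    rcases hall i hi c1 c2 c3 with ⟨q1, q2⟩ | ⟨q1, q2⟩
    · simp [c1, q1]; omega
    · simp [c1, q1]; omega
  omega

open Classical in
lemma Body.stepC {P : Set Pt} (h : Body P)
    {I : Type} (x : I → Pt) (k : ℕ) (ht : IsKFoldTranslativeTiling P x k) (v : Pt)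
    (S : Finset I) (hS : ∀ i, i ∈ S ↔ v - x i ∈ P) (a b : Pt) (f : Pt →L[ℝ] ℝ) (hne : a ≠ b)
    (haP : a ∈ P) (hfb : f b = f a) (hpos : 0 < f a) (hmax : ∀ z ∈ P, f z ≤ f a)
    (heq : ∀ z ∈ P, f z = f a → z ∈ segment ℝ a b)
    (hchord : ∀ z ∈ P, z ∉ interior P → f z < f a → - f a < f z →
      (∃ c > (0 : ℝ), z + c • (b - a) ∈ interior P) →
      ∀ s > (0 : ℝ), s ≤ 1 → z + s • (b - a) ∈ interior P) :
    k ≤ (S.filter (fun i => v - x i ∈ interior P)).card +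
      (S.filter (fun i => v - x i ∉ interior P ∧
        ∀ s > (0 : ℝ), s ≤ 1 → v - x i + s • (b - a) ∈ interior P)).card +
      (S.filter (fun i => f (v - x i) = - f a ∧ v - x i ≠ -a)).card := by
  obtain ⟨hdis, hge, hle⟩ := ht
  have hg : b - a ≠ 0 := sub_ne_zero.2 hne.symm
  have t1 : Tendsto (fun e : ℝ => v + e • (b - a)) (𝓝[>] 0) (𝓝 v) := by
    have : ContinuousAt (fun e : ℝ => v + e • (b - a)) 0 := by fun_prop
    have h2 := this.tendsto
    simp only [zero_smul, add_zero] at h2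
    exact h2.mono_left nhdsWithin_le_nhds
  obtain ⟨e, hn1, he⟩ := ((t1.eventually (nbhd_lem h.comp x hdis v)).and
    self_mem_nhdsWithin).exists
  have he : 0 < e := he
  set p := v + e • (b - a) with hp
  have t2 : Tendsto (fun δ : ℝ => p + δ • a) (𝓝[>] 0) (𝓝 p) := by
    have : ContinuousAt (fun δ : ℝ => p + δ • a) 0 := by fun_prop
    have h2 := this.tendsto
    simp only [zero_smul, add_zero] at h2
    exact h2.mono_left nhdsWithin_le_nhds
  obtain ⟨δ, hn2, hδ⟩ := ((t2.eventually (nbhd_lem h.comp x hdis p)).and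
    self_mem_nhdsWithin).exists
  have hδ : 0 < δ := hδ
  have hk := hge (p + δ • a)
  have hsub : {i | p + δ • a - x i ∈ P} ⊆ ↑((S.filter (fun i => v - x i ∈ interior P)) ∪
      (S.filter (fun i => v - x i ∉ interior P ∧
        ∀ s > (0 : ℝ), s ≤ 1 → v - x i + s • (b - a) ∈ interior P)) ∪
      (S.filter (fun i => f (v - x i) = - f a ∧ v - x i ≠ -a))) := by
    intro i hi
    have hi0 : p + δ • a - x i ∈ P := hi
    have hi1 := hn2.1 i hi0
    have hiP := hn1.1 i hi1
    have hiS := (hS i).2 hiP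
    have hpe : p - x i = v - x i + e • (b - a) := by rw [hp]; abel
    rw [hpe] at hi1
    simp only [Finset.coe_union, Finset.coe_filter, Set.mem_union, Set.mem_ofPred_eq, hiS,
      true_and]
    by_cases c1 : v - x i ∈ interior P
    · exact Or.inl (Or.inl c1)
    have b1 : f (v - x i) < f a := by
      have := hmax _ hi0
      have e1 : p + δ • a - x i = v - x i + e • (b - a) + δ • a := by rw [hp]; abel
      rw [e1, map_add, map_add, map_smul, map_smul, map_sub f b a, hfb] at this
      simp only [sub_self, smul_zero, add_zero, smul_eq_mul] at this
      have : 0 < δ * f a := by positivity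
      linarith
    have b2 : - f a ≤ f (v - x i) := by
      have := hmax _ (h.neg _ hiP)
      rw [map_neg] at this
      linarith
    rcases b2.eq_or_lt with b3 | b3
    · right
      refine ⟨b3.symm, fun hh => ?_⟩
      rw [hh] at hi1
      have hq := h.neg _ hi1
      have hqf : f (-(-a + e • (b - a))) = f a := by
        simp [hfb]
      obtain ⟨α, β, hα, hβ, hab, hs⟩ := heq _ hq hqf
      have : (e + β) • (b - a) = 0 := by
        have hα' : α = 1 - β := by linarith
        subst hα'
        have : (e + β) • (b - a) = ((1 - β) • a + β • b) - (-(-a + e • (b - a))) := by module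
        rw [this, hs, sub_self]
      rcases smul_eq_zero.1 this with h0 | h0
      · linarith
      · exact hg h0
    · left; right
      refine ⟨c1, ?_⟩
      rcases h.dir f a (b - a) (v - x i) haP hpos hg (by simp [hfb]) hiP c1 b1 b3 with
        ⟨⟨c, hc, hc1, -⟩, -⟩ | ⟨-, hc3⟩
      · exact hchord _ hiP c1 b1 b3 ⟨c, hc, hc1⟩
      · exact absurd hi1 (hc3 e he)
  have h2 := hk.trans (Set.encard_le_encard hsub)
  rw [Set.encard_coe_eq_coe_finsetCard] at h2
  have h3 := Nat.cast_le.1 h2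
  refine h3.trans ((Finset.card_union_le _ _).trans ?_)
  gcongr
  exact Finset.card_union_le _ _

lemma edge_left_extreme {P : Set Pt} {a b : Pt} (hab : IsEdgeOf P a b) :
    a ∈ Set.extremePoints ℝ P := by
  obtain ⟨hne, hsub, hext⟩ := hab
  refine ⟨hsub (left_mem_segment ℝ a b), ?_⟩
  intro x1 h1 x2 h2 hseg
  have e1 := hext h1 h2 (left_mem_segment ℝ a b) hseg
  have e2 := hext h2 h1 (left_mem_segment ℝ a b) (by rwa [openSegment_symm])
  rw [segment_eq_image'] at e1 e2
  obtain ⟨s, hs, rfl⟩ := e1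
  obtain ⟨t, ht, rfl⟩ := e2
  obtain ⟨α, β, hα, hβ, hαβ, h⟩ := hseg
  have h3 : (α * s + β * t) • (b - a) = 0 := by
    have hα' : α = 1 - β := by linarith
    subst hα'
    have : ((1 - β) * s + β * t) • (b - a) =
      ((1 - β) • (a + s • (b - a)) + β • (a + t • (b - a))) - a := by module
    rw [this]
    exact sub_eq_zero.2 h
  rcases smul_eq_zero.1 h3 with h0 | h0
  · have : s = 0 := by
      have := mul_nonneg hα.le hs.1
      have := mul_nonneg hβ.le ht.1
      have : α * s = 0 := by linarith
      simpa [hα.ne'] using this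
    simp [this]
  · exact absurd (sub_eq_zero.1 h0).symm hne

open Classical in
lemma core (m : ℕ) (hm : 4 ≤ m) (P : Set Pt)
    (hP : IsConvexPolygon P (2 * m)) (hsym : P = -P)
    (I : Type) (x : I → Pt) (k : ℕ)
    (ht : IsKFoldTranslativeTiling P x k)
    (w : Pt) (hw : w ∈ Set.extremePoints ℝ P) (j : I) (v : Pt) (hvG : v = w + x j)
    (a b : Pt) (l : I) (hab : IsEdgeOf P a b) (hend : v = a + x l) :
    (((m - 3 + 1) / 2 : ℕ) : ℕ∞) ≤
      {i : I | v - x i ∈ frontier P ∧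
        ∀ p ∈ segment ℝ (a + x l) (b + x l) \ {v}, p - x i ∈ interior P}.encard := by
  obtain ⟨hconv, hcomp, ⟨y, hy⟩, hfin, hcard, hhull⟩ := hP
  have hneg : ∀ z ∈ P, -z ∈ P := by
    intro z hz
    rw [hsym] at hz
    exact hz
  have hnegI : -y ∈ interior P := by
    have h2 := (Homeomorph.neg Pt).preimage_interior P
    have h3 : -y ∈ (Homeomorph.neg Pt) ⁻¹' interior P := by simpa using hy
    rw [h2] at h3
    rw [hsym]
    exact h3
  have h0 : (0 : Pt) ∈ interior P :=
    hconv.interior.segment_subset hy hnegI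
      ⟨1 / 2, 1 / 2, by norm_num, by norm_num, by norm_num, by module⟩
  have h : Body P := ⟨hconv, hcomp, h0, hneg⟩
  obtain ⟨f, hfb, hpos, hmax, heq⟩ := h.edge hab
  have haE := edge_left_extreme hab
  have hbE : b ∈ Set.extremePoints ℝ P :=
    edge_left_extreme ⟨hab.1.symm, by rw [segment_symm]; exact hab.2⟩
  have hne := hab.1
  have hnegE : ∀ u ∈ Set.extremePoints ℝ P, -u ∈ Set.extremePoints ℝ P := by
    intro u hu
    refine ⟨hneg u hu.1, ?_⟩
    intro x1 h1 x2 h2 hseg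
    have : u ∈ openSegment ℝ (-x1) (-x2) := by
      obtain ⟨α, β, hα, hβ, hαβ, hh⟩ := hseg
      refine ⟨α, β, hα, hβ, hαβ, ?_⟩
      rw [smul_neg, smul_neg, ← neg_add, hh, neg_neg]
    have := hu.2 (hneg _ h1) (hneg _ h2) this
    rw [← this, neg_neg]
  have hvert : ∀ u ∈ Set.extremePoints ℝ P, f u = f a → u = a ∨ u = b := by
    intro u hu hfu
    have := (mem_extremePoints_iff_forall_segment.1 hu).2 a haE.1 b hbE.1 (heq u hu.1 hfu)
    rcases this with h1 | h1
    · exact Or.inl h1.symm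
    · exact Or.inr h1.symm
  have hvert' : ∀ u ∈ Set.extremePoints ℝ P, f u = -f a → u = -a ∨ u = -b := by
    intro u hu hfu
    rcases hvert (-u) (hnegE u hu) (by rw [map_neg, hfu, neg_neg]) with h1 | h1
    · left; rw [← h1, neg_neg]
    · right; rw [← h1, neg_neg]
  have hmin : ∀ z ∈ P, -f a ≤ f z := by
    intro z hz
    have := hmax _ (hneg z hz)
    rw [map_neg] at this; linarith
  -- an extra vertex
  obtain ⟨u, huE, hu1, hu2⟩ : ∃ u ∈ Set.extremePoints ℝ P, f u < f a ∧ -f a < f u := by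
    by_contra hcon
    push Not at hcon
    have hsub : Set.extremePoints ℝ P ⊆ (({a, b, -a, -b} : Finset Pt) : Set Pt) := by
      intro u hu
      simp only [Finset.coe_insert, Finset.coe_singleton, Set.mem_insert_iff,
        Set.mem_singleton_iff]
      by_cases h1 : f u < f a
      · rcases hvert' u hu (le_antisymm (hcon u hu h1) (hmin u hu.1)) with h2 | h2 <;> simp [h2]
      · rcases hvert u hu (le_antisymm (hmax u hu.1) (not_lt.1 h1)) with h2 | h2 <;> simp [h2]
    have := Set.ncard_le_ncard hsub (Finset.finite_toSet _)
    rw [hcard, Set.ncard_coe_finset] at this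
    have h4 : ({a, b, -a, -b} : Finset Pt).card ≤ 4 := Finset.card_le_four
    omega
  have hchord := h.chord f hne haE.1 hbE.1 hfb hpos huE hu1 hu2
  -- the finite set of translates
  have hSfin : {i | v - x i ∈ P}.Finite := by
    have hB : Bornology.IsBounded ({v} - P) := Bornology.isBounded_singleton.sub hcomp.isBounded
    refine (ht.1 _ hB).subset ?_
    intro i hi
    exact ⟨v, rfl, v - x i, hi, by simp⟩
  set S := hSfin.toFinset with hSdef
  have hS : ∀ i, i ∈ S ↔ v - x i ∈ P := fun i => by simp [hSdef]
  have hA := h.stepA hfin hhull x k ht v S hS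
  have hC1 := h.stepC x k ht v S hS a b f hne haE.1 hfb hpos hmax heq hchord
  have hC2 := h.stepC x k ht v S hS (-b) (-a) (-f) (fun hh => hne (neg_injective hh).symm)
    (hneg b hbE.1) (by simp [hfb]) (by simp [hfb, hpos])
    (by
      intro z hz
      have := hmin z hz
      simp [hfb]; linarith)
    (by
      intro z hz hz2
      have := heq (-z) (hneg z hz) (by simpa [hfb] using hz2)
      obtain ⟨α, β, h1, h2, h3, h4⟩ := this
      refine ⟨β, α, h2, h1, by linarith, ?_⟩
      rw [smul_neg, smul_neg, ← neg_add, add_comm, h4, neg_neg])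
    (by
      intro z hz hzi h1 h2 h3
      have e : -a - -b = b - a := by abel
      rw [e] at h3 ⊢
      simp [hfb] at h1 h2
      exact hchord z hz hzi h2 (by linarith) h3)
  have e : -a - -b = b - a := by abel
  simp only [e, ContinuousLinearMap.neg_apply, map_neg, neg_neg, hfb, neg_inj] at hC2
  have hEi : ∀ u ∈ Set.extremePoints ℝ P, u ∉ interior P := by
    intro u hu
    obtain ⟨f', p', q'⟩ := h.expose hfin hhull u hu
    refine h.not_int f' u p' (fun z hz => ?_)
    by_cases hzu : z = u
    · rw [hzu]
    · exact (q' z hz hzu).le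
  set n : Pt → ℕ := fun u => (S.filter (fun i => v - x i = u)).card with hn
  set φ := (S.filter (fun i => v - x i ∈ interior P)).card
  set T := (S.filter (fun i => v - x i ∉ interior P)).card with hT
  set C := S.filter (fun i => v - x i ∉ interior P ∧
        ∀ s > (0 : ℝ), s ≤ 1 → v - x i + s • (b - a) ∈ interior P) with hCdef
  set H1 := (S.filter (fun i => f (v - x i) = f a ∧ v - x i ∉ Set.extremePoints ℝ P)).card with hH1
  set H2 := (S.filter (fun i => f (v - x i) = -f a ∧ v - x i ∉ Set.extremePoints ℝ P)).card
    with hH2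
  have hA' : ∀ u ∈ Set.extremePoints ℝ P, 2 * k + (n u + n (-u)) = 2 * φ + T := hA
  have hD1 : (S.filter (fun i => f (v - x i) = -f a ∧ v - x i ≠ -a)).card ≤ n (-b) + H2 := by
    refine le_trans (Finset.card_le_card ?_) (Finset.card_union_le _ _)
    intro i hi
    simp only [Finset.mem_filter, Finset.mem_union] at hi ⊢
    by_cases hE : v - x i ∈ Set.extremePoints ℝ P
    · left
      exact ⟨hi.1, (hvert' _ hE hi.2.1).resolve_left hi.2.2⟩
    · right
      exact ⟨hi.1, hi.2.1, hE⟩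
  have hD2 : (S.filter (fun i => f (v - x i) = f a ∧ v - x i ≠ b)).card ≤ n a + H1 := by
    refine le_trans (Finset.card_le_card ?_) (Finset.card_union_le _ _)
    intro i hi
    simp only [Finset.mem_filter, Finset.mem_union] at hi ⊢
    by_cases hE : v - x i ∈ Set.extremePoints ℝ P
    · left
      exact ⟨hi.1, (hvert _ hE hi.2.1).resolve_right hi.2.2⟩
    · right
      exact ⟨hi.1, hi.2.1, hE⟩
  have hT' : (S.filter (fun i => v - x i ∈ Set.extremePoints ℝ P)).card + H1 + H2 ≤ T := by
    simp only [hH1, hH2, hT, Finset.card_filter, ← Finset.sum_add_distrib]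
    apply Finset.sum_le_sum
    intro i hi
    by_cases hE : v - x i ∈ Set.extremePoints ℝ P
    · simp [hE, hEi _ hE]
    by_cases c1 : f (v - x i) = f a
    · have c2 : ¬ f (v - x i) = - f a := by intro hh; linarith
      have c3 : v - x i ∉ interior P :=
        h.not_int f _ (by rw [c1]; exact hpos) (by rw [c1]; exact hmax)
      rw [if_neg hE, if_pos ⟨c1, hE⟩, if_neg (fun hh => c2 hh.1), if_pos c3]
    by_cases c2 : f (v - x i) = - f a
    · have c3 : v - x i ∉ interior P := 
        h.not_int (-f) _ (by simp [c2, hpos]) (by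
          intro z hz
          have := hmin z hz
          simp only [ContinuousLinearMap.neg_apply, c2]; linarith)
      rw [if_neg hE, if_neg (fun hh => c1 hh.1), if_pos ⟨c2, hE⟩, if_pos c3]
    · rw [if_neg hE, if_neg (fun hh => c1 hh.1), if_neg (fun hh => c2 hh.1)]
      exact Nat.zero_le _
  set F := hfin.toFinset with hF
  have hsum : (S.filter (fun i => v - x i ∈ Set.extremePoints ℝ P)).card = ∑ u ∈ F, n u := by
    rw [Finset.card_eq_sum_card_fiberwise (f := fun i => v - x i) (t := F)]
    · apply Finset.sum_congr rfl
      intro u hu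
      rw [Finset.filter_filter]
      simp only [hn]
      congr 1
      apply Finset.filter_congr
      intro i _
      constructor
      · exact fun hh => hh.2
      · intro hh
        exact ⟨by rw [hh]; simpa [hF] using hu, hh⟩
    · intro i hi
      simp only [Finset.coe_filter, Set.mem_ofPred_eq] at hi
      simpa [hF] using hi.2
  have hsum2 : ∑ u ∈ F, n (-u) = ∑ u ∈ F, n u := by
    apply Finset.sum_nbij' (fun u => -u) (fun u => -u)
    · intro u hu; simp only [hF, Set.Finite.mem_toFinset] at hu ⊢; exact hnegE u hu
    · intro u hu; simp only [hF, Set.Finite.mem_toFinset] at hu ⊢; exact hnegE u hu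
    · intro u _; simp
    · intro u _; simp
    · intro u _; rfl
  set N := n w + n (-w) with hN
  have hconst : ∀ u ∈ Set.extremePoints ℝ P, n u + n (-u) = N := by
    intro u hu
    have := hA' u hu
    have := hA' w hw
    omega
  have hFc : F.card = 2 * m := by
    rw [← hcard, Set.ncard_eq_toFinset_card _ hfin]
  have hsum3 : 2 * ∑ u ∈ F, n u = 2 * m * N := by
    rw [two_mul]
    nth_rewrite 2 [← hsum2]
    rw [← Finset.sum_add_distrib, Finset.sum_congr rfl (g := fun _ => N), Finset.sum_const, hFc,
      smul_eq_mul]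
    intro u hu
    exact hconst u (by simpa [hF] using hu)
  have hN1 : 1 ≤ N := by
    have : 0 < n w := by
      apply Finset.card_pos.2
      refine ⟨j, Finset.mem_filter.2 ⟨(hS j).2 ?_, ?_⟩⟩
      · rw [hvG]; simpa using hw.1
      · rw [hvG]; simp
    omega
  have hfin1 : m - 3 ≤ 2 * C.card := by
    have q1 := hconst a haE
    have q2 := hconst b hbE
    have q3 := hA' w hw
    rw [hsum] at hT'
    have q4 : ∑ u ∈ F, n u = m * N := by
      have : 2 * ∑ u ∈ F, n u = 2 * (m * N) := by rw [hsum3]; ring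
      omega
    rw [q4] at hT'
    have q5 : m * N ≤ 2 * C.card + 3 * N := by omega
    have q6 : (m - 3) * N + 3 * N = m * N := by
      rw [← add_mul]; congr 1; omega
    have q7 : m - 3 ≤ (m - 3) * N := Nat.le_mul_of_pos_right _ hN1
    omega
  have hle : (m - 3 + 1) / 2 ≤ C.card := by omega
  have hCsub : (C : Set I) ⊆ {i : I | v - x i ∈ frontier P ∧
        ∀ p ∈ segment ℝ (a + x l) (b + x l) \ {v}, p - x i ∈ interior P} := by
    intro i hi
    simp only [hCdef, Finset.coe_filter, Set.mem_ofPred_eq, hS] at hi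
    obtain ⟨g1, g2, g3⟩ := hi
    refine ⟨?_, ?_⟩
    · rw [hcomp.isClosed.frontier_eq]
      exact ⟨g1, g2⟩
    · rintro p ⟨hp, hpv⟩
      rw [segment_eq_image'] at hp
      obtain ⟨s, hs, rfl⟩ := hp
      have hs0 : s ≠ 0 := by
        rintro rfl
        apply hpv
        simp [hend]
      have := g3 s (lt_of_le_of_ne hs.1 hs0.symm) hs.2
      have e2 : a + x l + s • (b + x l - (a + x l)) - x i = v - x i + s • (b - a) := by
        rw [hend]; module
      simp only [e2]
      exact this
  calc (((m - 3 + 1) / 2 : ℕ) : ℕ∞) ≤ (C.card : ℕ∞) := by exact_mod_cast hle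
    _ = (C : Set I).encard := (Set.encard_coe_eq_coe_finsetCard C).symm
    _ ≤ _ := Set.encard_le_encard hCsub

/-- let `m ≥ 4`, let `P` be a centrally symmetric convex `2m`-gon centered at the
origin, and let `P + X` be a `τ(P)`-fold translative tiling (i.e. a `k`-fold translative tiling
where no smaller multiplicity is possible). If `vG` is a vertex of a translate `P + x j` and
`G = [a + x l, b + x l]` is an edge of a translate `P + x l` having `vG` as an endpoint, then at
least `⌈(m−3)/2⌉` distinct indices `i` satisfy `vG ∈ ∂(P) + x i` and
`G ∖ {vG} ⊆ int(P) + x i`. -/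
theorem vertex_edge_interior_translates (m : ℕ) (hm : 4 ≤ m) (P : Set Pt)
    (hP : IsConvexPolygon P (2 * m)) (hsym : P = -P)
    (I : Type) (x : I → Pt) (k : ℕ) (hk : 0 < k)
    (ht : IsKFoldTranslativeTiling P x k)
    (hmin : ∀ (J : Type) (y : J → Pt) (k' : ℕ), 0 < k' → k' < k →
      ¬IsKFoldTranslativeTiling P y k')
    (w : Pt) (hw : w ∈ Set.extremePoints ℝ P) (j : I) (vG : Pt) (hvG : vG = w + x j)
    (a b : Pt) (l : I) (hab : IsEdgeOf P a b)
    (hend : vG = a + x l ∨ vG = b + x l) :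
    (((m - 3 + 1) / 2 : ℕ) : ℕ∞) ≤
      {i : I | vG - x i ∈ frontier P ∧
        ∀ p ∈ segment ℝ (a + x l) (b + x l) \ {vG}, p - x i ∈ interior P}.encard := by
  rcases hend with hend | hend
  · exact core m hm P hP hsym I x k ht w hw j vG hvG a b l hab hend
  · rw [segment_symm ℝ (a + x l) (b + x l)]
    exact core m hm P hP hsym I x k ht w hw j vG hvG b a l
      ⟨hab.1.symm, by rw [segment_symm]; exact hab.2⟩ hend
end
end

section
/- Let P be a centrally symmetric convex polygon in ℝ² with exactly 2m vertices. If m is even, then P admits no k-fold translative tiling of ℝ² for any positive integer k < m − 1 (so τ*(P) ≥ τ(P) ≥ m − 1); if m is odd, then P admits no k-fold translative tiling of ℝ² for any positive integer k < m − 2 (so τ*(P) ≥ τ(P) ≥ m − 2). -/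
open Set Pointwise

noncomputable section

/-! ### Cross product and the combinatorial description of the polygon -/

/-- Planar cross product. -/
def cr (a b : Pt) : ℝ := a.1 * b.2 - a.2 * b.1

/-- The edge functional. -/
def L (v : ℕ → Pt) (i : ℕ) (q : Pt) : ℝ := cr (v (i + 1) - v i) (q - v i)

/-- The edge vector. -/
def ed (v : ℕ → Pt) (i : ℕ) : Pt := v (i + 1) - v i

structure Gon (P : Set Pt) (m : ℕ) (v : ℕ → Pt) : Prop where
  hm : 3 ≤ m
  per : ∀ i, v (i + m) = - v i
  ang : ∀ i j, i < j → j < i + m → 0 < cr (v i) (v j)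
  conv : Convex ℝ P
  comp : IsCompact P
  zero : (0 : Pt) ∈ P
  mem : ∀ i, v i ∈ P
  sup : ∀ i, ∀ q ∈ P, 0 ≤ L v i q
  strict : ∀ i k, L v i (v k) = 0 → v k = v i ∨ v k = v (i + 1)

namespace Gon

variable {P : Set Pt} {m : ℕ} {v : ℕ → Pt}

lemma periodic (g : Gon P m v) : Function.Periodic v (2 * m) := by
  intro i
  rw [two_mul, ← add_assoc, g.per, g.per, neg_neg]

lemma ne_of_lt (g : Gon P m v) {i j : ℕ} (h1 : i < j) (h2 : j < i + 2 * m) : v i ≠ v j := by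
  intro h
  rcases lt_trichotomy j (i + m) with h3 | h3 | h3
  · have := g.ang i j h1 h3
    rw [h] at this
    simp [cr, mul_comm] at this
  · subst h3
    have h0 := g.ang i (i + 1) (by omega) (by have := g.hm; omega)
    rw [g.per] at h
    have h4 : v i = 0 := self_eq_neg.mp h
    simp [h4, cr] at h0
  · obtain ⟨l, rfl⟩ := Nat.exists_eq_add_of_lt h3
    have := g.ang i (i + l + 1) (by omega) (by omega)
    have e : i + m + l + 1 = (i + l + 1) + m := by ring
    rw [e, g.per] at h
    rw [h] at this
    simp [cr, mul_comm] at this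

lemma eq_mod (g : Gon P m v) {i j : ℕ} (h : v i = v j) : i ≡ j [MOD 2 * m] := by
  have hm := g.hm
  have h1 := g.periodic.map_mod_nat i
  have h2 := g.periodic.map_mod_nat j
  have b1 := Nat.mod_lt i (show 0 < 2 * m by omega)
  have b2 := Nat.mod_lt j (show 0 < 2 * m by omega)
  rw [← h1, ← h2] at h
  rcases lt_trichotomy (i % (2 * m)) (j % (2 * m)) with h3 | h3 | h3
  · exact absurd h (g.ne_of_lt h3 (by omega))
  · exact h3
  · exact absurd h.symm (g.ne_of_lt h3 (by omega))

lemma of_mod (g : Gon P m v) {i j : ℕ} (h : i ≡ j [MOD 2 * m]) : v i = v j := by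
  rw [← g.periodic.map_mod_nat i, ← g.periodic.map_mod_nat j, h]

lemma succ_iff (g : Gon P m v) {i j : ℕ} : v (i + 1) = v (j + 1) ↔ v i = v j := by
  constructor
  · intro h
    exact g.of_mod (Nat.ModEq.add_right_cancel' 1 (g.eq_mod h))
  · intro h
    exact g.of_mod (Nat.ModEq.add_right 1 (g.eq_mod h))

lemma ed_congr (g : Gon P m v) {i j : ℕ} (h : v i = v j) : ed v i = ed v j := by
  unfold ed; rw [g.succ_iff.mpr h, h]

lemma ed_add (g : Gon P m v) (i : ℕ) : ed v (i + m) = - ed v i := by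
  unfold ed
  rw [show i + m + 1 = (i + 1) + m by ring, g.per, g.per]; abel

lemma L_congr (g : Gon P m v) {i j : ℕ} (h : v i = v j) (q : Pt) : L v i q = L v j q := by
  unfold L; rw [g.succ_iff.mpr h, h]

lemma L_mod (g : Gon P m v) (i : ℕ) (q : Pt) : L v (i % (2 * m)) q = L v i q :=
  g.L_congr (g.periodic.map_mod_nat i) q

lemma ed_mod (g : Gon P m v) (i : ℕ) : ed v (i % (2 * m)) = ed v i :=
  g.ed_congr (g.periodic.map_mod_nat i)

lemma L_neg (g : Gon P m v) (i : ℕ) (q : Pt) : L v (i + m) q = L v i (-q) := by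
  unfold L
  rw [show i + m + 1 = (i + 1) + m by ring, g.per, g.per]
  simp only [cr, Prod.fst_sub, Prod.snd_sub, Prod.fst_neg, Prod.snd_neg]
  ring

lemma det_pos (g : Gon P m v) (i : ℕ) : 0 < cr (v i) (v (i + 1)) :=
  g.ang i (i + 1) (by omega) (by have := g.hm; omega)

lemma L_zero (v : ℕ → Pt) (i : ℕ) : L v i 0 = cr (v i) (v (i + 1)) := by
  simp only [L, cr, Prod.fst_sub, Prod.snd_sub, Prod.fst_zero, Prod.snd_zero]; ring

lemma L_add (v : ℕ → Pt) (i : ℕ) (q d : Pt) : L v i (q + d) = L v i q + cr (ed v i) d := by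
  simp only [L, ed, cr, Prod.fst_sub, Prod.snd_sub, Prod.fst_add, Prod.snd_add]; ring

lemma L_comb (v : ℕ → Pt) (i : ℕ) (a b : ℝ) (p q : Pt) :
    L v i (a • p + b • q) = a * L v i p + b * L v i q + (1 - a - b) * L v i 0 := by
  simp only [L, cr, Prod.fst_sub, Prod.snd_sub, Prod.fst_add, Prod.snd_add, Prod.smul_fst,
    Prod.smul_snd, smul_eq_mul, Prod.fst_zero, Prod.snd_zero]; ring

lemma L_self (v : ℕ → Pt) (i : ℕ) : L v i (v i) = 0 := by
  simp [L, cr]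

lemma L_self' (v : ℕ → Pt) (i : ℕ) : L v i (v (i + 1)) = 0 := by
  simp only [L, cr]; ring

lemma solve {a b : Pt} (h : 0 < cr a b) (p : Pt) :
    p = (cr p b / cr a b) • a + (cr a p / cr a b) • b := by
  have h' : a.1 * b.2 - a.2 * b.1 ≠ 0 := h.ne'
  ext
  · simp only [cr, Prod.fst_add, Prod.smul_fst, smul_eq_mul]
    rw [div_mul_eq_mul_div, div_mul_eq_mul_div, ← add_div, eq_div_iff h']
    ring
  · simp only [cr, Prod.snd_add, Prod.smul_snd, smul_eq_mul]
    rw [div_mul_eq_mul_div, div_mul_eq_mul_div, ← add_div, eq_div_iff h']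
    ring

lemma cone (g : Gon P m v) (p : Pt) :
    ∃ k, ∃ a b : ℝ, 0 ≤ a ∧ 0 ≤ b ∧ p = a • v k + b • v (k + 1) := by
  have key : ∃ k, 0 ≤ cr (v k) p ∧ cr (v (k + 1)) p ≤ 0 := by
    by_contra hcon
    push Not at hcon
    obtain ⟨i, hi⟩ : ∃ i, 0 ≤ cr (v i) p := by
      rcases le_total 0 (cr (v 0) p) with h | h
      · exact ⟨0, h⟩
      · refine ⟨0 + m, ?_⟩
        rw [g.per]
        simp only [cr, Prod.fst_neg, Prod.snd_neg] at h ⊢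
        linarith
    have hall : ∀ n, 0 < cr (v (i + 1 + n)) p := by
      intro n
      induction n with
      | zero => exact hcon i hi
      | succ n ih => exact hcon _ ih.le
    have h1 := hall 0
    have h2 := hall m
    rw [g.per] at h2
    simp only [cr, Prod.fst_neg, Prod.snd_neg, add_zero] at h1 h2
    linarith
  obtain ⟨k, h1, h2⟩ := key
  have hd := g.det_pos k
  refine ⟨k, _, _, ?_, ?_, solve hd p⟩
  · apply div_nonneg _ hd.le
    simp only [cr] at h2 ⊢; linarith
  · exact div_nonneg h1 hd.le

lemma cone' (g : Gon P m v) {p : Pt} (hp : ∀ i, 0 ≤ L v i p) :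
    ∃ k, ∃ a b : ℝ, 0 ≤ a ∧ 0 ≤ b ∧ a + b ≤ 1 ∧ p = a • v k + b • v (k + 1) := by
  obtain ⟨k, a, b, ha, hb, rfl⟩ := g.cone p
  refine ⟨k, a, b, ha, hb, ?_, rfl⟩
  have h := hp k
  rw [L_comb, L_self, L_self', L_zero] at h
  have hd := g.det_pos k
  by_contra hc
  push Not at hc
  nlinarith

lemma mem_iff (g : Gon P m v) (p : Pt) : p ∈ P ↔ ∀ i, 0 ≤ L v i p := by
  refine ⟨fun h i => g.sup i p h, fun h => ?_⟩
  obtain ⟨k, a, b, ha, hb, hab, rfl⟩ := g.cone' h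
  have := g.conv.sum_mem (t := Finset.univ) (w := ![a, b, 1 - a - b]) (z := ![v k, v (k + 1), 0])
    (by intro i _; fin_cases i <;> simp <;> linarith) (by simp [Fin.sum_univ_three])
    (by intro i _; fin_cases i <;> simp [g.mem, g.zero])
  simpa [Fin.sum_univ_three] using this

lemma L_cont (v : ℕ → Pt) (i : ℕ) : Continuous (L v i) := by
  unfold L cr; fun_prop

lemma int_iff (g : Gon P m v) (p : Pt) : p ∈ interior P ↔ ∀ i, 0 < L v i p := by
  constructor
  · intro h i
    have h0 := g.sup i p (interior_subset h)
    rcases h0.lt_or_eq with h1 | h1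
    · exact h1
    exfalso
    have hc : Filter.Tendsto (fun s : ℝ => p + s • v i) (nhds 0) (nhds p) := by
      have : Continuous (fun s : ℝ => p + s • v i) := by fun_prop
      simpa using this.tendsto 0
    have ev := hc.eventually (mem_interior_iff_mem_nhds.mp h)
    have ev2 : ∀ᶠ s : ℝ in nhdsWithin 0 (Set.Ioi 0), p + s • v i ∈ P := ev.filter_mono inf_le_left
    obtain ⟨s, hs, hs0⟩ := (ev2.and self_mem_nhdsWithin).exists
    have := g.sup i _ hs
    rw [L_add, ← h1] at this
    have hd := g.det_pos i
    have hs0' : 0 < s := hs0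
    simp only [cr, ed, Prod.fst_sub, Prod.snd_sub, Prod.smul_fst, Prod.smul_snd,
      smul_eq_mul] at this hd
    nlinarith [mul_pos hs0' hd]
  · intro h
    have hm := g.hm
    have ho : IsOpen {q : Pt | ∀ i ∈ Finset.range (2 * m), 0 < L v i q} := by
      have : {q : Pt | ∀ i ∈ Finset.range (2 * m), 0 < L v i q} =
          ⋂ i ∈ Finset.range (2 * m), {q : Pt | 0 < L v i q} := by
        ext; simp
      rw [this]
      exact isOpen_biInter_finset fun i _ => isOpen_lt continuous_const (L_cont v i)
    refine interior_maximal ?_ ho (fun i _ => h i)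
    intro q hq
    rw [g.mem_iff]
    intro i
    rw [← g.L_mod]
    exact (hq _ (Finset.mem_range.mpr (Nat.mod_lt _ (by omega)))).le

/-- Trichotomy for points on an edge. -/
lemma tri (g : Gon P m v) {p : Pt} (hp : p ∈ P) {i : ℕ} (h : L v i p = 0) :
    p = v i ∨ p = v (i + 1) ∨
      ((∃ a b : ℝ, 0 < a ∧ 0 < b ∧ a + b = 1 ∧ p = a • v i + b • v (i + 1)) ∧
        ∀ j, L v j p = 0 → v j = v i) := by
  have hm := g.hm
  obtain ⟨k, a, b, ha, hb, hab, rfl⟩ := g.cone' ((g.mem_iff p).mp hp)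
  have main : ∀ j, L v j (a • v k + b • v (k + 1)) = 0 →
      a + b = 1 ∧ a * L v j (v k) = 0 ∧ b * L v j (v (k + 1)) = 0 := by
    intro j hj
    rw [L_comb] at hj
    have h0 := g.det_pos j
    rw [← L_zero] at h0
    have h1 := mul_nonneg ha (g.sup j _ (g.mem k))
    have h2 := mul_nonneg hb (g.sup j _ (g.mem (k + 1)))
    have h3 := mul_nonneg (show 0 ≤ 1 - a - b by linarith) h0.le
    refine ⟨?_, by linarith, by linarith⟩
    have : (1 - a - b) * L v j 0 = 0 := by linarith
    rcases mul_eq_zero.mp this with h | h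
    · linarith
    · exact absurd h h0.ne'
  obtain ⟨hab1, h1, h2⟩ := main i h
  rcases ha.eq_or_lt with ha0 | ha0
  · subst ha0
    have hb1 : b = 1 := by linarith
    subst hb1
    simp only [zero_smul, one_smul, zero_add, one_mul] at h2 ⊢
    rcases g.strict _ _ h2 with h | h
    · exact Or.inl h
    · exact Or.inr (Or.inl h)
  rcases hb.eq_or_lt with hb0 | hb0
  · subst hb0
    have hb1 : a = 1 := by linarith
    subst hb1
    simp only [zero_smul, one_smul, add_zero, one_mul] at h1 ⊢
    rcases g.strict _ _ h1 with h | h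
    · exact Or.inl h
    · exact Or.inr (Or.inl h)
  have main2 : ∀ j, L v j (a • v k + b • v (k + 1)) = 0 → v k = v j := by
    intro j hj
    obtain ⟨-, h1, h2⟩ := main j hj
    have h1 := (mul_eq_zero.mp h1).resolve_left ha0.ne'
    have h2 := (mul_eq_zero.mp h2).resolve_left hb0.ne'
    rcases g.strict _ _ h1 with h | h
    · exact h
    · exfalso
      have h' := g.succ_iff.mpr h
      rcases g.strict _ _ h2 with h3 | h3
      · rw [h'] at h3
        exact g.ne_of_lt (i := j) (j := j + 1 + 1) (by omega) (by omega) h3.symm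
      · rw [h'] at h3
        exact g.ne_of_lt (i := j + 1) (j := j + 1 + 1) (by omega) (by omega) h3.symm
  have e := main2 i h
  refine Or.inr (Or.inr ⟨⟨a, b, ha0, hb0, hab1, ?_⟩, fun j hj => ?_⟩)
  · rw [e, g.succ_iff.mpr e]
  · rw [← main2 j hj, e]

lemma ed_cross (g : Gon P m v) (i : ℕ) : 0 < cr (ed v i) (ed v (i + 1)) := by
  have hm := g.hm
  have h : cr (ed v i) (ed v (i + 1)) = L v i (v (i + 1 + 1)) := by
    simp only [cr, ed, L, Prod.fst_sub, Prod.snd_sub]; ring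
  rw [h]
  refine lt_of_le_of_ne (g.sup i _ (g.mem _)) (fun h0 => ?_)
  rcases g.strict _ _ h0.symm with h1 | h1
  · exact g.ne_of_lt (i := i) (j := i + 1 + 1) (by omega) (by omega) h1.symm
  · exact g.ne_of_lt (i := i + 1) (j := i + 1 + 1) (by omega) (by omega) h1.symm

lemma par_pos (g : Gon P m v) {i j : ℕ} {l : ℝ} (hl : 0 < l) (h : ed v j = l • ed v i) :
    v j = v i := by
  have hm := g.hm
  have h1 : ∀ q, L v j q = l * (L v i q - L v i (v j)) := by
    intro q
    have : L v j q = cr (ed v j) (q - v j) := rfl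
    rw [this, h]
    simp only [cr, ed, L, Prod.fst_sub, Prod.snd_sub, Prod.smul_fst, Prod.smul_snd, smul_eq_mul]
    ring
  have h2 := h1 (v i)
  rw [L_self] at h2
  have h3 := g.sup j _ (g.mem i)
  have h4 := g.sup i _ (g.mem j)
  have h5 : L v i (v j) = 0 := by nlinarith
  have h6 := h1 (v (j + 1))
  rw [L_self', h5] at h6
  have h7 : L v i (v (j + 1)) = 0 := by
    rcases mul_eq_zero.mp h6.symm with h | h
    · exact absurd h hl.ne'
    · linarith
  rcases g.strict _ _ h5 with h | h
  · exact h
  · exfalso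
    have h' := g.succ_iff.mpr h
    rcases g.strict _ _ h7 with h3 | h3
    · rw [h'] at h3
      exact g.ne_of_lt (i := i) (j := i + 1 + 1) (by omega) (by omega) h3.symm
    · rw [h'] at h3
      exact g.ne_of_lt (i := i + 1) (j := i + 1 + 1) (by omega) (by omega) h3.symm

lemma par (g : Gon P m v) {i j : ℕ} (h : cr (ed v j) (ed v i) = 0) :
    v j = v i ∨ v j = v (i + m) := by
  have hi : ∀ i, 0 < (ed v i).1 ^ 2 + (ed v i).2 ^ 2 := by
    intro i
    have h1 := g.ed_cross i
    by_contra hc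
    have h2 : (ed v i).1 = 0 := by nlinarith [sq_nonneg (ed v i).1, sq_nonneg (ed v i).2]
    have h3 : (ed v i).2 = 0 := by nlinarith [sq_nonneg (ed v i).1, sq_nonneg (ed v i).2]
    simp [cr, h2, h3] at h1
  have hi0 := hi i
  set l : ℝ := ((ed v j).1 * (ed v i).1 + (ed v j).2 * (ed v i).2) /
    ((ed v i).1 ^ 2 + (ed v i).2 ^ 2) with hl
  have he : ed v j = l • ed v i := by
    simp only [cr] at h
    ext
    · simp only [Prod.smul_fst, smul_eq_mul, hl]
      field_simp
      linear_combination (ed v i).2 * h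
    · simp only [Prod.smul_snd, smul_eq_mul, hl]
      field_simp
      linear_combination -(ed v i).1 * h
  rcases lt_trichotomy l 0 with h0 | h0 | h0
  · right
    refine g.par_pos (l := -l) (by linarith) ?_
    rw [g.ed_add, he]; simp
  · have := hi j
    rw [he, h0] at this
    simp at this
  · left
    exact g.par_pos h0 he

/-- Pushing a vertex of the right chain by the bottom edge vector lands in the interior. -/
lemma push (g : Gon P m v) {i : ℕ} (h1 : 1 < i) (h2 : i < m) (h : ℕ) :
    0 < L v h (v i - ed v 0) := by
  have hm := g.hm
  have hd : 0 < cr (v 1) (v m) := g.ang 1 m (by omega) (by omega)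
  have ha : 0 < cr (v i) (v m) / cr (v 1) (v m) := div_pos (g.ang i m (by omega) (by omega)) hd
  have hb : 0 < cr (v 1) (v i) / cr (v 1) (v m) := div_pos (g.ang 1 i (by omega) (by omega)) hd
  have hs := solve hd (v i)
  set a := cr (v i) (v m) / cr (v 1) (v m)
  set b := cr (v 1) (v i) / cr (v 1) (v m)
  have hv0 : v m = - v 0 := by have := g.per 0; rwa [zero_add] at this
  have pos : ∀ j k, v k ≠ v j → v k ≠ v (j + 1) → 0 < L v j (v k) := by
    intro j k h1 h2
    refine lt_of_le_of_ne (g.sup j _ (g.mem k)) (fun h0 => ?_)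
    rcases g.strict _ _ h0.symm with h | h
    · exact h1 h
    · exact h2 h
  have hab : 1 < a + b := by
    by_contra hc
    push Not at hc
    have e := L_self v i
    have p1 : 0 < L v i (v 1) := pos _ _ (g.ne_of_lt (by omega) (by omega))
      (g.ne_of_lt (by omega) (by omega))
    have p2 := g.sup i _ (g.mem m)
    have p3 := g.det_pos i
    rw [← L_zero] at p3
    have e2 := L_comb v i a b (v 1) (v m)
    rw [← hs, e] at e2
    have := mul_pos ha p1
    have := mul_nonneg hb.le p2
    have := mul_nonneg (show 0 ≤ 1 - a - b by linarith) p3.le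
    linarith
  have q0 : 0 < L v 0 (v i) := pos _ _ (g.ne_of_lt (by omega) (by omega)).symm
      (g.ne_of_lt (by omega) (by omega)).symm
  have qm : 0 < L v (0 + m) (v i) := pos _ _ (g.ne_of_lt (by omega) (by omega))
      (g.ne_of_lt (by omega) (by omega))
  rw [g.L_neg] at qm
  have hv0' : v 0 = - v m := by rw [hv0, neg_neg]
  have e0 : L v 0 (v i) = cr (v 1) (v m) * (1 + b - a) := by
    rw [hs]
    simp only [L, zero_add, hv0', cr, Prod.fst_sub, Prod.snd_sub, Prod.fst_add, Prod.snd_add,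
      Prod.smul_fst, Prod.smul_snd, smul_eq_mul, Prod.fst_neg, Prod.snd_neg]
    ring
  have em : L v 0 (-v i) = cr (v 1) (v m) * (1 - b + a) := by
    rw [hs]
    simp only [L, zero_add, hv0', cr, Prod.fst_sub, Prod.snd_sub, Prod.fst_add, Prod.snd_add,
      Prod.smul_fst, Prod.smul_snd, smul_eq_mul, Prod.fst_neg, Prod.snd_neg]
    ring
  rw [e0] at q0
  rw [em] at qm
  have c1 : 0 < 1 + b - a := (mul_pos_iff_of_pos_left hd).mp q0
  have c2 : 0 < 1 - b + a := (mul_pos_iff_of_pos_left hd).mp qm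
  -- now the functional `h`
  set D := L v h 0 with hD
  set s := cr (ed v h) (v 1) with hs'
  set t := cr (ed v h) (v m) with ht
  have hD0 : 0 < D := by rw [hD, L_zero]; exact g.det_pos h
  have form : ∀ x y : ℝ, L v h (x • v 1 + y • v m) = D + x * s + y * t := by
    intro x y
    rw [hD, hs', ht]
    simp only [L, ed, cr, Prod.fst_sub, Prod.snd_sub, Prod.fst_add, Prod.snd_add,
      Prod.smul_fst, Prod.smul_snd, smul_eq_mul, Prod.fst_zero, Prod.snd_zero]
    ring
  have t1 : 0 ≤ D + s := by
    have := g.sup h _ (g.mem 1)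
    have e := form 1 0
    simp at e; linarith
  have t2 : 0 ≤ D + t := by
    have := g.sup h _ (g.mem m)
    have e := form 0 1
    simp at e; linarith
  have t3 : 0 ≤ D - s := by
    have := g.sup h _ (g.mem (1 + m))
    rw [g.per] at this
    have e := form (-1) 0
    simp at e; linarith
  have t4 : 0 ≤ D - t := by
    have := g.sup h _ (g.mem 0)
    rw [hv0'] at this
    have e := form 0 (-1)
    simp at e; linarith
  have t5 : 0 ≤ D + a * s + b * t := by
    have := g.sup h _ (g.mem i)
    rw [hs, form] at this; exact this
  have eq : v i - ed v 0 = (a - 1) • v 1 + (b - 1) • v m := by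
    rw [ed, zero_add, hv0']
    nth_rewrite 1 [hs]
    module
  rw [eq, form]
  rcases lt_or_ge (a + b) 2 with hlt | hge
  · -- |a-1| + |b-1| < 1
    rcases le_total 1 a with x1 | x1 <;> rcases le_total 1 b with x2 | x2
    · linarith
    · nlinarith [mul_nonneg (sub_nonneg.mpr x1) t1, mul_nonneg (sub_nonneg.mpr x2) t4]
    · nlinarith [mul_nonneg (sub_nonneg.mpr x1) t3, mul_nonneg (sub_nonneg.mpr x2) t2]
    · nlinarith [mul_nonneg (sub_nonneg.mpr x1) t3, mul_nonneg (sub_nonneg.mpr x2) t4]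
  · -- convex combination
    have mid : 0 < D + (a - b) / 2 * (s - t) := by
      rcases le_total b a with x | x
      · nlinarith [mul_nonneg (sub_nonneg.mpr x) t1, mul_nonneg (sub_nonneg.mpr x) t4]
      · nlinarith [mul_nonneg (sub_nonneg.mpr x) t3, mul_nonneg (sub_nonneg.mpr x) t2]
    have hpos : 0 < a + b := by linarith
    have : (a + b) * (D + (a - 1) * s + (b - 1) * t) =
        (a + b - 2) * (D + a * s + b * t) + 2 * (D + (a - b) / 2 * (s - t)) := by ring
    have : 0 < (a + b) * (D + (a - 1) * s + (b - 1) * t) := by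
      rw [this]
      have := mul_nonneg (show 0 ≤ a + b - 2 by linarith) t5
      linarith
    exact (mul_pos_iff_of_pos_left hpos).mp this

lemma push' (g : Gon P m v) {i : ℕ} (h1 : 1 < i) (h2 : i < m) (h : ℕ) :
    0 < L v h (v (i + m) + ed v 0) := by
  have := g.push h1 h2 (h + m)
  rw [g.L_neg] at this
  rw [g.per]
  convert this using 2
  abel

lemma push_edge (g : Gon P m v) {i : ℕ} (h1 : 1 < i) (h2 : i + 1 < m) {p : Pt} (hp : p ∈ P)
    (hl : L v (i + m) p = 0) (h : ℕ) : 0 < L v h (p + ed v 0) := by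
  have p1 := g.push' h1 (by omega) h
  have p2 := g.push' (i := i + 1) (by omega) h2 h
  rw [show i + 1 + m = i + m + 1 by ring] at p2
  rcases g.tri hp hl with rfl | rfl | ⟨⟨a, b, ha, hb, hab, rfl⟩, -⟩
  · exact p1
  · exact p2
  · have : a • v (i + m) + b • v (i + m + 1) + ed v 0 =
        a • (v (i + m) + ed v 0) + b • (v (i + m + 1) + ed v 0) := by
      have : ed v 0 = (a + b) • ed v 0 := by rw [hab, one_smul]
      nth_rewrite 1 [this]
      module
    rw [this, L_comb, show 1 - a - b = 0 by linarith]
    have := mul_pos ha p1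
    have := mul_pos hb p2
    linarith

end Gon

/-! ### Local counting -/

/-- The direction `d` points into `P` at its point `p`. -/
def In (v : ℕ → Pt) (p d : Pt) : Prop := ∀ j, L v j p = 0 → 0 < cr (ed v j) d

/-- `d` is a small perturbation of the direction of edge `i`. -/
def Near (v : ℕ → Pt) (i : ℕ) (d : Pt) : Prop :=
  (∀ j, cr (ed v j) d ≠ 0) ∧ (∀ j, 0 < cr (ed v j) (ed v i) → 0 < cr (ed v j) d) ∧
    ∀ j, cr (ed v j) (ed v i) < 0 → cr (ed v j) d < 0

namespace Gon

variable {P : Set Pt} {m : ℕ} {v : ℕ → Pt}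

lemma cr_neg_right (a b : Pt) : cr a (-b) = - cr a b := by
  simp only [cr, Prod.fst_neg, Prod.snd_neg]; ring

lemma cr_neg_left (a b : Pt) : cr (-a) b = - cr a b := by
  simp only [cr, Prod.fst_neg, Prod.snd_neg]; ring

lemma cr_swap (a b : Pt) : cr a b = - cr b a := by
  simp only [cr]; ring

lemma cr_smul_right (a b : Pt) (s : ℝ) : cr a (s • b) = s * cr a b := by
  simp only [cr, Prod.smul_fst, Prod.smul_snd, smul_eq_mul]; ring

lemma exists_near (g : Gon P m v) (i : ℕ) :
    ∃ d₁ d₂, Near v i d₁ ∧ Near v i d₂ ∧ 0 < cr (ed v i) d₁ ∧ cr (ed v i) d₂ < 0 := by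
  have hm := g.hm
  have hc : ∀ j, cr (ed v j) (ed v i) ≠ 0 → ∀ᶠ s : ℝ in nhdsWithin 0 (Set.Ioi 0),
      |s * cr (ed v j) (v i)| < |cr (ed v j) (ed v i)| := by
    intro j hj
    have : Continuous (fun s : ℝ => |s * cr (ed v j) (v i)|) := by fun_prop
    have h0 := this.tendsto 0
    have h1 : |(0 : ℝ) * cr (ed v j) (v i)| < |cr (ed v j) (ed v i)| := by
      simpa using hj
    exact (h0.eventually_lt_const h1).filter_mono inf_le_left
  have hall : ∀ᶠ s : ℝ in nhdsWithin 0 (Set.Ioi 0), ∀ j ∈ Finset.range (2 * m),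
      cr (ed v j) (ed v i) ≠ 0 → |s * cr (ed v j) (v i)| < |cr (ed v j) (ed v i)| := by
    rw [Filter.eventually_all_finset]
    intro j _
    by_cases hj : cr (ed v j) (ed v i) = 0
    · exact Filter.Eventually.of_forall fun s h => absurd hj h
    · filter_upwards [hc j hj] with s hs _ using hs
  obtain ⟨s, hs, hs0⟩ := (hall.and self_mem_nhdsWithin).exists
  have hs0 : 0 < s := hs0
  have hs' : ∀ j, cr (ed v j) (ed v i) ≠ 0 →
      |s * cr (ed v j) (v i)| < |cr (ed v j) (ed v i)| := by
    intro j hj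
    have := hs (j % (2 * m)) (Finset.mem_range.mpr (Nat.mod_lt _ (by omega)))
    rw [g.ed_mod] at this
    exact this hj
  have hii : cr (ed v i) (v i) < 0 := by
    have := g.det_pos i
    simp only [cr, ed, Prod.fst_sub, Prod.snd_sub] at this ⊢
    linarith
  have key : ∀ c : ℝ, c = s ∨ c = -s → Near v i (ed v i + c • v i) := by
    intro c hcs
    have ex : ∀ j, cr (ed v j) (ed v i + c • v i) =
        cr (ed v j) (ed v i) + c * cr (ed v j) (v i) := by
      intro j
      simp only [cr, Prod.fst_add, Prod.snd_add, Prod.smul_fst, Prod.smul_snd, smul_eq_mul]; ring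
    have hab : ∀ j, cr (ed v j) (ed v i) ≠ 0 →
      |c * cr (ed v j) (v i)| < |cr (ed v j) (ed v i)| := by
      intro j hj
      rcases hcs with rfl | rfl
      · exact hs' j hj
      · rw [neg_mul, abs_neg]; exact hs' j hj
    have hpos : ∀ j, 0 < cr (ed v j) (ed v i) → 0 < cr (ed v j) (ed v i + c • v i) := by
      intro j hj
      have := hab j hj.ne'
      rw [abs_of_pos hj] at this
      rw [ex]
      linarith [(abs_lt.mp this).1]
    have hneg : ∀ j, cr (ed v j) (ed v i) < 0 → cr (ed v j) (ed v i + c • v i) < 0 := by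
      intro j hj
      have := hab j hj.ne
      rw [abs_of_neg hj] at this
      rw [ex]
      linarith [(abs_lt.mp this).2]
    refine ⟨?_, hpos, hneg⟩
    intro j
    rcases lt_trichotomy (cr (ed v j) (ed v i)) 0 with h | h | h
    · exact (hneg j h).ne
    · have hc0 : c ≠ 0 := by rcases hcs with rfl | rfl <;> simp [hs0.ne']
      rw [ex, h, zero_add]
      refine mul_ne_zero hc0 ?_
      rcases g.par h with h1 | h1
      · rw [g.ed_congr h1]; exact hii.ne
      · rw [g.ed_congr h1, g.ed_add, cr_neg_left]; simpa using hii.ne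
    · exact (hpos j h).ne'
  have self0 : cr (ed v i) (ed v i) = 0 := by simp only [cr]; ring
  refine ⟨ed v i + (-s) • v i, ed v i + s • v i, key _ (Or.inr rfl), key _ (Or.inl rfl), ?_, ?_⟩
  · have : cr (ed v i) (ed v i + (-s) • v i) = - (s * cr (ed v i) (v i)) := by
      simp only [cr, Prod.fst_add, Prod.snd_add, Prod.smul_fst, Prod.smul_snd, smul_eq_mul]; ring
    rw [this]; nlinarith
  · have : cr (ed v i) (ed v i + s • v i) = (s * cr (ed v i) (v i)) := by
      simp only [cr, Prod.fst_add, Prod.snd_add, Prod.smul_fst, Prod.smul_snd, smul_eq_mul]; ring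
    rw [this]; nlinarith

lemma eventually_in (g : Gon P m v) (p d : Pt) (hd : ∀ j, cr (ed v j) d ≠ 0) :
    ∀ᶠ s : ℝ in nhdsWithin 0 (Set.Ioi 0),
      ((p ∈ P ∧ In v p d) → p + s • d ∈ interior P) ∧
      (¬ (p ∈ P ∧ In v p d) → p + s • d ∉ P) := by
  have hm := g.hm
  have hc : Continuous (fun s : ℝ => p + s • d) := by fun_prop
  by_cases hp : p ∈ P
  · by_cases hin : In v p d
    · have : ∀ᶠ s : ℝ in nhdsWithin 0 (Set.Ioi 0), ∀ j ∈ Finset.range (2 * m),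
          0 < L v j (p + s • d) := by
        rw [Filter.eventually_all_finset]
        intro j _
        rcases (g.sup j p hp).lt_or_eq with h | h
        · have h0 := ((L_cont v j).comp hc).tendsto 0
          have h1 : 0 < (L v j ∘ fun s : ℝ => p + s • d) 0 := by simpa using h
          exact (h0.eventually_const_lt h1).filter_mono inf_le_left
        · filter_upwards [self_mem_nhdsWithin] with s hs
          rw [L_add, ← h, zero_add, cr_smul_right]
          exact mul_pos hs (hin j h.symm)
      filter_upwards [this] with s hs
      refine ⟨fun _ => ?_, fun h => absurd ⟨hp, hin⟩ h⟩
      rw [g.int_iff]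
      intro j
      rw [← g.L_mod]
      exact hs _ (Finset.mem_range.mpr (Nat.mod_lt _ (by omega)))
    · have hin' := hin
      unfold In at hin'
      push Not at hin'
      obtain ⟨j, h1, h2⟩ := hin'
      filter_upwards [self_mem_nhdsWithin] with s hs
      refine ⟨fun h => absurd h.2 hin, fun _ hmem => ?_⟩
      have := g.sup j _ hmem
      rw [L_add, h1, zero_add, cr_smul_right] at this
      have h3 := mul_pos_of_neg_of_neg (lt_of_le_of_ne h2 (hd j)) (neg_neg_of_pos hs)
      linarith [h3]
  · have h0 := hc.tendsto 0
    have h1 : Pᶜ ∈ nhds (p + (0 : ℝ) • d) := by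
      simpa using g.comp.isClosed.isOpen_compl.mem_nhds hp
    have ev : ∀ᶠ s : ℝ in nhdsWithin 0 (Set.Ioi 0), p + s • d ∈ Pᶜ :=
      (h0.eventually h1).filter_mono inf_le_left
    filter_upwards [ev] with s hs
    exact ⟨fun h => absurd h.1 hp, fun _ => hs⟩

lemma finite_cover (g : Gon P m v) {I : Type} {x : I → Pt} (hx : IsDiscreteFamily x) (w : Pt) :
    {i : I | w - x i ∈ P}.Finite := by
  have hb : Bornology.IsBounded ((fun q : Pt => w - q) '' P) :=
    (g.comp.image (by fun_prop)).isBounded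
  refine (hx _ hb).subset ?_
  intro i hi
  exact ⟨_, hi, by simp⟩

lemma loc (g : Gon P m v) {I : Type} {x : I → Pt} {k : ℕ} (ht : IsKFoldTranslativeTiling P x k)
    (w d : Pt) (hd : ∀ j, cr (ed v j) d ≠ 0) :
    {i : I | w - x i ∈ P ∧ In v (w - x i) d}.encard = k := by
  obtain ⟨hx, h1, h2⟩ := ht
  -- indices that matter
  have hK : IsCompact ((fun z : ℝ × Pt => w + z.1 • d - z.2) '' (Set.Icc 0 1 ×ˢ P)) :=
    (isCompact_Icc.prod g.comp).image (by fun_prop)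
  have hZ := hx _ hK.isBounded
  have ev : ∀ᶠ s : ℝ in nhdsWithin 0 (Set.Ioi 0), ∀ i ∈ hZ.toFinset,
      (((w - x i) ∈ P ∧ In v (w - x i) d) → (w - x i) + s • d ∈ interior P) ∧
      (¬ ((w - x i) ∈ P ∧ In v (w - x i) d) → (w - x i) + s • d ∉ P) := by
    rw [Filter.eventually_all_finset]
    intro i _
    exact g.eventually_in _ d hd
  have ev1 : ∀ᶠ s : ℝ in nhdsWithin 0 (Set.Ioi 0), s < 1 :=
    (eventually_lt_nhds one_pos).filter_mono inf_le_left
  obtain ⟨s, ⟨hs, hs1⟩, hs0⟩ := ((ev.and ev1).and self_mem_nhdsWithin).exists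
  have hs0 : 0 < s := hs0
  have e : ∀ i, w + s • d - x i = (w - x i) + s • d := fun i => by abel
  have inZ : ∀ i, ∀ s : ℝ, 0 ≤ s → s ≤ 1 → (w - x i) + s • d ∈ P → i ∈ hZ.toFinset := by
    intro i s h0 h1 hi
    rw [Set.Finite.mem_toFinset]
    exact ⟨(s, (w - x i) + s • d), ⟨⟨h0, h1⟩, hi⟩, by simp only; abel⟩
  apply le_antisymm
  · refine le_trans (Set.encard_le_encard ?_) (h2 (w + s • d))
    intro i hi
    have hi' : w - x i ∈ P ∧ In v (w - x i) d := hi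
    have hz : i ∈ hZ.toFinset := inZ i 0 le_rfl zero_le_one (by simpa using hi'.1)
    show w + s • d - x i ∈ interior P
    rw [e]
    exact (hs i hz).1 hi
  · refine le_trans (h1 (w + s • d)) (Set.encard_le_encard ?_)
    intro i hi
    have hi' : w + s • d - x i ∈ P := hi
    rw [e] at hi'
    by_contra hc
    exact (hs i (inZ i s hs0.le hs1.le hi')).2 hc hi'

open Classical in
lemma pointwise (g : Gon P m v) (i : ℕ) {d₁ d₂ : Pt} (n₁ : Near v (i + 1) d₁)
    (n₂ : Near v (i + 1) d₂) (c₁ : 0 < cr (ed v (i + 1)) d₁) (c₂ : cr (ed v (i + 1)) d₂ < 0)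
    {p : Pt} (hp : p ∈ P) :
    ((if In v p d₁ then 1 else 0) - (if In v p d₂ then 1 else 0) : ℤ) =
      ((if L v (i + 1) p = 0 then 1 else 0) - (if p = v (i + 1 + 1) then 1 else 0)) -
      ((if L v (i + 1 + m) p = 0 then 1 else 0) - (if p = v (i + 1 + m) then 1 else 0)) := by
  have hm := g.hm
  have hsum : L v (i + 1) p + L v (i + 1 + m) p = 2 * L v (i + 1) 0 := by
    rw [g.L_neg]
    simp only [L, cr, Prod.fst_sub, Prod.snd_sub, Prod.fst_neg, Prod.snd_neg, Prod.fst_zero,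
      Prod.snd_zero]
    ring
  have h0 : 0 < L v (i + 1) 0 := by rw [L_zero]; exact g.det_pos _
  have x1 : 0 < cr (ed v i) (ed v (i + 1)) := g.ed_cross i
  have x2 : cr (ed v (i + 1 + 1)) (ed v (i + 1)) < 0 := by
    rw [cr_swap]; linarith [g.ed_cross (i + 1)]
  have y1 : cr (ed v (i + m)) (ed v (i + 1)) < 0 := by
    rw [g.ed_add, cr_neg_left]; linarith
  have y2 : 0 < cr (ed v (i + 1 + 1 + m)) (ed v (i + 1)) := by
    rw [g.ed_add, cr_neg_left]; linarith
  by_cases hA : L v (i + 1) p = 0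
  · have hB : L v (i + 1 + m) p ≠ 0 := by
      intro h; rw [hA, h] at hsum; linarith
    have hpB : p ≠ v (i + 1 + m) := by
      rintro rfl; exact hB (L_self v _)
    have hn2 : ¬ In v p d₂ := fun h => absurd (h _ hA) (by linarith)
    have hiff : In v p d₁ ↔ p ≠ v (i + 1 + 1) := by
      constructor
      · rintro h rfl
        have := h (i + 1 + 1) (L_self v _)
        linarith [n₁.2.2 _ x2]
      · intro hne j hj
        rcases g.tri hp hA with rfl | rfl | ⟨-, h⟩
        · rcases g.strict _ _ hj with h | h
          · rw [g.ed_congr h.symm]; exact c₁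
          · rw [← g.ed_congr (g.succ_iff.mp h)]; exact n₁.2.1 _ x1
        · exact absurd rfl hne
        · rw [g.ed_congr (h j hj)]; exact c₁
    simp only [hA, hB, hpB, hn2, hiff, if_true, if_false]
    by_cases hq : p = v (i + 1 + 1) <;> simp [hq]
  · have hpA : p ≠ v (i + 1 + 1) := by
      rintro rfl; exact hA (L_self' v _)
    by_cases hB : L v (i + 1 + m) p = 0
    · have hn1 : ¬ In v p d₁ := by
        intro h
        have := h _ hB
        rw [g.ed_add, cr_neg_left] at this
        linarith
      have c₂' : 0 < cr (ed v (i + 1 + m)) d₂ := by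
        rw [g.ed_add, cr_neg_left]; linarith
      have hiff : In v p d₂ ↔ p ≠ v (i + 1 + m) := by
        constructor
        · rintro h rfl
          have := h (i + m) (by rw [show i + 1 + m = i + m + 1 by ring]; exact L_self' v _)
          linarith [n₂.2.2 _ y1]
        · intro hne j hj
          rcases g.tri hp hB with rfl | rfl | ⟨-, h⟩
          · exact absurd rfl hne
          · rcases g.strict _ _ hj with h | h
            · rw [← g.ed_congr h, show i + 1 + m + 1 = i + 1 + 1 + m by ring]
              exact n₂.2.1 _ y2
            · rw [← g.ed_congr (g.succ_iff.mp h)]; exact c₂'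
          · rw [g.ed_congr (h j hj)]; exact c₂'
      simp only [hA, hpA, hB, hn1, hiff, if_true, if_false]
      by_cases hq : p = v (i + 1 + m) <;> simp [hq]
    · have hpB : p ≠ v (i + 1 + m) := by
        rintro rfl; exact hB (L_self v _)
      have hiff : In v p d₁ ↔ In v p d₂ := by
        refine forall_congr' fun j => forall_congr' fun hj => ?_
        rcases lt_trichotomy (cr (ed v j) (ed v (i + 1))) 0 with h | h | h
        · have := n₁.2.2 _ h
          have := n₂.2.2 _ h
          constructor <;> intro <;> linarith
        · exfalso
          rcases g.par h with h | h
          · exact hA (by rw [← g.L_congr h]; exact hj)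
          · exact hB (by rw [← g.L_congr h]; exact hj)
        · exact ⟨fun _ => n₂.2.1 _ h, fun _ => n₁.2.1 _ h⟩
      simp [hA, hpA, hB, hpB, hiff]

end Gon

/-! ### Global counting -/

/-- The number of translates covering `w` whose relative position satisfies `q`. -/
def cnt (P : Set Pt) {I : Type} (x : I → Pt) (w : Pt) (q : Pt → Prop) : ℕ :=
  {i : I | w - x i ∈ P ∧ q (w - x i)}.ncard

namespace Gon

variable {P : Set Pt} {m : ℕ} {v : ℕ → Pt}

open Classical in
lemma cnt_eq (g : Gon P m v) {I : Type} {x : I → Pt} (hx : IsDiscreteFamily x) (w : Pt)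
    (q : Pt → Prop) :
    cnt P x w q = ((g.finite_cover hx w).toFinset.filter (fun i => q (w - x i))).card := by
  rw [cnt, ← Set.ncard_coe_finset]
  congr 1
  ext i
  simp

lemma cnt_in (g : Gon P m v) {I : Type} {x : I → Pt} {k : ℕ} (ht : IsKFoldTranslativeTiling P x k)
    (w d : Pt) (hd : ∀ j, cr (ed v j) d ≠ 0) : cnt P x w (fun p => In v p d) = k := by
  have := g.loc ht w d hd
  rw [cnt, Set.ncard, this]; rfl

lemma balance (g : Gon P m v) {I : Type} {x : I → Pt} {k : ℕ}
    (ht : IsKFoldTranslativeTiling P x k) (w : Pt) (i : ℕ) :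
    (cnt P x w (fun p => L v (i + 1) p = 0) : ℤ) - cnt P x w (fun p => p = v (i + 1 + 1)) =
      cnt P x w (fun p => L v (i + 1 + m) p = 0) - cnt P x w (fun p => p = v (i + 1 + m)) := by
  classical
  obtain ⟨d₁, d₂, n₁, n₂, c₁, c₂⟩ := g.exists_near (i + 1)
  have e1 := g.cnt_in ht w d₁ n₁.1
  have e2 := g.cnt_in ht w d₂ n₂.1
  have e : (cnt P x w (fun p => In v p d₁) : ℤ) - cnt P x w (fun p => In v p d₂) = 0 := by
    rw [e1, e2]; simp
  simp only [g.cnt_eq ht.1] at e ⊢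
  simp only [← Finset.sum_boole] at e ⊢
  rw [← Finset.sum_sub_distrib] at e
  rw [← sub_eq_zero, ← Finset.sum_sub_distrib, ← Finset.sum_sub_distrib,
    ← Finset.sum_sub_distrib]
  refine (Finset.sum_congr rfl fun y hy => ?_).trans e
  have hy' : w - x y ∈ P := by simpa using hy
  convert (g.pointwise i n₁ n₂ c₁ c₂ hy').symm

lemma edge_ge (g : Gon P m v) {I : Type} {x : I → Pt} (hx : IsDiscreteFamily x) (w : Pt) (i : ℕ) :
    cnt P x w (fun p => p = v i) + cnt P x w (fun p => p = v (i + 1)) ≤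
      cnt P x w (fun p => L v i p = 0) := by
  classical
  have hm := g.hm
  simp only [g.cnt_eq hx]
  rw [← Finset.card_union_of_disjoint]
  · apply Finset.card_le_card
    intro y hy
    simp only [Finset.mem_union, Finset.mem_filter] at hy ⊢
    rcases hy with ⟨h1, h2⟩ | ⟨h1, h2⟩
    · exact ⟨h1, by rw [h2]; exact L_self v i⟩
    · exact ⟨h1, by rw [h2]; exact L_self' v i⟩
  · rw [Finset.disjoint_left]
    intro y hy1 hy2
    simp only [Finset.mem_filter] at hy1 hy2
    have h1 := hy1.2
    have h2 := hy2.2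
    exact g.ne_of_lt (i := i) (j := i + 1) (by omega) (by omega) (h1.symm.trans h2)

lemma kappa (g : Gon P m v) {I : Type} {x : I → Pt} {k : ℕ}
    (ht : IsKFoldTranslativeTiling P x k) (w : Pt) {j₀ : ℕ} (h : ∃ y, w - x y = v j₀) (j : ℕ) :
    1 ≤ cnt P x w (fun p => p = v j) + cnt P x w (fun p => p = v (j + m)) := by
  have hm := g.hm
  set a : ℕ → ℕ := fun j => cnt P x w (fun p => p = v j) with ha
  have per : ∀ j, a (j + m + m) = a j := by
    intro j
    simp only [ha]
    rw [g.per, g.per, neg_neg]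
  have step : ∀ n, a (n + 1 + 1) + a (n + 1 + 1 + m) = a (n + 1) + a (n + 1 + m) := by
    intro n
    have b1 := g.balance ht w n
    have b2 := g.balance ht w (n + m)
    have hL : ∀ p, L v (n + m + 1 + m) p = L v (n + 1) p := by
      intro p
      apply g.L_congr
      rw [g.per, show n + m + 1 = n + 1 + m by ring, g.per, neg_neg]
    simp only [hL] at b2
    have e1 : n + m + 1 + m = n + 1 + m + m := by ring
    have e2 : n + m + 1 = n + 1 + m := by ring
    have e3 : n + 1 + m + 1 = n + 1 + 1 + m := by ring
    rw [e1, e2, e3] at b2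
    have p := per (n + 1)
    simp only [ha] at p ⊢
    rw [p] at b2
    omega
  have all : ∀ n, a (n + 1) + a (n + 1 + m) = a 1 + a (1 + m) := by
    intro n
    induction n with
    | zero => simp
    | succ n ih => rw [step, ih]
  have all' : ∀ n, a n + a (n + m) = a 1 + a (1 + m) := by
    intro n
    have := all (n + m - 1)
    rw [show n + m - 1 + 1 = n + m by omega, per] at this
    omega
  have h1 : 1 ≤ a j₀ := by
    obtain ⟨y, hy⟩ := h
    simp only [ha, cnt]
    rw [Nat.one_le_iff_ne_zero, ← Nat.pos_iff_ne_zero, Set.ncard_pos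
      ((g.finite_cover ht.1 w).subset fun i hi => hi.1)]
    exact ⟨y, by rw [Set.mem_ofPred_eq, hy]; exact ⟨g.mem j₀, rfl⟩⟩
  have := all' j
  have := all' j₀
  show 1 ≤ a j + a (j + m)
  omega

lemma exists_of_cnt {I : Type} {x : I → Pt} {w : Pt} {q : Pt → Prop} (h : 1 ≤ cnt P x w q) :
    ∃ y, w - x y ∈ P ∧ q (w - x y) := by
  have : cnt P x w q ≠ 0 := by omega
  obtain ⟨y, hy⟩ := Set.nonempty_of_ncard_ne_zero this
  exact ⟨y, hy⟩

lemma exists_vertex (g : Gon P m v) {I : Type} {x : I → Pt} {k : ℕ}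
    (ht : IsKFoldTranslativeTiling P x k) (w : Pt) {j₀ : ℕ} (h : ∃ y, w - x y = v j₀) (j : ℕ) :
    ∃ y, w - x y = v j ∨ w - x y = v (j + m) := by
  have := g.kappa ht w h j
  by_cases h1 : 1 ≤ cnt P x w (fun p => p = v j)
  · obtain ⟨y, -, hy⟩ := exists_of_cnt h1
    exact ⟨y, Or.inl hy⟩
  · have h2 : 1 ≤ cnt P x w (fun p => p = v (j + m)) := by omega
    obtain ⟨y, -, hy⟩ := exists_of_cnt h2
    exact ⟨y, Or.inr hy⟩

lemma exists_edge (g : Gon P m v) {I : Type} {x : I → Pt} {k : ℕ}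
    (ht : IsKFoldTranslativeTiling P x k) (w : Pt) {j₀ : ℕ} (h : ∃ y, w - x y = v j₀) (i : ℕ) :
    ∃ y, w - x y ∈ P ∧ L v (i + 1) (w - x y) = 0 := by
  apply exists_of_cnt (q := fun p => L v (i + 1) p = 0)
  have h1 := g.kappa ht w h (i + 1 + 1)
  have h2 := g.balance ht w i
  have h3 := g.edge_ge ht.1 w (i + 1 + m)
  rw [show i + 1 + m + 1 = i + 1 + 1 + m by ring] at h3
  omega

/-- Two disjoint edges have no common point. -/
lemma edges_disjoint (g : Gon P m v) {p : Pt} (hp : p ∈ P) {i j : ℕ} (h1 : i + 1 < j)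
    (h2 : j + 1 < i + 2 * m) (hi : L v i p = 0) (hj : L v j p = 0) : False := by
  rcases g.tri hp hi with rfl | rfl | ⟨-, h⟩
  · rcases g.strict _ _ hj with h | h
    · exact g.ne_of_lt (by omega) (by omega) h
    · exact g.ne_of_lt (by omega) (by omega) h
  · rcases g.strict _ _ hj with h | h
    · exact g.ne_of_lt (by omega) (by omega) h
    · exact g.ne_of_lt (by omega) (by omega) h
  · exact g.ne_of_lt (i := i) (j := j) (by omega) (by omega) (h j hj).symm

theorem bound (g : Gon P m v) {I : Type} {x : I → Pt} {k : ℕ} (hk : 0 < k)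
    (ht : IsKFoldTranslativeTiling P x k) : 2 * ((m - 2) / 2) + (m - 1) ≤ 2 * k := by
  classical
  have hm := g.hm
  obtain ⟨y₀⟩ : Nonempty I := by
    have h := ht.2.1 0
    by_contra hI
    rw [not_nonempty_iff] at hI
    have : {i : I | (0 : Pt) - x i ∈ P} = ∅ := Set.eq_empty_of_isEmpty _
    rw [this, Set.encard_empty] at h
    have h' : k = 0 := by simpa using h
    omega
  set w : Pt := x y₀ + v 0 with hw
  set u : Pt := x y₀ + v 1 with hu
  have hwu : ∀ y, u - x y = (w - x y) + ed v 0 := by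
    intro y; simp only [hw, hu, ed, zero_add]; abel
  have hwv : ∃ y, w - x y = v 0 := ⟨y₀, by simp [hw]⟩
  have huv : ∃ y, u - x y = v 1 := ⟨y₀, by simp [hu]⟩
  -- interior translates at `u`
  have hedge : ∀ r : ℕ, ∃ y, w - x y ∈ P ∧ L v (2 + 2 * r + m) (w - x y) = 0 := by
    intro r
    obtain ⟨y, hy⟩ := g.exists_edge ht w hwv (1 + 2 * r + m)
    rw [show 1 + 2 * r + m + 1 = 2 + 2 * r + m by ring] at hy
    exact ⟨y, hy⟩
  choose f hf1 hf2 using hedge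
  set F : Finset I := (Finset.range ((m - 2) / 2)).image f with hF
  have hFcard : F.card = (m - 2) / 2 := by
    rw [hF, Finset.card_image_of_injOn, Finset.card_range]
    have main : ∀ r s, r < s → s < (m - 2) / 2 → f r ≠ f s := by
      intro r s hrs hs hfe
      have h2 := hf2 s
      rw [← hfe] at h2
      exact g.edges_disjoint (hf1 r) (by omega) (by omega) (hf2 r) h2
    intro r hr s hs hfe
    simp only [Finset.coe_range, Set.mem_Iio] at hr hs
    rcases lt_trichotomy r s with h | h | h
    · exact absurd hfe (main r s h hs)
    · exact h
    · exact absurd hfe.symm (main s r h hr)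
  have hFint : ∀ y ∈ F, ∀ j, 0 < L v j (u - x y) := by
    intro y hy j
    simp only [hF, Finset.mem_image, Finset.mem_range] at hy
    obtain ⟨r, hr, rfl⟩ := hy
    rw [hwu]
    exact g.push_edge (by omega) (by omega) (hf1 r) (hf2 r) j
  -- boundary translates at `u`
  have hvert := g.exists_vertex ht u huv
  choose t ht' using hvert
  set S : Finset ℕ := insert 0 (Finset.Ico 2 m) with hS
  have hScard : S.card = m - 1 := by
    rw [hS, Finset.card_insert_of_notMem (by simp), Nat.card_Ico]; omega
  set T : Finset I := S.image t with hT
  have hSm : ∀ i ∈ S, i < m := by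
    intro i hi
    simp only [hS, Finset.mem_insert, Finset.mem_Ico] at hi
    omega
  have hTcard : T.card = m - 1 := by
    rw [hT, Finset.card_image_of_injOn, hScard]
    have main : ∀ r s, r < s → s < m → t r ≠ t s := by
      intro r s hrs hs hfe
      have h1 := ht' r
      have h2 := ht' s
      rw [← hfe] at h2
      rcases h1 with h1 | h1 <;> rcases h2 with h2 | h2 <;> rw [h1] at h2
      · exact g.ne_of_lt (by omega) (by omega) h2
      · exact g.ne_of_lt (by omega) (by omega) h2
      · exact g.ne_of_lt (by omega) (by omega) h2.symm
      · exact g.ne_of_lt (by omega) (by omega) h2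
    intro r hr s hs hfe
    have hr := hSm r hr
    have hs := hSm s hs
    rcases lt_trichotomy r s with h | h | h
    · exact absurd hfe (main r s h hs)
    · exact h
    · exact absurd hfe.symm (main s r h hr)
  have hdisj : Disjoint F T := by
    rw [Finset.disjoint_left]
    intro y hy hyT
    simp only [hT, Finset.mem_image] at hyT
    obtain ⟨i, -, rfl⟩ := hyT
    rcases ht' i with h | h
    · have := hFint _ hy i
      rw [h, L_self] at this
      exact lt_irrefl _ this
    · have := hFint _ hy (i + m)
      rw [h, L_self] at this
      exact lt_irrefl _ this
  -- the two directions
  obtain ⟨d, -, n, -, c, -⟩ := g.exists_near 0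
  have e1 := g.cnt_in ht u d n.1
  have e2 := g.cnt_in ht u (-d) (fun j => by rw [cr_neg_right]; simpa using n.1 j)
  rw [g.cnt_eq ht.1] at e1 e2
  set Y := (g.finite_cover ht.1 u).toFinset with hY
  set A := Y.filter (fun i => In v (u - x i) d)
  set B := Y.filter (fun i => In v (u - x i) (-d))
  have hYmem : ∀ y, y ∈ Y ↔ u - x y ∈ P := by intro y; simp [hY]
  have hFA : F ⊆ A ∩ B := by
    intro y hy
    have h := hFint y hy
    simp only [A, B, Finset.mem_inter, Finset.mem_filter]
    have hmem : y ∈ Y := by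
      rw [hYmem, g.mem_iff]; exact fun j => (h j).le
    exact ⟨⟨hmem, fun j hj => absurd hj (h j).ne'⟩, ⟨hmem, fun j hj => absurd hj (h j).ne'⟩⟩
  have hTA : T ⊆ A ∪ B := by
    intro y hy
    simp only [hT, Finset.mem_image] at hy
    obtain ⟨i, hi, rfl⟩ := hy
    have hmem : t i ∈ Y := by
      rw [hYmem]
      rcases ht' i with h | h <;> rw [h] <;> exact g.mem _
    simp only [A, B, Finset.mem_union, Finset.mem_filter, hmem, true_and]
    simp only [hS, Finset.mem_insert, Finset.mem_Ico] at hi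
    rcases hi with rfl | ⟨hi2, him⟩
    · have hpre : 0 < cr (ed v (2 * m - 1)) (ed v 0) := by
        have := g.ed_cross (2 * m - 1)
        have e : v (2 * m - 1 + 1) = v 0 := by
          rw [show 2 * m - 1 + 1 = 0 + 2 * m by omega]; exact g.periodic 0
        rwa [g.ed_congr e] at this
      have hin : ∀ j, L v j (v 0) = 0 → 0 < cr (ed v j) d := by
        intro j hj
        rcases g.strict _ _ hj with h | h
        · rw [← g.ed_congr h]; exact c
        · have e : v (2 * m - 1 + 1) = v 0 := by
            rw [show 2 * m - 1 + 1 = 0 + 2 * m by omega]; exact g.periodic 0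
          rw [← e] at h
          rw [← g.ed_congr (g.succ_iff.mp h)]
          exact n.2.1 _ hpre
      rcases ht' 0 with h | h
      · left
        rw [h]
        exact hin
      · right
        rw [h]
        intro j hj
        have h1 : L v (j + m) (v 0) = 0 := by
          rw [g.L_neg, ← g.per]; exact hj
        have := hin _ h1
        rw [g.ed_add, cr_neg_left] at this
        rwa [cr_neg_right]
    · rcases ht' i with h | h
      · right
        rw [h]
        intro j hj
        have := g.push (i := i) (by omega) him j
        rw [sub_eq_add_neg, L_add, hj, zero_add, cr_neg_right] at this
        rw [cr_neg_right]
        have := n.2.2 j (by linarith)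
        linarith
      · left
        rw [h]
        intro j hj
        have := g.push' (i := i) (by omega) him j
        rw [L_add, hj, zero_add] at this
        exact n.2.1 j this
  have hFT : F ∪ T ⊆ A ∪ B := by
    refine Finset.union_subset (hFA.trans ?_) hTA
    exact Finset.inter_subset_left.trans Finset.subset_union_left
  have k1 := Finset.card_le_card hFA
  have k2 := Finset.card_le_card hFT
  rw [Finset.card_union_of_disjoint hdisj] at k2
  have k3 := Finset.card_union_add_card_inter A B
  omega

end Gon

/-! ### Existence of the cyclic enumeration -/

lemma extreme_aux {P : Set Pt} (hc : Convex ℝ P) (h0 : (0 : Pt) ∈ P) {e r s : Pt}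
    (he : e ∈ Set.extremePoints ℝ P) (hr : r ∈ P) (hs : s ∈ P) {a b : ℝ} (ha : 0 < a)
    (ha1 : a < 1) (hb : 0 ≤ b) (hab : a + b ≤ 1) (h : e = a • r + b • s) : r = e := by
  have hs' : (b / (1 - a)) • s ∈ P := by
    have h1 : 0 ≤ b / (1 - a) := div_nonneg hb (by linarith)
    have h2 : b / (1 - a) ≤ 1 := (div_le_one (by linarith)).mpr (by linarith)
    have := hc hs h0 h1 (sub_nonneg.mpr h2) (by ring)
    simpa using this
  refine (mem_extremePoints.mp he).2 r hr _ hs' ⟨a, 1 - a, ha, by linarith, by ring, ?_⟩ |>.1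
  rw [h, smul_smul, mul_div_cancel₀ _ (show (1 - a) ≠ 0 by linarith)]

lemma ray_aux {P : Set Pt} (hc : Convex ℝ P) (h0 : (0 : Pt) ∈ P) {e r : Pt}
    (he : e ∈ Set.extremePoints ℝ P) (hr : r ∈ Set.extremePoints ℝ P) {t : ℝ} (ht : 0 < t)
    (h : e = t • r) : e = r := by
  rcases lt_trichotomy t 1 with h1 | h1 | h1
  · exact (extreme_aux hc h0 he (extremePoints_subset hr) h0 ht h1 le_rfl (by linarith)
      (by simpa using h)).symm
  · rw [h, h1, one_smul]
  · refine extreme_aux hc h0 hr (extremePoints_subset he) h0 (inv_pos.mpr ht) (inv_lt_one_of_one_lt₀ h1)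
      le_rfl (by linarith [inv_lt_one_of_one_lt₀ h1]) ?_
    rw [h, smul_smul, inv_mul_cancel₀ ht.ne']; simp

lemma not_extreme_zero {P : Set Pt} (hzint : (0 : Pt) ∈ interior P) :
    (0 : Pt) ∉ Set.extremePoints ℝ P := by
  intro h
  have hcont : Filter.Tendsto (fun s : ℝ => s • ((1, 0) : Pt)) (nhds 0) (nhds 0) := by
    have : Continuous (fun s : ℝ => s • ((1, 0) : Pt)) := by fun_prop
    simpa using this.tendsto 0
  have hcont2 : Filter.Tendsto (fun s : ℝ => s • ((-1, 0) : Pt)) (nhds 0) (nhds 0) := by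
    have : Continuous (fun s : ℝ => s • ((-1, 0) : Pt)) := by fun_prop
    simpa using this.tendsto 0
  have ev := (hcont.eventually (mem_interior_iff_mem_nhds.mp hzint)).and
    (hcont2.eventually (mem_interior_iff_mem_nhds.mp hzint))
  have ev' : ∀ᶠ s : ℝ in nhdsWithin 0 (Set.Ioi 0), s • ((1, 0) : Pt) ∈ P ∧ s • ((-1, 0) : Pt) ∈ P :=
    ev.filter_mono inf_le_left
  obtain ⟨s, ⟨h1, h2⟩, hs⟩ := (ev'.and self_mem_nhdsWithin).exists
  have hs : 0 < s := hs
  have := ((mem_extremePoints.mp h).2 _ h1 _ h2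
    ⟨1 / 2, 1 / 2, by norm_num, by norm_num, by norm_num, by ext <;> simp⟩).1
  have := congrArg Prod.fst this
  simp at this
  exact hs.ne' this

lemma neg_extreme {P : Set Pt} (hs : ∀ p ∈ P, -p ∈ P) {e : Pt}
    (he : e ∈ Set.extremePoints ℝ P) : -e ∈ Set.extremePoints ℝ P := by
  rw [mem_extremePoints] at he ⊢
  refine ⟨hs _ he.1, fun a ha b hb hab => ?_⟩
  have := he.2 (-a) (hs _ ha) (-b) (hs _ hb) (by
    obtain ⟨s, t, h1, h2, h3, h4⟩ := hab
    refine ⟨s, t, h1, h2, h3, ?_⟩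
    rw [smul_neg, smul_neg, ← neg_add, h4, neg_neg])
  exact ⟨by rw [← this.1, neg_neg], by rw [← this.2, neg_neg]⟩

lemma par_smul {a b : Pt} (ha : a ≠ 0) (h : cr a b = 0) : ∃ t : ℝ, b = t • a := by
  have hpos : 0 < a.1 ^ 2 + a.2 ^ 2 := by
    by_contra hc
    apply ha
    have h1 : a.1 = 0 := by nlinarith [sq_nonneg a.1, sq_nonneg a.2]
    have h2 : a.2 = 0 := by nlinarith [sq_nonneg a.1, sq_nonneg a.2]
    ext <;> simp [h1, h2]
  refine ⟨(b.1 * a.1 + b.2 * a.2) / (a.1 ^ 2 + a.2 ^ 2), ?_⟩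
  simp only [cr] at h
  ext
  · simp only [Prod.smul_fst, smul_eq_mul]
    field_simp
    linear_combination -a.2 * h
  · simp only [Prod.smul_snd, smul_eq_mul]
    field_simp
    linear_combination a.1 * h

/-- Sorting: half of the vertices in angular order. -/
lemma exists_half {P : Set Pt} {m : ℕ} (hm : 3 ≤ m) (hc : Convex ℝ P)
    (hzint : (0 : Pt) ∈ interior P) (hs : ∀ p ∈ P, -p ∈ P)
    (hfin : (Set.extremePoints ℝ P).Finite) (hcard : (Set.extremePoints ℝ P).ncard = 2 * m) :
    ∃ h : ℕ → Pt, (∀ i < m, h i ∈ Set.extremePoints ℝ P) ∧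
      (∀ i j, i < j → j < m → 0 < cr (h i) (h j)) ∧
      ∀ q ∈ Set.extremePoints ℝ P, ∃ i < m, q = h i ∨ q = - h i := by
  classical
  have h0 : (0 : Pt) ∈ P := interior_subset hzint
  set E : Finset Pt := hfin.toFinset with hE
  have hmem : ∀ q, q ∈ E ↔ q ∈ Set.extremePoints ℝ P := by intro q; simp [hE]
  have hEcard : E.card = 2 * m := by
    rw [hE, ← Set.ncard_eq_toFinset_card _ hfin, hcard]
  have hne0 : ∀ q ∈ E, q ≠ 0 := by
    rintro q hq rfl
    exact not_extreme_zero hzint ((hmem _).mp hq)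
  obtain ⟨A, hA⟩ : E.Nonempty := by rw [← Finset.card_pos]; omega
  have hA0 := hne0 A hA
  have hnegE : ∀ q, q ∈ E → -q ∈ E := fun q hq => (hmem _).mpr (neg_extreme hs ((hmem _).mp hq))
  set H : Finset Pt := E.filter (fun q => 0 < cr A q) with hH
  set H' : Finset Pt := E.filter (fun q => cr A q < 0) with hH'
  set Z : Finset Pt := E.filter (fun q => cr A q = 0) with hZ
  have hHH' : H'.card = H.card := by
    have : H' = H.image (fun q => -q) := by
      ext q
      simp only [hH, hH', Finset.mem_filter, Finset.mem_image]
      constructor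
      · rintro ⟨h1, h2⟩
        refine ⟨-q, ⟨hnegE q h1, ?_⟩, neg_neg q⟩
        rw [Gon.cr_neg_right]; linarith
      · rintro ⟨r, ⟨h1, h2⟩, rfl⟩
        refine ⟨hnegE r h1, ?_⟩
        rw [Gon.cr_neg_right]; linarith
    rw [this, Finset.card_image_of_injective _ neg_injective]
  have hZeq : Z = {A, -A} := by
    ext q
    simp only [hZ, Finset.mem_filter, Finset.mem_insert, Finset.mem_singleton]
    constructor
    · rintro ⟨h1, h2⟩
      obtain ⟨t, ht⟩ := par_smul hA0 h2
      rcases lt_trichotomy t 0 with h3 | h3 | h3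
      · right
        refine ray_aux hc h0 ((hmem _).mp h1) ((hmem _).mp (hnegE A hA)) (t := -t) (by linarith) ?_
        rw [ht]; simp
      · exfalso
        apply hne0 q h1
        rw [ht, h3, zero_smul]
      · left
        exact ray_aux hc h0 ((hmem _).mp h1) ((hmem _).mp hA) h3 ht
    · rintro (rfl | rfl)
      · exact ⟨hA, by simp only [cr]; ring⟩
      · exact ⟨hnegE A hA, by rw [Gon.cr_neg_right]; simp only [cr]; ring⟩
  have hZcard : Z.card = 2 := by
    rw [hZeq, Finset.card_pair]
    exact fun h => hA0 (self_eq_neg.mp h)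
  have hHcard : H.card = m - 1 := by
    have hEu : E = (H ∪ H') ∪ Z := by
      ext q
      simp only [hH, hH', hZ, Finset.mem_union, Finset.mem_filter]
      constructor
      · intro h
        rcases lt_trichotomy (cr A q) 0 with h1 | h1 | h1 <;> simp [h, h1]
      · tauto
    have d1 : Disjoint H H' := by
      rw [Finset.disjoint_left]
      intro q h1 h2
      have h1 := (Finset.mem_filter.mp h1).2
      have h2 := (Finset.mem_filter.mp h2).2
      linarith
    have d2 : Disjoint (H ∪ H') Z := by
      rw [Finset.disjoint_left]
      intro q h1 h2
      have h2 := (Finset.mem_filter.mp h2).2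
      rcases Finset.mem_union.mp h1 with h1 | h1
      · have h1 := (Finset.mem_filter.mp h1).2
        linarith
      · have h1 := (Finset.mem_filter.mp h1).2
        linarith
    have := congrArg Finset.card hEu
    rw [Finset.card_union_of_disjoint d2, Finset.card_union_of_disjoint d1, hEcard, hHH',
      hZcard] at this
    omega
  have hHpos : ∀ q ∈ H, 0 < cr A q := fun q hq => (Finset.mem_filter.mp hq).2
  have hHE : ∀ q ∈ H, q ∈ E := fun q hq => (Finset.mem_filter.mp hq).1
  have hApos : 0 < A.1 ^ 2 + A.2 ^ 2 := by
    by_contra hcon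
    apply hA0
    have h1 : A.1 = 0 := by nlinarith [sq_nonneg A.1, sq_nonneg A.2]
    have h2 : A.2 = 0 := by nlinarith [sq_nonneg A.1, sq_nonneg A.2]
    ext <;> simp [h1, h2]
  set key : Pt → ℝ := fun q => -(A.1 * q.1 + A.2 * q.2) / cr A q with hkey
  have ident : ∀ q r : Pt, (A.1 ^ 2 + A.2 ^ 2) * cr q r =
      (A.1 * q.1 + A.2 * q.2) * cr A r - (A.1 * r.1 + A.2 * r.2) * cr A q := by
    intro q r; simp only [cr]; ring
  have key_lt : ∀ q ∈ H, ∀ r ∈ H, key q < key r → 0 < cr q r := by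
    intro q hq r hr h
    simp only [hkey] at h
    rw [div_lt_div_iff₀ (hHpos q hq) (hHpos r hr)] at h
    have := ident q r
    have : 0 < (A.1 ^ 2 + A.2 ^ 2) * cr q r := by rw [this]; linarith
    exact (mul_pos_iff_of_pos_left hApos).mp this
  have key_inj : Set.InjOn key H := by
    intro q hq r hr h
    have hq : q ∈ H := hq
    have hr : r ∈ H := hr
    simp only [hkey] at h
    rw [div_eq_div_iff (hHpos q hq).ne' (hHpos r hr).ne'] at h
    have h1 : (A.1 ^ 2 + A.2 ^ 2) * cr q r = 0 := by rw [ident q r]; linarith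
    have h2 := (mul_eq_zero.mp h1).resolve_left hApos.ne'
    obtain ⟨t, ht⟩ := par_smul (hne0 q (hHE q hq)) h2
    have h3 := hHpos r hr
    rw [ht, Gon.cr_smul_right] at h3
    have ht0 : 0 < t := (pos_iff_pos_of_mul_pos h3).mpr (hHpos q hq)
    exact (ray_aux hc h0 ((hmem _).mp (hHE r hr)) ((hmem _).mp (hHE q hq)) ht0 ht).symm
  have hKcard : (H.image key).card = m - 1 := by
    rw [Finset.card_image_of_injOn key_inj, hHcard]
  set o := (H.image key).orderEmbOfFin hKcard with ho
  have hex : ∀ i : Fin (m - 1), ∃ q ∈ H, key q = o i := by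
    intro i
    have := Finset.orderEmbOfFin_mem (H.image key) hKcard i
    exact Finset.mem_image.mp this
  choose p hpH hpk using hex
  refine ⟨fun i => if hi : 1 ≤ i ∧ i < m then p ⟨i - 1, by omega⟩ else A, ?_, ?_, ?_⟩
  · intro i _
    dsimp only
    split_ifs with hi
    · exact (hmem _).mp (hHE _ (hpH _))
    · exact (hmem _).mp hA
  · intro i j hij hj
    dsimp only
    rw [dif_pos (show 1 ≤ j ∧ j < m by omega)]
    split_ifs with hi
    · apply key_lt _ (hpH _) _ (hpH _)
      rw [hpk, hpk]
      apply o.strictMono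
      simp only [Fin.mk_lt_mk]
      omega
    · exact hHpos _ (hpH _)
  · intro q hq
    have hq := (hmem _).mpr hq
    have inH : ∀ r ∈ H, ∃ i : Fin (m - 1), r = p i := by
      intro r hr
      have : key r ∈ Set.range o := by
        rw [ho, Finset.range_orderEmbOfFin]
        exact Finset.mem_coe.mpr (Finset.mem_image_of_mem key hr)
      obtain ⟨i, hi⟩ := this
      exact ⟨i, key_inj hr (hpH i) (by rw [hpk, hi])⟩
    have fin : ∀ i : Fin (m - 1), (1 ≤ i.1 + 1 ∧ i.1 + 1 < m) := fun i => by
      have := i.2; omega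
    rcases lt_trichotomy (cr A q) 0 with h1 | h1 | h1
    · obtain ⟨i, hi⟩ := inH (-q) (Finset.mem_filter.mpr ⟨hnegE q hq, by
        rw [Gon.cr_neg_right]; linarith⟩)
      refine ⟨i.1 + 1, (fin i).2, Or.inr ?_⟩
      dsimp only
      rw [dif_pos (fin i)]
      simp only [Nat.add_sub_cancel, ← hi, neg_neg]
    · have : q ∈ Z := Finset.mem_filter.mpr ⟨hq, h1⟩
      rw [hZeq] at this
      refine ⟨0, by omega, ?_⟩
      simpa using this
    · obtain ⟨i, hi⟩ := inH q (Finset.mem_filter.mpr ⟨hq, h1⟩)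
      refine ⟨i.1 + 1, (fin i).2, Or.inl ?_⟩
      dsimp only
      rw [dif_pos (fin i)]
      simp only [Nat.add_sub_cancel, ← hi]

lemma exists_gon {P : Set Pt} {m : ℕ} (hm : 3 ≤ m) (hc : Convex ℝ P) (hcomp : IsCompact P)
    (hzint : (0 : Pt) ∈ interior P) (hs : ∀ p ∈ P, -p ∈ P)
    (hfin : (Set.extremePoints ℝ P).Finite) (hcard : (Set.extremePoints ℝ P).ncard = 2 * m)
    (hhull : P = convexHull ℝ (Set.extremePoints ℝ P)) : ∃ v, Gon P m v := by
  obtain ⟨h, h1, h2, h3⟩ := exists_half hm hc hzint hs hfin hcard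
  have h0 : (0 : Pt) ∈ P := interior_subset hzint
  have mpos : 0 < m := by omega
  set v : ℕ → Pt := fun n => (-1 : ℝ) ^ (n / m) • h (n % m) with hv
  have per : ∀ i, v (i + m) = - v i := by
    intro i
    simp only [hv]
    rw [Nat.add_div_right _ mpos, Nat.add_mod_right, pow_succ]
    simp
  have base : ∀ i < m, v i = h i := by
    intro i hi
    simp only [hv]
    rw [Nat.div_eq_of_lt hi, Nat.mod_eq_of_lt hi]; simp
  have ext : ∀ i, v i ∈ Set.extremePoints ℝ P := by
    intro i
    simp only [hv]
    have := h1 (i % m) (Nat.mod_lt _ mpos)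
    rcases neg_one_pow_eq_or ℝ (i / m) with e | e <;> rw [e]
    · simpa using this
    · simpa using neg_extreme hs this
  clear_value v
  have ang : ∀ i j, i < j → j < i + m → 0 < cr (v i) (v j) := by
    intro i
    induction i using Nat.strong_induction_on with
    | _ i ih =>
      intro j hij hj
      by_cases him : i < m
      · by_cases hjm : j < m
        · rw [base i him, base j hjm]; exact h2 i j hij hjm
        · obtain ⟨l, rfl⟩ := Nat.exists_eq_add_of_le' (Nat.le_of_not_lt hjm)
          rw [per, Gon.cr_neg_right, ← Gon.cr_swap, base i him, base l (by omega)]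
          exact h2 l i (by omega) him
      · obtain ⟨a, rfl⟩ := Nat.exists_eq_add_of_le' (Nat.le_of_not_lt him)
        obtain ⟨b, rfl⟩ := Nat.exists_eq_add_of_le' (show m ≤ j by omega)
        rw [per, per, Gon.cr_neg_right, Gon.cr_neg_left, neg_neg]
        exact ih a (by omega) b (by omega) (by omega)
  have hmemP : ∀ i, v i ∈ P := fun i => extremePoints_subset (ext i)
  -- the strict support property for forward indices
  have Lcomb : ∀ i (a b : ℝ), L v i (a • v i + b • v (i + 1)) =
      cr (v i) (v (i + 1)) * (1 - a - b) := by
    intro i a b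
    rw [Gon.L_comb, Gon.L_self, Gon.L_self', Gon.L_zero]; ring
  have supp : ∀ i l, i + 1 < l → l < i + 2 * m → 0 < L v i (v l) := by
    intro i l hl1 hl2
    have hd : 0 < cr (v i) (v (i + 1)) := ang i (i + 1) (by omega) (by omega)
    have hsol := Gon.solve hd (v l)
    rcases lt_trichotomy l (i + m) with hl | hl | hl
    · have hb : 0 < cr (v i) (v l) / cr (v i) (v (i + 1)) := div_pos (ang _ _ (by omega) hl) hd
      have ha : cr (v l) (v (i + 1)) / cr (v i) (v (i + 1)) < 0 := by
        apply div_neg_of_neg_of_pos _ hd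
        rw [Gon.cr_swap]
        linarith [ang (i + 1) l hl1 (by omega)]
      set a := cr (v l) (v (i + 1)) / cr (v i) (v (i + 1))
      set b := cr (v i) (v l) / cr (v i) (v (i + 1))
      rw [hsol, Lcomb]
      apply mul_pos hd
      by_contra hcon
      have hb1 : 1 < b := by linarith
      have hb0 : b ≠ 0 := hb.ne'
      have e : v l = v (i + 1) := by
        refine extreme_aux hc h0 (ext (i + 1)) (hmemP l) (hmemP i) (a := b⁻¹) (b := -a / b)
          (inv_pos.mpr hb) (inv_lt_one_of_one_lt₀ hb1) (div_nonneg (by linarith) hb.le) ?_ ?_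
        · rw [inv_eq_one_div, ← add_div, div_le_one hb]; linarith
        · rw [hsol, smul_add, smul_smul, smul_smul, inv_mul_cancel₀ hb0, one_smul,
            show b⁻¹ * a = a / b by rw [div_eq_inv_mul], neg_div]
          module
      have := ang (i + 1) l hl1 (by omega)
      rw [e] at this
      simp only [cr] at this
      linarith
    · rw [hl, per]
      have := Lcomb i (-1) 0
      simp only [neg_smul, one_smul, zero_smul, add_zero] at this
      rw [this]
      linarith
    · obtain ⟨r, rfl⟩ := Nat.exists_eq_add_of_le' (show m ≤ l by omega)
      rcases (show i + 1 ≤ r by omega).eq_or_lt with hr | hr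
      · rw [← hr, per]
        have := Lcomb i 0 (-1)
        simp only [neg_smul, one_smul, zero_smul, zero_add] at this
        rw [this]
        linarith
      · have hb : cr (v i) (v (r + m)) / cr (v i) (v (i + 1)) < 0 := by
          apply div_neg_of_neg_of_pos _ hd
          rw [per, Gon.cr_neg_right]
          linarith [ang i r (by omega) (by omega)]
        have ha : 0 < cr (v (r + m)) (v (i + 1)) / cr (v i) (v (i + 1)) := by
          apply div_pos _ hd
          rw [per, Gon.cr_neg_left, ← Gon.cr_swap]
          exact ang (i + 1) r hr (by omega)
        set a := cr (v (r + m)) (v (i + 1)) / cr (v i) (v (i + 1))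
        set b := cr (v i) (v (r + m)) / cr (v i) (v (i + 1))
        rw [hsol, Lcomb]
        apply mul_pos hd
        by_contra hcon
        have ha1 : 1 < a := by linarith
        have ha0 : a ≠ 0 := ha.ne'
        have e : v (r + m) = v i := by
          refine extreme_aux hc h0 (ext i) (hmemP (r + m)) (hmemP (i + 1)) (a := a⁻¹) (b := -b / a)
            (inv_pos.mpr ha) (inv_lt_one_of_one_lt₀ ha1) (div_nonneg (by linarith) ha.le) ?_ ?_
          · rw [inv_eq_one_div, ← add_div, div_le_one ha]; linarith
          · rw [hsol, smul_add, smul_smul, smul_smul, inv_mul_cancel₀ ha0, one_smul,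
              show a⁻¹ * b = b / a by rw [div_eq_inv_mul], neg_div]
            module
        have := ang i r (by omega) (by omega)
        rw [per] at e
        rw [← e] at this
        simp only [cr, Prod.fst_neg, Prod.snd_neg] at this
        linarith
  have periodic : Function.Periodic v (2 * m) := by
    intro i
    rw [two_mul, ← add_assoc, per, per, neg_neg]
  -- every vertex index can be moved into the window `[i, i + 2m)`
  have window : ∀ i k, ∃ l, i ≤ l ∧ l < i + 2 * m ∧ v k = v l := by
    intro i k
    refine ⟨i + (k + (2 * m - 1) * i) % (2 * m), by omega, ?_, ?_⟩
    · have := Nat.mod_lt (k + (2 * m - 1) * i) (show 0 < 2 * m by omega)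
      omega
    · rw [← periodic.map_mod_nat (i + _), ← periodic.map_mod_nat k, Nat.add_mod_mod]
      congr 1
      have : i + (k + (2 * m - 1) * i) = k + 2 * m * i := by
        obtain ⟨c, hc⟩ : ∃ c, 2 * m = c + 1 := ⟨2 * m - 1, by omega⟩
        rw [hc]; simp only [Nat.add_sub_cancel]; ring
      rw [this, Nat.add_mul_mod_self_left]
  have strict : ∀ i k, 0 ≤ L v i (v k) ∧ (L v i (v k) = 0 → v k = v i ∨ v k = v (i + 1)) := by
    intro i k
    obtain ⟨l, hl1, hl2, e⟩ := window i k
    rw [e]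
    rcases hl1.eq_or_lt with h | h
    · subst h
      exact ⟨(Gon.L_self v i).ge, fun _ => Or.inl rfl⟩
    rcases (show i + 1 ≤ l from h).eq_or_lt with h | h
    · subst h
      exact ⟨(Gon.L_self' v i).ge, fun _ => Or.inr rfl⟩
    · have := supp i l h hl2
      exact ⟨this.le, fun h => absurd h this.ne'⟩
  refine ⟨v, ⟨hm, per, ang, hc, hcomp, h0, hmemP, ?_, fun i k => (strict i k).2⟩⟩
  intro i q hq
  rw [hhull] at hq
  have hconv : Convex ℝ {q : Pt | 0 ≤ L v i q} := by
    intro p hp q hq a b ha hb hab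
    have hp : 0 ≤ L v i p := hp
    have hq : 0 ≤ L v i q := hq
    show 0 ≤ L v i (a • p + b • q)
    rw [Gon.L_comb, show 1 - a - b = 0 by linarith]
    have := mul_nonneg ha hp
    have := mul_nonneg hb hq
    linarith
  refine convexHull_min ?_ hconv hq
  intro r hr
  show 0 ≤ L v i r
  obtain ⟨j, hj, e | e⟩ := h3 r hr
  · rw [e, ← base j hj]; exact (strict i j).1
  · rw [e, ← base j hj, ← per]; exact (strict i (j + m)).1

lemma centered_bound {m : ℕ} {P : Set Pt} (hm : 3 ≤ m)
    (hP : IsConvexPolygon P (2 * m)) (hsym : CentrallySymmetric P) {I : Type} {x : I → Pt} {k : ℕ}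
    (hk : 0 < k) (ht : IsKFoldTranslativeTiling P x k) :
    2 * ((m - 2) / 2) + (m - 1) ≤ 2 * k := by
  obtain ⟨hc, hcomp, hzint, hfin, hcard, hhull⟩ := hP
  obtain ⟨c, hcs⟩ := hsym
  set f : Pt ≃ₜ Pt := Homeomorph.addRight c with hf
  have fa : ∀ q, f q = q + c := fun q => rfl
  set Q : Set Pt := f ⁻¹' P with hQ
  have memQ : ∀ q, q ∈ Q ↔ q + c ∈ P := fun q => Iff.rfl
  have hsegm : ∀ (a b : ℝ) (p q : Pt), a + b = 1 → a • p + b • q + c = a • (p + c) + b • (q + c) := by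
    intro a b p q hab
    have : a • (p + c) + b • (q + c) = a • p + b • q + (a + b) • c := by module
    rw [this, hab, one_smul]
  have hQc : Convex ℝ Q := by
    intro p hp q hq a b ha hb hab
    rw [memQ, hsegm a b p q hab]
    exact hc hp hq ha hb hab
  have hQcomp : IsCompact Q := f.isCompact_preimage.mpr hcomp
  have hQs : ∀ p ∈ Q, -p ∈ Q := by
    intro p hp
    rw [memQ] at hp ⊢
    have := (hcs _).mp hp
    rwa [show c + c - (p + c) = -p + c by abel] at this
  have hQint : interior Q = f ⁻¹' interior P := (f.preimage_interior P).symm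
  have hne : (interior Q).Nonempty := by
    obtain ⟨q, hq⟩ := hzint
    refine ⟨q - c, ?_⟩
    rw [hQint]
    show q - c + c ∈ interior P
    rwa [sub_add_cancel]
  have h0 : (0 : Pt) ∈ interior Q := by
    obtain ⟨q, hq⟩ := hne
    have hQn : Q = -Q := by
      ext p
      rw [Set.mem_neg]
      exact ⟨hQs p, fun h => by simpa using hQs _ h⟩
    have hq2 : -q ∈ interior Q := by
      rw [mem_interior] at hq ⊢
      obtain ⟨t, ht1, ht2, ht3⟩ := hq
      refine ⟨-t, fun p hp => ?_, ht2.neg, by simpa using ht3⟩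
      have := hQs _ (ht1 hp)
      simpa using this
    have := hQc.interior hq hq2 (a := 1 / 2) (b := 1 / 2) (by norm_num) (by norm_num) (by norm_num)
    simpa using this
  have hopen : ∀ (p q r : Pt), r ∈ openSegment ℝ p q → r + c ∈ openSegment ℝ (p + c) (q + c) := by
    rintro p q r ⟨a, b, ha, hb, hab, rfl⟩
    exact ⟨a, b, ha, hb, hab, (hsegm a b p q hab).symm⟩
  have hopen' : ∀ (p q r : Pt), r + c ∈ openSegment ℝ p q → r ∈ openSegment ℝ (p - c) (q - c) := by
    rintro p q r ⟨a, b, ha, hb, hab, h⟩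
    refine ⟨a, b, ha, hb, hab, ?_⟩
    have := hsegm a b (p - c) (q - c) hab
    rw [sub_add_cancel, sub_add_cancel, h] at this
    exact add_right_cancel this
  have hext : Set.extremePoints ℝ Q = f ⁻¹' Set.extremePoints ℝ P := by
    ext r
    rw [Set.mem_preimage, fa, mem_extremePoints, mem_extremePoints]
    constructor
    · rintro ⟨h1, h2⟩
      refine ⟨h1, fun p hp q hq h => ?_⟩
      have := h2 (p - c) (by rw [memQ, sub_add_cancel]; exact hp) (q - c)
        (by rw [memQ, sub_add_cancel]; exact hq) (hopen' p q r h)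
      exact ⟨sub_eq_iff_eq_add.mp this.1, sub_eq_iff_eq_add.mp this.2⟩
    · rintro ⟨h1, h2⟩
      refine ⟨h1, fun p hp q hq h => ?_⟩
      have := h2 (p + c) hp (q + c) hq (hopen p q r h)
      exact ⟨add_right_cancel this.1, add_right_cancel this.2⟩
  have hQfin : (Set.extremePoints ℝ Q).Finite := by
    rw [hext]
    exact hfin.preimage f.injective.injOn
  have hQcard : (Set.extremePoints ℝ Q).ncard = 2 * m := by
    rw [hext, Set.ncard_preimage_of_injective_subset_range f.injective, hcard]
    rw [f.surjective.range_eq]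
    exact Set.subset_univ _
  have hQhull : Q = convexHull ℝ (Set.extremePoints ℝ Q) := by
    have h1 := closure_convexHull_extremePoints hQcomp hQc
    rw [(hQfin.isCompact_convexHull (𝕜 := ℝ)).isClosed.closure_eq] at h1
    exact h1.symm
  obtain ⟨v, g⟩ := exists_gon hm hQc hQcomp h0 hQs hQfin hQcard hQhull
  refine g.bound (x := fun i => x i + c) hk ⟨?_, ?_, ?_⟩
  · intro B hB
    have hB' : Bornology.IsBounded ((fun p : Pt => p - c) '' B) := by
      have : (fun p : Pt => p - c) '' B = B + {-c} := by
        rw [Set.add_singleton]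
        simp only [sub_eq_add_neg]
      rw [this]
      exact hB.add Bornology.isBounded_singleton
    refine (ht.1 _ hB').subset ?_
    intro i hi
    exact ⟨x i + c, hi, add_sub_cancel_right _ _⟩
  · intro p
    have e : ∀ i, p - (x i + c) ∈ Q ↔ p - x i ∈ P := by
      intro i
      rw [memQ, show p - (x i + c) + c = p - x i by abel]
    simp only [e]
    exact ht.2.1 p
  · intro p
    have e : ∀ i, p - (x i + c) ∈ interior Q ↔ p - x i ∈ interior P := by
      intro i
      rw [hQint, Set.mem_preimage, fa, show p - (x i + c) + c = p - x i by abel]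
    simp only [e]
    exact ht.2.2 p

/-- a centrally symmetric convex `2m`-gon admits no `k`-fold translative tiling
for any positive `k < m − 1` when `m` is even, and none for any positive `k < m − 2` when `m`
is odd (so `τ*(P) ≥ τ(P) ≥ m − 1`, resp. `m − 2`). -/
theorem gon_translative_lower_bound (m : ℕ) (P : Set Pt)
    (hP : IsConvexPolygon P (2 * m)) (hsym : CentrallySymmetric P) :
    (Even m → ∀ (I : Type) (x : I → Pt) (k : ℕ), 0 < k → k < m - 1 →
      ¬IsKFoldTranslativeTiling P x k) ∧
    (Odd m → ∀ (I : Type) (x : I → Pt) (k : ℕ), 0 < k → k < m - 2 →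
      ¬IsKFoldTranslativeTiling P x k) := by
  constructor
  · rintro ⟨n, rfl⟩ I x k hk hlt ht
    have := centered_bound (by omega) hP hsym hk ht
    omega
  · rintro ⟨n, rfl⟩ I x k hk hlt ht
    have := centered_bound (by omega) hP hsym hk ht
    omega
end
end
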